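/- Let c_{2l}(b) = Σ_{w excursion, |w| = 2l} e^{ibθ^w} (a finite sum, real-valued). Then as l → ∞: for fixed b ∈ (0,2), c_{2l}(b) ∼ sin²(πb/4)·(Γ(1+b)/π)·4^{2(l+1−b)}/l^{b+1}; for b = 0, c_{2l}(0) ∼ (π/(l·log²l))·4^{2l}; and for b = 2, c_{2l}(2) ∼ 4^{2l}/(4πl³). -/

import Mathlib

open Complex Real Set

noncomputable section

/-- A lattice point `(x,y)` viewed as the complex number `x + iy`. -/
def ptC (p : ℤ × ℤ) : ℂ := (p.1 : ℂ) + (p.2 : ℂ) * Complex.I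

/-- A diagonal step on `ℤ²`. -/
def IsDiagStep (a b : ℤ × ℤ) : Prop :=
  b - a = (1, 1) ∨ b - a = (1, -1) ∨ b - a = (-1, -1) ∨ b - a = (-1, 1)

/-- A rectilinear step on `ℤ²`. -/
def IsRectStep (a b : ℤ × ℤ) : Prop :=
  b - a = (1, 0) ∨ b - a = (-1, 0) ∨ b - a = (0, 1) ∨ b - a = (0, -1)

/-- `w` encodes a simple diagonal walk `(w₀, …, w_n)` as a list of length `n+1`. -/
def IsWalkList (w : List (ℤ × ℤ)) : Prop := w ≠ [] ∧ w.Chain' IsDiagStep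

/-- Winding angle of the walk `w` around the origin up to time `i`. -/
def windTo (w : List (ℤ × ℤ)) (i : ℕ) : ℝ :=
  ∑ j ∈ Finset.range i, (ptC (w.getD (j + 1) 0) / ptC (w.getD j 0)).arg

/-- The full winding angle of the walk `w` around the origin. -/
def wind (w : List (ℤ × ℤ)) : ℝ := windTo w (w.length - 1)

/-- The condition on walks counted by `W^{(α,I)}_{l,p}`: a simple diagonal walk on
`ℤ² ∖ {0}` from `(p,0)` to a point on one of the axes at distance `l` from the origin,
with full winding angle `α` and intermediate winding angles in `I`. -/
def WCond (l p : ℕ) (α : ℝ) (I : Set ℝ) (w : List (ℤ × ℤ)) : Prop :=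
  IsWalkList w ∧ (∀ x ∈ w, x ≠ (0, 0)) ∧ w.head? = some ((p : ℤ), 0) ∧
    (w.getLast? = some ((l : ℤ), 0) ∨ w.getLast? = some (-(l : ℤ), 0) ∨
      w.getLast? = some (0, (l : ℤ)) ∨ w.getLast? = some (0, -(l : ℤ))) ∧
    wind w = α ∧ (∀ i, 1 ≤ i → i ≤ w.length - 2 → windTo w i ∈ I)

/-- The generating function `W^{(α,I)}_{l,p}(t)`. -/
def Wgen (t : ℝ) (l p : ℕ) (α : ℝ) (I : Set ℝ) : ℝ :=
  ∑' w : {w : List (ℤ × ℤ) // WCond l p α I w}, t ^ (w.val.length - 1)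

/-- The complete elliptic integral of the first kind `K(k)`. -/
def Kell (k : ℝ) : ℝ := ∫ y in (0:ℝ)..1, 1 / Real.sqrt ((1 - y ^ 2) * (1 - k ^ 2 * y ^ 2))

/-- The complete elliptic integral of the second kind `E(k)`. -/
def Eell (k : ℝ) : ℝ := ∫ y in (0:ℝ)..1, Real.sqrt (1 - k ^ 2 * y ^ 2) / Real.sqrt (1 - y ^ 2)

/-- The complementary modulus `k' = √(1-k²)`. -/
def kComp (k : ℝ) : ℝ := Real.sqrt (1 - k ^ 2)

/-- The elliptic nome `q_k = exp(-π K(k')/K(k))`. -/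
def qNome (k : ℝ) : ℝ := Real.exp (-π * Kell (kComp k) / Kell k)

/-- The descending Landen transformation `k₁ = (1-k')/(1+k')`. -/
def kLanden (k : ℝ) : ℝ := (1 - kComp k) / (1 + kComp k)

/-- `T_k = K(k')/(4K(k))`. -/
def Tell (k : ℝ) : ℝ := Kell (kComp k) / (4 * Kell k)

/-- The plane minus the two real slits `{z ∈ ℝ : z² ≥ κ}`. -/
def slitDom (κ : ℝ) : Set ℂ := {z : ℂ | ¬(z.im = 0 ∧ κ ≤ z.re ^ 2)}

/-- `v` is the analytic function `v_κ` on `ℂ ∖ {z ∈ ℝ : z² ≥ κ}` with `v 0 = 0` and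
`v'(z) = 1/(4K(κ)√((κ-z²)(1-κz²)))`, the branch of the square root being positive on
`(-√κ, √κ)` (by analytic continuation this determines `v` uniquely). -/
structure IsVmap (κ : ℝ) (v : ℂ → ℂ) : Prop where
  map_zero : v 0 = 0
  analytic : AnalyticOnNhd ℂ v (slitDom κ)
  deriv_real : ∀ x : ℝ, x ^ 2 < κ →
    HasDerivAt v ((1 / (4 * Kell κ * Real.sqrt ((κ - x ^ 2) * (1 - κ * x ^ 2))) : ℝ) : ℂ)
      (x : ℂ)

/-- The function `f_m(z) = cos(2πm(v(z) + 1/4)) - cos(πm/2)` built from `v = v_{k₁}`. -/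
def fmFun (v : ℂ → ℂ) (m : ℕ) (z : ℂ) : ℂ :=
  Complex.cos (2 * (π : ℂ) * m * (v z + 1 / 4)) - Complex.cos ((π : ℂ) * m / 2)

/-- `a n m` is the (real) Taylor coefficient `[zⁿ] f_m(z)` at `0`. -/
def IsCoeff (κ : ℝ) (v : ℂ → ℂ) (a : ℕ → ℕ → ℝ) : Prop :=
  ∀ m : ℕ, 1 ≤ m → ∀ z : ℂ, z ∈ slitDom κ → ‖z‖ < 1 →
    HasSum (fun n : ℕ => (a n m : ℂ) * z ^ n) (fmFun v m z)

/-- An excursion: a nonempty simple diagonal walk from the origin to the origin with no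
intermediate visits to the origin. -/
def IsExcursion (w : List (ℤ × ℤ)) : Prop :=
  2 ≤ w.length ∧ w.Chain' IsDiagStep ∧ w.head? = some (0, 0) ∧ w.getLast? = some (0, 0) ∧
    ∀ i, 1 ≤ i → i ≤ w.length - 2 → w.getD i 0 ≠ (0, 0)

/-- The winding angle sequence of an excursion: `θ₀ = θ₁ = 0`, increments of the first and
last step do not contribute, and `θ_n = θ_{n-1}`. -/
def windExcTo (w : List (ℤ × ℤ)) (i : ℕ) : ℝ :=
  ∑ j ∈ Finset.Icc 2 (min i (w.length - 2)), (ptC (w.getD j 0) / ptC (w.getD (j - 1) 0)).arg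

/-- The full winding angle of an excursion. -/
def windExc (w : List (ℤ × ℤ)) : ℝ := windExcTo w (w.length - 1)

/-- `F^{(α)}(t)`: generating function of excursions with winding angle `α`. -/
def Fgen (t α : ℝ) : ℝ :=
  ∑' w : {w : List (ℤ × ℤ) // IsExcursion w ∧ windExc w = α}, t ^ (w.val.length - 1)

/-- `F(t,b) = Σ_w t^{|w|} e^{i b θ^w}`, the characteristic function of excursions. -/
def Fchar (t b : ℝ) : ℂ :=
  ∑' w : {w : List (ℤ × ℤ) // IsExcursion w},
    (t : ℂ) ^ (w.val.length - 1) * Complex.exp (Complex.I * b * windExc w.val)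

/-- `ψ_k(z) = (1 - √(1-kz²))/(√k z)` (principal square root), `ψ_k(0) = 0`. -/
def psiK (k : ℝ) (z : ℂ) : ℂ :=
  if z = 0 then 0 else (1 - (1 - (k : ℂ) * z ^ 2) ^ ((1 : ℂ) / 2)) / ((Real.sqrt k : ℂ) * z)

/-- `c_L(b) = Σ_{w excursion, |w| = L} e^{i b θ^w}` (a finite sum). -/
def cExc (L : ℕ) (b : ℝ) : ℂ :=
  ∑' w : {w : List (ℤ × ℤ) // IsExcursion w ∧ w.length - 1 = L},
    Complex.exp (Complex.I * b * windExc w.val)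

/-- The incomplete elliptic integral of the first kind, with parameter `m`. -/
def ellInt (m φ : ℝ) : ℝ := ∫ x in (0:ℝ)..φ, 1 / √(1 - m * Real.sin x ^ 2)

/-- The quarter period. -/
def ellK (m : ℝ) : ℝ := ellInt m (π / 2)

/-- The Jacobi amplitude: the inverse function of the incomplete elliptic integral. -/
def jam (m : ℝ) : ℝ → ℝ := Function.invFun (ellInt m)

section Amplitude

variable {m : ℝ}

lemma one_sub_mul_sin_sq_pos (h0 : 0 ≤ m) (h1 : m < 1) (x : ℝ) : 0 < 1 - m * Real.sin x ^ 2 := by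
  nlinarith [Real.sin_sq_le_one x, sq_nonneg (Real.sin x)]

lemma one_sub_mul_sin_sq_ge (h0 : 0 ≤ m) (x : ℝ) : 1 - m ≤ 1 - m * Real.sin x ^ 2 := by
  nlinarith [Real.sin_sq_le_one x, sq_nonneg (Real.sin x)]

lemma continuous_ellInt_integrand (h0 : 0 ≤ m) (h1 : m < 1) :
    Continuous fun x : ℝ => 1 / √(1 - m * Real.sin x ^ 2) := by
  refine continuous_const.div (by fun_prop) fun x => ?_
  exact (Real.sqrt_pos.2 (one_sub_mul_sin_sq_pos h0 h1 x)).ne'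

lemma hasDerivAt_ellInt (h0 : 0 ≤ m) (h1 : m < 1) (φ : ℝ) :
    HasDerivAt (ellInt m) (1 / √(1 - m * Real.sin φ ^ 2)) φ :=
  (continuous_ellInt_integrand h0 h1).integral_hasStrictDerivAt 0 φ |>.hasDerivAt

lemma strictMono_ellInt (h0 : 0 ≤ m) (h1 : m < 1) : StrictMono (ellInt m) :=
  strictMono_of_hasDerivAt_pos (fun φ => hasDerivAt_ellInt h0 h1 φ) fun φ => by
    have := Real.sqrt_pos.2 (one_sub_mul_sin_sq_pos h0 h1 φ)
    positivity

lemma continuous_ellInt (h0 : 0 ≤ m) (h1 : m < 1) : Continuous (ellInt m) :=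
  continuous_iff_continuousAt.2 fun φ => (hasDerivAt_ellInt h0 h1 φ).continuousAt

@[simp] lemma ellInt_zero : ellInt m 0 = 0 := by simp [ellInt]

lemma ellInt_neg (φ : ℝ) : ellInt m (-φ) = -ellInt m φ := by
  unfold ellInt
  have := intervalIntegral.integral_comp_neg (a := 0) (b := φ)
    (fun x : ℝ => 1 / √(1 - m * Real.sin x ^ 2))
  simp only [Real.sin_neg, neg_sq, neg_zero] at this
  rw [this, intervalIntegral.integral_symm]

lemma ellInt_add_pi (h0 : 0 ≤ m) (h1 : m < 1) (φ : ℝ) :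
    ellInt m (φ + π) = ellInt m φ + 2 * ellK m := by
  have hc := continuous_ellInt_integrand h0 h1
  have hper : Function.Periodic (fun x : ℝ => 1 / √(1 - m * Real.sin x ^ 2)) π := by
    intro x; simp [Real.sin_add_pi]
  have h2 : ellInt m (φ + π) = ellInt m φ + ∫ x in φ..(φ + π), 1 / √(1 - m * Real.sin x ^ 2) := by
    unfold ellInt
    rw [intervalIntegral.integral_add_adjacent_intervals] <;> exact hc.intervalIntegrable _ _
  have h3 := hper.intervalIntegral_add_eq φ (-(π / 2))
  have h4 : (∫ x in (-(π / 2))..(-(π / 2) + π), 1 / √(1 - m * Real.sin x ^ 2))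
      = ellInt m (π / 2) - ellInt m (-(π / 2)) := by
    unfold ellInt
    rw [intervalIntegral.integral_interval_sub_left (hc.intervalIntegrable _ _)
      (hc.intervalIntegrable _ _)]
    congr 1; ring
  rw [h2, h3, h4, ellInt_neg]; unfold ellK; ring

lemma le_ellInt (h0 : 0 ≤ m) (h1 : m < 1) {φ : ℝ} (hφ : 0 ≤ φ) : φ ≤ ellInt m φ := by
  have : ∫ x in (0:ℝ)..φ, (1:ℝ) ≤ ellInt m φ := by
    refine intervalIntegral.integral_mono_on hφ (by simp)
      ((continuous_ellInt_integrand h0 h1).intervalIntegrable _ _) fun x _ => ?_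
    rw [le_div_iff₀ (Real.sqrt_pos.2 (one_sub_mul_sin_sq_pos h0 h1 x)), one_mul]
    refine Real.sqrt_le_one.2 ?_
    nlinarith [sq_nonneg (Real.sin x)]
  simpa using this

lemma surjective_ellInt (h0 : 0 ≤ m) (h1 : m < 1) : Function.Surjective (ellInt m) := by
  refine (continuous_ellInt h0 h1).surjective ?_ ?_
  · exact Filter.tendsto_atTop_mono' _ (Filter.eventually_ge_atTop 0 |>.mono
      fun φ hφ => le_ellInt h0 h1 hφ) Filter.tendsto_id
  · refine Filter.tendsto_atBot_mono' _ (Filter.eventually_le_atBot 0 |>.mono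
      fun φ hφ => ?_) Filter.tendsto_id
    have := le_ellInt h0 h1 (neg_nonneg.2 hφ)
    rw [ellInt_neg] at this
    simpa using neg_le_neg this

lemma ellInt_jam (h0 : 0 ≤ m) (h1 : m < 1) (u : ℝ) : ellInt m (jam m u) = u :=
  Function.rightInverse_invFun (surjective_ellInt h0 h1) u

lemma jam_ellInt (h0 : 0 ≤ m) (h1 : m < 1) (φ : ℝ) : jam m (ellInt m φ) = φ :=
  Function.leftInverse_invFun (strictMono_ellInt h0 h1).injective φ

lemma continuous_jam (h0 : 0 ≤ m) (h1 : m < 1) : Continuous (jam m) := by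
  let e := (strictMono_ellInt h0 h1).orderIsoOfSurjective _ (surjective_ellInt h0 h1)
  have : jam m = e.symm := by
    funext u
    apply (strictMono_ellInt h0 h1).injective
    rw [ellInt_jam h0 h1]
    exact (e.apply_symm_apply u).symm
  rw [this]; exact e.symm.continuous

lemma hasDerivAt_jam (h0 : 0 ≤ m) (h1 : m < 1) (u : ℝ) :
    HasDerivAt (jam m) (√(1 - m * Real.sin (jam m u) ^ 2)) u := by
  have hp := Real.sqrt_pos.2 (one_sub_mul_sin_sq_pos h0 h1 (jam m u))
  have := HasDerivAt.of_local_left_inverse (f := ellInt m) (g := jam m) (a := u)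
    (continuous_jam h0 h1).continuousAt (hasDerivAt_ellInt h0 h1 (jam m u)) (by positivity)
    (Filter.Eventually.of_forall (ellInt_jam h0 h1))
  simpa using this

@[simp] lemma jam_zero (h0 : 0 ≤ m) (h1 : m < 1) : jam m 0 = 0 := by
  simpa using jam_ellInt h0 h1 0

lemma jam_neg (h0 : 0 ≤ m) (h1 : m < 1) (u : ℝ) : jam m (-u) = -jam m u := by
  apply (strictMono_ellInt h0 h1).injective
  rw [ellInt_neg, ellInt_jam h0 h1, ellInt_jam h0 h1]

lemma jam_ellK (h0 : 0 ≤ m) (h1 : m < 1) : jam m (ellK m) = π / 2 := jam_ellInt h0 h1 _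

lemma jam_add_period (h0 : 0 ≤ m) (h1 : m < 1) (u : ℝ) :
    jam m (u + 2 * ellK m) = jam m u + π := by
  apply (strictMono_ellInt h0 h1).injective
  rw [ellInt_add_pi h0 h1, ellInt_jam h0 h1, ellInt_jam h0 h1]

lemma strictMono_jam (h0 : 0 ≤ m) (h1 : m < 1) : StrictMono (jam m) := by
  intro u v huv
  rw [← (strictMono_ellInt h0 h1).lt_iff_lt, ellInt_jam h0 h1, ellInt_jam h0 h1]
  exact huv

lemma ellK_pos (h0 : 0 ≤ m) (h1 : m < 1) : 0 < ellK m :=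
  lt_of_lt_of_le (by positivity) (le_ellInt h0 h1 (by positivity : 0 ≤ π / 2))

end Amplitude

/-- The Jacobi elliptic functions of parameter `m`, on the real line. -/
def jsn (m u : ℝ) : ℝ := Real.sin (jam m u)
def jcn (m u : ℝ) : ℝ := Real.cos (jam m u)
def jdn (m u : ℝ) : ℝ := √(1 - m * jsn m u ^ 2)

section Jacobi

variable {m : ℝ}

lemma jcn_sq (m u : ℝ) : jcn m u ^ 2 = 1 - jsn m u ^ 2 := by
  have := Real.sin_sq_add_cos_sq (jam m u)
  unfold jcn jsn; linarith

lemma jdn_sq (h0 : 0 ≤ m) (h1 : m < 1) (u : ℝ) : jdn m u ^ 2 = 1 - m * jsn m u ^ 2 :=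
  Real.sq_sqrt (one_sub_mul_sin_sq_pos h0 h1 _).le

lemma jdn_pos (h0 : 0 ≤ m) (h1 : m < 1) (u : ℝ) : 0 < jdn m u :=
  Real.sqrt_pos.2 (one_sub_mul_sin_sq_pos h0 h1 _)

lemma hasDerivAt_jam' (h0 : 0 ≤ m) (h1 : m < 1) (u : ℝ) : HasDerivAt (jam m) (jdn m u) u :=
  hasDerivAt_jam h0 h1 u

lemma hasDerivAt_jsn (h0 : 0 ≤ m) (h1 : m < 1) (u : ℝ) :
    HasDerivAt (jsn m) (jcn m u * jdn m u) u :=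
  (Real.hasDerivAt_sin _).comp u (hasDerivAt_jam' h0 h1 u)

lemma hasDerivAt_jcn (h0 : 0 ≤ m) (h1 : m < 1) (u : ℝ) :
    HasDerivAt (jcn m) (-(jsn m u * jdn m u)) u := by
  have := (Real.hasDerivAt_cos _).comp u (hasDerivAt_jam' h0 h1 u)
  rw [neg_mul] at this
  exact this

lemma hasDerivAt_jdn (h0 : 0 ≤ m) (h1 : m < 1) (u : ℝ) :
    HasDerivAt (jdn m) (-(m * jsn m u * jcn m u)) u := by
  have h := (((hasDerivAt_jsn h0 h1 u).pow 2).const_mul m).const_sub 1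
  have h2 := h.sqrt (one_sub_mul_sin_sq_pos h0 h1 _).ne'
  have hp := jdn_pos h0 h1 u
  refine HasDerivAt.congr_deriv (f := jdn m) h2 ?_
  change _ / (2 * jdn m u) = _
  rw [div_eq_iff (by positivity)]
  push_cast
  ring

lemma continuous_jsn (h0 : 0 ≤ m) (h1 : m < 1) : Continuous (jsn m) :=
  Real.continuous_sin.comp (continuous_jam h0 h1)

lemma continuous_jcn (h0 : 0 ≤ m) (h1 : m < 1) : Continuous (jcn m) :=
  Real.continuous_cos.comp (continuous_jam h0 h1)

lemma continuous_jdn (h0 : 0 ≤ m) (h1 : m < 1) : Continuous (jdn m) := by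
  have := continuous_jsn h0 h1
  unfold jdn; fun_prop

lemma jsn_neg (h0 : 0 ≤ m) (h1 : m < 1) (u : ℝ) : jsn m (-u) = -jsn m u := by
  simp [jsn, jam_neg h0 h1]

lemma jcn_neg (h0 : 0 ≤ m) (h1 : m < 1) (u : ℝ) : jcn m (-u) = jcn m u := by
  simp [jcn, jam_neg h0 h1]

lemma jdn_neg (h0 : 0 ≤ m) (h1 : m < 1) (u : ℝ) : jdn m (-u) = jdn m u := by
  simp [jdn, jsn_neg h0 h1]

lemma jsn_zero (h0 : 0 ≤ m) (h1 : m < 1) : jsn m 0 = 0 := by simp [jsn, jam_zero h0 h1]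

lemma jcn_zero (h0 : 0 ≤ m) (h1 : m < 1) : jcn m 0 = 1 := by simp [jcn, jam_zero h0 h1]

lemma jdn_zero (h0 : 0 ≤ m) (h1 : m < 1) : jdn m 0 = 1 := by simp [jdn, jsn_zero h0 h1]

lemma jsn_add_period (h0 : 0 ≤ m) (h1 : m < 1) (u : ℝ) : jsn m (u + 2 * ellK m) = -jsn m u := by
  simp [jsn, jam_add_period h0 h1, Real.sin_add_pi]

lemma jdn_periodic (h0 : 0 ≤ m) (h1 : m < 1) : Function.Periodic (jdn m) (2 * ellK m) := fun u => by
  simp [jdn, jsn_add_period h0 h1]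

lemma jsn_sq_le_one (m u : ℝ) : jsn m u ^ 2 ≤ 1 := Real.sin_sq_le_one _

lemma one_sub_mul_jsn_sq_mul_pos (h0 : 0 ≤ m) (h1 : m < 1) (u v : ℝ) :
    0 < 1 - m * jsn m u ^ 2 * jsn m v ^ 2 := by
  have h2 := jsn_sq_le_one m u
  have h3 := jsn_sq_le_one m v
  have : jsn m u ^ 2 * jsn m v ^ 2 ≤ 1 := mul_le_one₀ h2 (sq_nonneg _) h3
  nlinarith [mul_nonneg (sq_nonneg (jsn m u)) (sq_nonneg (jsn m v))]

/-- Addition theorem for `dn`. -/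
lemma jdn_add (h0 : 0 ≤ m) (h1 : m < 1) (u v : ℝ) :
    jdn m (u + v) = (jdn m u * jdn m v - m * jsn m u * jcn m u * jsn m v * jcn m v) /
      (1 - m * jsn m u ^ 2 * jsn m v ^ 2) := by
  set w := u + v with hw
  let f : ℝ → ℝ := fun v => (jdn m (w - v) * jdn m v -
    m * jsn m (w - v) * jcn m (w - v) * jsn m v * jcn m v) /
      (1 - m * jsn m (w - v) ^ 2 * jsn m v ^ 2)
  have hf : ∀ x, HasDerivAt f 0 x := by
    intro x
    have hs : HasDerivAt (fun v : ℝ => w - v) (-1) x := by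
      simpa using (hasDerivAt_id x).const_sub w
    have a1 := (hasDerivAt_jsn h0 h1 (w - x)).comp x hs
    have a2 := (hasDerivAt_jcn h0 h1 (w - x)).comp x hs
    have a3 := (hasDerivAt_jdn h0 h1 (w - x)).comp x hs
    have b1 := hasDerivAt_jsn h0 h1 x
    have b2 := hasDerivAt_jcn h0 h1 x
    have b3 := hasDerivAt_jdn h0 h1 x
    have hne := (one_sub_mul_jsn_sq_mul_pos h0 h1 (w - x) x).ne'
    have := ((a3.mul b3).sub ((((a1.const_mul m).mul a2).mul b1).mul b2)).div
      ((((a1.pow 2).const_mul m).mul (b1.pow 2)).const_sub 1) hne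
    refine this.congr_deriv ?_
    simp only [Function.comp_apply, Pi.mul_apply, Pi.sub_apply, Pi.pow_apply]
    rw [div_eq_zero_iff]; left
    have e1 := jcn_sq m (w - x)
    have e2 := jcn_sq m x
    have e3 := jdn_sq h0 h1 (w - x)
    have e4 := jdn_sq h0 h1 x
    generalize jsn m (w - x) = s at *
    generalize jcn m (w - x) = c at *
    generalize jdn m (w - x) = d at *
    generalize jsn m x = s' at *
    generalize jcn m x = c' at *
    generalize jdn m x = d' at *
    clear this a1 a2 a3 b1 b2 b3 hs hne
    push_cast
    simp only [pow_one]
    grind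
  have hc : ∀ x y, f x = f y :=
    is_const_of_deriv_eq_zero (fun x => (hf x).differentiableAt) fun x => (hf x).deriv
  have h3 := hc v 0
  simp only [f, hw, add_sub_cancel_right, sub_zero, jsn_zero h0 h1, jcn_zero h0 h1,
    jdn_zero h0 h1] at h3
  rw [h3, hw]; simp

end Jacobi

lemma hasDerivAt_integral_of_continuousOn {F F' : ℝ → ℝ → ℝ} {U : Set ℝ} (hU : IsOpen U)
    (hd : ∀ v ∈ U, ∀ u, HasDerivAt (fun v => F v u) (F' v u) v)
    (hc : ContinuousOn (Function.uncurry F') (U ×ˢ univ)) (hF : ∀ v ∈ U, Continuous (F v))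
    (a b : ℝ) {v₀ : ℝ} (hv : v₀ ∈ U) :
    HasDerivAt (fun v => ∫ u in a..b, F v u) (∫ u in a..b, F' v₀ u) v₀ := by
  obtain ⟨ε, hε, hball⟩ := Metric.nhds_basis_closedBall.mem_iff.1 (hU.mem_nhds hv)
  have hK : IsCompact (Metric.closedBall v₀ ε ×ˢ uIcc a b) :=
    (isCompact_closedBall _ _).prod isCompact_uIcc
  obtain ⟨C, hC⟩ := hK.exists_bound_of_continuousOn
    (hc.mono (prod_mono hball (subset_univ _)))
  refine (intervalIntegral.hasDerivAt_integral_of_dominated_loc_of_deriv_le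
    (s := Metric.closedBall v₀ ε) (bound := fun _ => C) (Metric.closedBall_mem_nhds _ hε)
    ?_ ((hF _ hv).intervalIntegrable _ _) ?_ ?_ intervalIntegrable_const ?_).2
  · filter_upwards [hU.mem_nhds hv] with v hv using (hF v hv).aestronglyMeasurable
  · have : Continuous (F' v₀) := by
      rw [← continuousOn_univ]
      exact hc.comp (f := fun u => (v₀, u)) (by fun_prop) fun u _ => ⟨hv, mem_univ _⟩
    exact this.aestronglyMeasurable
  · exact Filter.Eventually.of_forall fun u hu v hv => hC (v, u) ⟨hv, uIoc_subset_uIcc hu⟩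
  · exact Filter.Eventually.of_forall fun u hu v hv => hd v (hball hv) u

section DnFourier

variable {m : ℝ}

/-- `cn² v + m sn² u sn² v`, the denominator of `dn (u + i v)`. -/
def dnDen (m u v : ℝ) : ℝ := jcn (1 - m) v ^ 2 + m * jsn m u ^ 2 * jsn (1 - m) v ^ 2

/-- The real part of `dn (u + i v)`. -/
def dnRe (m u v : ℝ) : ℝ := jdn m u * jcn (1 - m) v * jdn (1 - m) v / dnDen m u v

/-- The imaginary part of `dn (u + i v)`. -/
def dnIm (m u v : ℝ) : ℝ := -(m * jsn m u * jcn m u * jsn (1 - m) v) / dnDen m u v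

/-- The `v`-derivative of `dnRe`. -/
def dnReV (m u v : ℝ) : ℝ :=
  ((jdn m u * -(jsn (1 - m) v * jdn (1 - m) v)) * jdn (1 - m) v +
    jdn m u * jcn (1 - m) v * -((1 - m) * jsn (1 - m) v * jcn (1 - m) v)) / dnDen m u v -
  jdn m u * jcn (1 - m) v * jdn (1 - m) v *
    (2 * jcn (1 - m) v * -(jsn (1 - m) v * jdn (1 - m) v) +
      m * jsn m u ^ 2 * (2 * jsn (1 - m) v * (jcn (1 - m) v * jdn (1 - m) v))) / dnDen m u v ^ 2

/-- The `u`-derivative of `dnRe`. -/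
def dnReU (m u v : ℝ) : ℝ :=
  -(m * jsn m u * jcn m u) * jcn (1 - m) v * jdn (1 - m) v / dnDen m u v -
  jdn m u * jcn (1 - m) v * jdn (1 - m) v *
    (m * (2 * jsn m u * (jcn m u * jdn m u)) * jsn (1 - m) v ^ 2) / dnDen m u v ^ 2

lemma jcn_pos (h0 : 0 ≤ m) (h1 : m < 1) {v : ℝ} (hv : v ∈ Ioo (-ellK m) (ellK m)) : 0 <
    jcn m v := by
  apply Real.cos_pos_of_mem_Ioo
  rw [← jam_ellK h0 h1, ← jam_neg h0 h1]
  exact ⟨strictMono_jam h0 h1 hv.1, strictMono_jam h0 h1 hv.2⟩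

lemma dnDen_pos (h0 : 0 < m) (h1 : m < 1) {v : ℝ} (hv : v ∈ Ioo (-ellK (1 - m)) (ellK (1 - m)))
    (u : ℝ) : 0 < dnDen m u v := by
  have := jcn_pos (by linarith) (by linarith) hv
  unfold dnDen
  positivity

lemma hasDerivAt_dnRe_right (h0 : 0 < m) (h1 : m < 1) {v : ℝ}
    (hv : v ∈ Ioo (-ellK (1 - m)) (ellK (1 - m))) (u : ℝ) :
    HasDerivAt (fun v => dnRe m u v) (dnReV m u v) v := by
  have hp := dnDen_pos h0 h1 hv u
  have i0 : (0:ℝ) ≤ 1 - m := by linarith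
  have i1 : 1 - m < 1 := by linarith
  have hs := hasDerivAt_jsn i0 i1 v
  have hc := hasDerivAt_jcn i0 i1 v
  have hd := hasDerivAt_jdn i0 i1 v
  have hD : HasDerivAt (fun v => dnDen m u v) _ v := (hc.pow 2).add ((hs.pow 2).const_mul (m * jsn
      m u ^ 2))
  have := ((hc.const_mul (jdn m u)).mul hd).div hD hp.ne'
  refine this.congr_deriv ?_
  have hp' := hp.ne'
  simp only [dnReV, Pi.mul_apply]
  field_simp
  ring

lemma hasDerivAt_dnRe_left (h0 : 0 < m) (h1 : m < 1) {v : ℝ}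
    (hv : v ∈ Ioo (-ellK (1 - m)) (ellK (1 - m))) (u : ℝ) :
    HasDerivAt (fun u => dnRe m u v) (dnReU m u v) u := by
  have hp := dnDen_pos h0 h1 hv u
  have hs := hasDerivAt_jsn h0.le h1 u
  have hc := hasDerivAt_jcn h0.le h1 u
  have hd := hasDerivAt_jdn h0.le h1 u
  have hD : HasDerivAt (fun u => dnDen m u v) _ u :=
    (((hs.pow 2).const_mul m).mul_const (jsn (1 - m) v ^ 2)).const_add (jcn (1 - m) v ^ 2)
  have := ((hd.mul_const (jcn (1 - m) v)).mul_const (jdn (1 - m) v)).div hD hp.ne'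
  refine this.congr_deriv ?_
  have hp' := hp.ne'
  simp only [dnReU]
  field_simp
  ring

lemma hasDerivAt_dnIm_left (h0 : 0 < m) (h1 : m < 1) {v : ℝ}
    (hv : v ∈ Ioo (-ellK (1 - m)) (ellK (1 - m))) (u : ℝ) :
    HasDerivAt (fun u => dnIm m u v) (-dnReV m u v) u := by
  have hp := dnDen_pos h0 h1 hv u
  have i0 : (0:ℝ) ≤ 1 - m := by linarith
  have i1 : 1 - m < 1 := by linarith
  have hs := hasDerivAt_jsn h0.le h1 u
  have hc := hasDerivAt_jcn h0.le h1 u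
  have hD : HasDerivAt (fun u => dnDen m u v) _ u :=
    (((hs.pow 2).const_mul m).mul_const (jsn (1 - m) v ^ 2)).const_add (jcn (1 - m) v ^ 2)
  have := (((hs.const_mul m).mul hc).mul_const (jsn (1 - m) v)).neg.div hD hp.ne'
  refine this.congr_deriv ?_
  have hp' := hp.ne'
  have e1 := jcn_sq m u
  have e2 := jdn_sq h0.le h1 u
  have e3 := jcn_sq (1 - m) v
  have e4 := jdn_sq i0 i1 v
  have e5 : dnDen m u v = jcn (1 - m) v ^ 2 + m * jsn m u ^ 2 * jsn (1 - m) v ^ 2 := rfl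
  simp only [dnReV, Pi.mul_apply, Pi.neg_apply]
  field_simp
  generalize jsn m u = s at *
  generalize jcn m u = c at *
  generalize jdn m u = d at *
  generalize jsn (1 - m) v = s' at *
  generalize jcn (1 - m) v = c' at *
  generalize jdn (1 - m) v = d' at *
  generalize dnDen m u v = D at *
  subst e5
  grind

lemma hasDerivAt_dnIm_right (h0 : 0 < m) (h1 : m < 1) {v : ℝ}
    (hv : v ∈ Ioo (-ellK (1 - m)) (ellK (1 - m))) (u : ℝ) :
    HasDerivAt (fun v => dnIm m u v) (dnReU m u v) v := by
  have hp := dnDen_pos h0 h1 hv u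
  have i0 : (0:ℝ) ≤ 1 - m := by linarith
  have i1 : 1 - m < 1 := by linarith
  have hs := hasDerivAt_jsn i0 i1 v
  have hc := hasDerivAt_jcn i0 i1 v
  have hD : HasDerivAt (fun v => dnDen m u v) _ v := (hc.pow 2).add ((hs.pow 2).const_mul (m * jsn
      m u ^ 2))
  have := (hs.const_mul (m * jsn m u * jcn m u)).neg.div hD hp.ne'
  refine this.congr_deriv ?_
  have hp' := hp.ne'
  have e1 := jcn_sq m u
  have e2 := jdn_sq h0.le h1 u
  have e3 := jcn_sq (1 - m) v
  have e4 := jdn_sq i0 i1 v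
  have e5 : dnDen m u v = jcn (1 - m) v ^ 2 + m * jsn m u ^ 2 * jsn (1 - m) v ^ 2 := rfl
  simp only [dnReU, Pi.neg_apply]
  field_simp
  generalize jsn m u = s at *
  generalize jcn m u = c at *
  generalize jdn m u = d at *
  generalize jsn (1 - m) v = s' at *
  generalize jcn (1 - m) v = c' at *
  generalize jdn (1 - m) v = d' at *
  generalize dnDen m u v = D at *
  subst e5
  grind

lemma continuousOn_dnDen_parts (h0 : 0 < m) (h1 : m < 1) :
    ContinuousOn (Function.uncurry fun v u => dnReV m u v)
      (Ioo (-ellK (1 - m)) (ellK (1 - m)) ×ˢ univ) ∧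
    ContinuousOn (Function.uncurry fun v u => dnReU m u v)
      (Ioo (-ellK (1 - m)) (ellK (1 - m)) ×ˢ univ) ∧
    ContinuousOn (Function.uncurry fun v u => dnRe m u v)
      (Ioo (-ellK (1 - m)) (ellK (1 - m)) ×ˢ univ) ∧
    ContinuousOn (Function.uncurry fun v u => dnIm m u v)
      (Ioo (-ellK (1 - m)) (ellK (1 - m)) ×ˢ univ) := by
  have i0 : (0:ℝ) ≤ 1 - m := by linarith
  have i1 : 1 - m < 1 := by linarith
  have c1 := continuous_jsn h0.le h1
  have c2 := continuous_jcn h0.le h1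
  have c3 := continuous_jdn h0.le h1
  have c4 := continuous_jsn i0 i1
  have c5 := continuous_jcn i0 i1
  have c6 := continuous_jdn i0 i1
  have cD : Continuous fun p : ℝ × ℝ => dnDen m p.2 p.1 := by unfold dnDen; fun_prop
  have hne : ∀ p ∈ Ioo (-ellK (1 - m)) (ellK (1 - m)) ×ˢ (univ : Set ℝ), dnDen m p.2 p.1 ≠ 0 :=
    fun p hp => (dnDen_pos h0 h1 hp.1 _).ne'
  have hne2 : ∀ p ∈ Ioo (-ellK (1 - m)) (ellK (1 - m)) ×ˢ (univ : Set ℝ), dnDen m p.2 p.1 ^ 2 ≠ 0 :=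
    fun p hp => pow_ne_zero _ (hne p hp)
  refine ⟨?_, ?_, ?_, ?_⟩
  · exact (ContinuousOn.div (by fun_prop) cD.continuousOn hne).sub
      (ContinuousOn.div (by fun_prop) (cD.pow 2).continuousOn hne2)
  · exact (ContinuousOn.div (by fun_prop) cD.continuousOn hne).sub
      (ContinuousOn.div (by fun_prop) (cD.pow 2).continuousOn hne2)
  · exact ContinuousOn.div (by fun_prop) cD.continuousOn hne
  · exact ContinuousOn.div (by fun_prop) cD.continuousOn hne

lemma continuous_section {f : ℝ → ℝ → ℝ} {U : Set ℝ}
    (hf : ContinuousOn (Function.uncurry f) (U ×ˢ univ)) {v : ℝ} (hv : v ∈ U) : Continuous (f v) :=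
        by
  rw [← continuousOn_univ]
  exact hf.comp (f := fun u => (v, u)) (by fun_prop) fun u _ => ⟨hv, mem_univ _⟩

lemma jcn_ellK (h0 : 0 ≤ m) (h1 : m < 1) : jcn m (ellK m) = 0 := by
  rw [jcn, jam_ellK h0 h1, Real.cos_pi_div_two]

lemma jsn_ellK (h0 : 0 ≤ m) (h1 : m < 1) : jsn m (ellK m) = 1 := by
  rw [jsn, jam_ellK h0 h1, Real.sin_pi_div_two]

lemma integral_dnRe_mul_cos (h0 : 0 < m) (h1 : m < 1) {ω : ℝ} (hω : Real.sin (ω * ellK m) =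
    0) {v : ℝ}
    (hv : v ∈ Ioo (-ellK (1 - m)) (ellK (1 - m))) :
    ∫ u in -ellK m..ellK m, dnRe m u v * Real.cos (ω * u) =
      (∫ u in -ellK m..ellK m, jdn m u * Real.cos (ω * u)) * Real.cosh (ω * v) := by
  have i0 : (0:ℝ) ≤ 1 - m := by linarith
  have i1 : 1 - m < 1 := by linarith
  obtain ⟨k1, k2, k3, k4⟩ := continuousOn_dnDen_parts h0 h1
  set U := Ioo (-ellK (1 - m)) (ellK (1 - m)) with hU
  set K := ellK m with hK
  set P : ℝ → ℝ := fun v => ∫ u in -K..K, dnRe m u v * Real.cos (ω * u) with hP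
  set Q : ℝ → ℝ := fun v => ∫ u in -K..K, dnIm m u v * Real.sin (ω * u) with hQ
  have hcos : ∀ u, HasDerivAt (fun u => Real.cos (ω * u)) (-(ω * Real.sin (ω * u))) u := fun u => by
    have := (Real.hasDerivAt_cos (ω * u)).comp u ((hasDerivAt_id u).const_mul ω)
    exact this.congr_deriv (by simp; ring)
  have hsin : ∀ u, HasDerivAt (fun u => Real.sin (ω * u)) (ω * Real.cos (ω * u)) u := fun u => by
    have := (Real.hasDerivAt_sin (ω * u)).comp u ((hasDerivAt_id u).const_mul ω)
    exact this.congr_deriv (by simp; ring)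
  have hP' : ∀ v ∈ U, HasDerivAt P (-ω * Q v) v := by
    intro v hv
    have h2 := hasDerivAt_integral_of_continuousOn (F := fun v u => dnRe m u v * Real.cos (ω * u))
      (F' := fun v u => dnReV m u v * Real.cos (ω * u)) isOpen_Ioo
      (fun v hv u => (hasDerivAt_dnRe_right h0 h1 hv u).mul_const _)
      (k1.mul (f := Function.uncurry fun v u => dnReV m u v) (g :=
          fun p => Real.cos (ω * p.2)) (by fun_prop))
      (fun v hv => (continuous_section k3 hv).mul (by fun_prop)) (-K) K hv
    refine h2.congr_deriv ?_
    have c1 := continuous_section k1 hv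
    have c4 := continuous_section k4 hv
    have h3 := intervalIntegral.integral_mul_deriv_eq_deriv_mul
      (u := fun u => Real.cos (ω * u)) (v := fun u => dnIm m u v) (a := -K) (b := K)
      (fun u _ => hcos u) (fun u _ => hasDerivAt_dnIm_left h0 h1 hv u)
      (by apply Continuous.intervalIntegrable; fun_prop) (c1.neg.intervalIntegrable _ _)
    have e1 : dnIm m K v = 0 := by simp [dnIm, jcn_ellK h0.le h1, hK]
    have e2 : dnIm m (-K) v = 0 := by simp [dnIm, jcn_neg h0.le h1, jcn_ellK h0.le h1, hK]
    rw [e1, e2] at h3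
    have e3 : ∫ u in -K..K, dnReV m u v * Real.cos (ω * u) =
        -∫ u in -K..K, Real.cos (ω * u) * -dnReV m u v := by
      rw [← intervalIntegral.integral_neg]; congr 1; funext u; ring
    have e4 : ∫ u in -K..K, -(ω * Real.sin (ω * u)) * dnIm m u v = -ω * Q v := by
      rw [hQ, ← intervalIntegral.integral_const_mul]; congr 1; funext u; ring
    rw [e3, h3, e4]; ring
  have hQ' : ∀ v ∈ U, HasDerivAt Q (-ω * P v) v := by
    intro v hv
    have h2 := hasDerivAt_integral_of_continuousOn (F := fun v u => dnIm m u v * Real.sin (ω * u))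
      (F' := fun v u => dnReU m u v * Real.sin (ω * u)) isOpen_Ioo
      (fun v hv u => (hasDerivAt_dnIm_right h0 h1 hv u).mul_const _)
      (k2.mul (f := Function.uncurry fun v u => dnReU m u v) (g :=
          fun p => Real.sin (ω * p.2)) (by fun_prop))
      (fun v hv => (continuous_section k4 hv).mul (by fun_prop)) (-K) K hv
    refine h2.congr_deriv ?_
    have c1 := continuous_section k2 hv
    have c4 := continuous_section k3 hv
    have h3 := intervalIntegral.integral_mul_deriv_eq_deriv_mul
      (u := fun u => Real.sin (ω * u)) (v := fun u => dnRe m u v) (a := -K) (b := K)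
      (fun u _ => hsin u) (fun u _ => hasDerivAt_dnRe_left h0 h1 hv u)
      (by apply Continuous.intervalIntegrable; fun_prop) (c1.intervalIntegrable _ _)
    rw [mul_neg, Real.sin_neg, hω] at h3
    have e3 : ∫ u in -K..K, dnReU m u v * Real.sin (ω * u) =
        ∫ u in -K..K, Real.sin (ω * u) * dnReU m u v := by
      congr 1; funext u; ring
    have e4 : ∫ u in -K..K, (ω * Real.cos (ω * u)) * dnRe m u v = ω * P v := by
      rw [hP, ← intervalIntegral.integral_const_mul]; congr 1; funext u; ring
    rw [e3, h3, e4]; ring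
  have hK' : 0 < ellK (1 - m) := ellK_pos i0 i1
  have h0U : (0:ℝ) ∈ U := ⟨by linarith, hK'⟩
  have hQ0 : Q 0 = 0 := by simp [hQ, dnIm, jsn_zero i0 i1]
  have hP0 : P 0 = ∫ u in -K..K, jdn m u * Real.cos (ω * u) := by
    simp [hP, dnRe, dnDen, jsn_zero i0 i1, jcn_zero i0 i1, jdn_zero i0 i1]
  have hexp : ∀ (σ v : ℝ), HasDerivAt (fun v => Real.exp (σ * v)) (σ * Real.exp (σ * v)) v :=
      fun σ v => by
    have := (Real.hasDerivAt_exp (σ * v)).comp v ((hasDerivAt_id v).const_mul σ)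
    exact this.congr_deriv (by simp; ring)
  have hA : ∀ v ∈ U, HasDerivAt (fun v => (P v + Q v) * Real.exp (ω * v)) 0 v := fun v hv =>
    (((hP' v hv).add (hQ' v hv)).mul (hexp ω v)).congr_deriv (by simp only [Pi.add_apply]; ring)
  have hB : ∀ v ∈ U, HasDerivAt (fun v => (P v - Q v) * Real.exp (-ω * v)) 0 v := fun v hv =>
    (((hP' v hv).sub (hQ' v hv)).mul (hexp (-ω) v)).congr_deriv (by simp only [Pi.sub_apply]; ring)
  have hconst : ∀ f : ℝ → ℝ, (∀ v ∈ U, HasDerivAt f 0 v) → f v = f 0 := fun f hf =>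
    isOpen_Ioo.is_const_of_deriv_eq_zero isPreconnected_Ioo
      (fun v hv => (hf v hv).differentiableAt.differentiableWithinAt) (fun v hv => (hf v hv).deriv)
          hv h0U
  have a1 := hconst _ hA
  have a2 := hconst _ hB
  simp only [hQ0, hP0, mul_zero, Real.exp_zero, add_zero, sub_zero, mul_one] at a1 a2
  show P v = _
  rw [Real.cosh_eq]
  have b1 : Real.exp (ω * v) * Real.exp (-(ω * v)) = 1 := by rw [← Real.exp_add]; simp
  rw [neg_mul] at a2
  linear_combination (Real.exp (-(ω * v)) / 2) * a1 + (Real.exp (ω * v) / 2) * a2 - P v * b1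

lemma integral_jdn (h0 : 0 ≤ m) (h1 : m < 1) : ∫ u in -ellK m..ellK m, jdn m u = π := by
  rw [intervalIntegral.integral_eq_sub_of_hasDerivAt (fun u _ => hasDerivAt_jam' h0 h1 u)
    ((continuous_jdn h0 h1).intervalIntegrable _ _), jam_neg h0 h1, jam_ellK h0 h1]
  ring

lemma sqrt_mul_le_jam (h0 : 0 ≤ m) (h1 : m < 1) {u : ℝ} (hu : 0 ≤ u) : √(1 - m) * u ≤ jam m u := by
  have hmono : Monotone fun u => jam m u - √(1 - m) * u := by
    have hd : ∀ u, HasDerivAt (fun u => jam m u - √(1 - m) * u) _ u := fun u =>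
      (hasDerivAt_jam h0 h1 u).sub ((hasDerivAt_id u).const_mul _)
    refine monotone_of_deriv_nonneg (fun u => (hd u).differentiableAt) fun u => ?_
    rw [(hd u).deriv, mul_one, sub_nonneg]
    exact Real.sqrt_le_sqrt (one_sub_mul_sin_sq_ge h0 _)
  have := hmono hu
  simp only [jam_zero h0 h1, mul_zero, sub_zero] at this
  linarith

lemma jsn_sq_ge (h0 : 0 ≤ m) (h1 : m < 1) {u : ℝ} (hu : u ∈ Icc (-ellK m) (ellK m)) :
    (1 - m) / 4 * u ^ 2 ≤ jsn m u ^ 2 := by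
  wlog hu0 : 0 ≤ u generalizing u
  · have := this (u := -u) ⟨by linarith [hu.2], by linarith [hu.1]⟩ (by linarith)
    rwa [jsn_neg h0 h1, neg_sq, neg_sq] at this
  have h2 := sqrt_mul_le_jam h0 h1 hu0
  have h3 : 0 ≤ √(1 - m) * u := by positivity
  have h4 : jam m u ≤ π / 2 := by
    rw [← jam_ellK h0 h1]; exact (strictMono_jam h0 h1).monotone hu.2
  have h5 := Real.mul_le_sin (h3.trans h2) h4
  have h6 : 1 / 2 * (√(1 - m) * u) ≤ jsn m u := by
    refine le_trans ?_ h5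
    have : 1 / 2 ≤ 2 / π := by
      rw [div_le_div_iff₀ (by norm_num) Real.pi_pos]; linarith [Real.pi_le_four]
    gcongr
  calc _ = (1 / 2 * (√(1 - m) * u)) ^ 2 := by
        rw [mul_pow, mul_pow, Real.sq_sqrt (by linarith)]; ring
    _ ≤ _ := by gcongr

/-- The Fourier coefficients of `dn`. -/
lemma integral_jdn_mul_cos (h0 : 0 < m) (h1 : m < 1) {ω : ℝ} (hω : Real.sin (ω * ellK m) = 0) :
    ∫ u in -ellK m..ellK m, jdn m u * Real.cos (ω * u) = π / Real.cosh (ω * ellK (1 - m)) := by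
  have i0 : (0:ℝ) ≤ 1 - m := by linarith
  have i1 : 1 - m < 1 := by linarith
  obtain ⟨-, -, k3, -⟩ := continuousOn_dnDen_parts h0 h1
  set K := ellK m with hK
  set K' := ellK (1 - m) with hK'
  have hKp : 0 < K := ellK_pos h0.le h1
  have hK'p : 0 < K' := ellK_pos i0 i1
  set D := ∫ u in -K..K, jdn m u * Real.cos (ω * u) with hD
  set c0 := m * ((1 - m) / 4) with hc0
  have hc0p : 0 < c0 := by have : 0 < 1 - m := by linarith
                           positivity
  have hbound : ∀ v ∈ Ioo 0 K', |D * Real.cosh (ω * v) - π| ≤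
      (jcn (1 - m) v * ω ^ 2 / (c0 * jsn (1 - m) v ^ 2)) * (2 * K) := by
    intro v hv
    have hv' : v ∈ Ioo (-K') K' := ⟨by linarith [hv.1], hv.2⟩
    have hc := continuous_section k3 hv'
    have e1 := integral_dnRe_mul_cos h0 h1 hω hv'
    have e2 := integral_dnRe_mul_cos h0 h1 (ω := 0) (by simp) hv'
    simp only [zero_mul, Real.cos_zero, mul_one, Real.cosh_zero] at e2
    rw [integral_jdn h0.le h1, ← hK] at e2
    rw [← hK, ← hD] at e1
    have hcc : Continuous fun u => dnRe m u v * Real.cos (ω * u) := hc.mul (by fun_prop)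
    rw [← e1, ← e2, ← intervalIntegral.integral_sub
      (hcc.intervalIntegrable _ _) (hc.intervalIntegrable _ _)]
    have hcn := jcn_pos i0 i1 hv'
    have hsn : 0 < jsn (1 - m) v := by
      apply Real.sin_pos_of_mem_Ioo
      rw [← jam_zero i0 i1]
      refine ⟨strictMono_jam i0 i1 hv.1, ?_⟩
      have := strictMono_jam i0 i1 hv.2
      rw [hK', jam_ellK i0 i1] at this
      linarith [Real.pi_pos]
    have hdn := jdn_pos i0 i1 v
    have hdn1 : jdn (1 - m) v ≤ 1 := by
      have := jdn_sq i0 i1 v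
      nlinarith [sq_nonneg (jsn (1 - m) v)]
    have := intervalIntegral.norm_integral_le_of_norm_le_const (a := -K) (b := K)
      (C := jcn (1 - m) v * ω ^ 2 / (c0 * jsn (1 - m) v ^ 2))
      (f := fun u => dnRe m u v * Real.cos (ω * u) - dnRe m u v) (fun u hu => ?_)
    · rwa [show K - -K = 2 * K by ring, abs_of_pos (by linarith)] at this
    · rw [uIoc_of_le (by linarith)] at hu
      have hden := dnDen_pos h0 h1 hv' u
      have hdu := jdn_pos h0.le h1 u
      have hdu1 : jdn m u ≤ 1 := by
        have := jdn_sq h0.le h1 u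
        nlinarith [sq_nonneg (jsn m u)]
      have hcos := Real.one_sub_sq_div_two_le_cos (x := ω * u)
      have hcos1 := Real.cos_le_one (ω * u)
      have hs := jsn_sq_ge h0.le h1 ⟨hu.1.le, hu.2⟩
      rw [show dnRe m u v * Real.cos (ω * u) - dnRe m u v =
          -(dnRe m u v * (1 - Real.cos (ω * u))) by ring,
        norm_neg, Real.norm_eq_abs, dnRe, abs_of_nonneg (by
          have : 0 ≤ 1 - Real.cos (ω * u) := by linarith
          positivity), div_mul_eq_mul_div, div_le_div_iff₀ hden (by positivity)]
      have s1 : c0 * u ^ 2 * jsn (1 - m) v ^ 2 ≤ dnDen m u v := by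
        have : c0 * u ^ 2 ≤ m * jsn m u ^ 2 := by rw [hc0, mul_assoc]; gcongr
        unfold dnDen
        nlinarith [sq_nonneg (jcn (1 - m) v), sq_nonneg (jsn (1 - m) v)]
      have s2 : jdn m u * jcn (1 - m) v * jdn (1 - m) v ≤ jcn (1 - m) v := by
        calc _ ≤ 1 * jcn (1 - m) v * 1 := by gcongr
          _ = _ := by ring
      have s3 : 1 - Real.cos (ω * u) ≤ ω ^ 2 * u ^ 2 := by nlinarith [sq_nonneg (ω * u)]
      calc _ ≤ jcn (1 - m) v * (ω ^ 2 * u ^ 2) * (c0 * jsn (1 - m) v ^ 2) := by gcongr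
        _ = jcn (1 - m) v * ω ^ 2 * (c0 * u ^ 2 * jsn (1 - m) v ^ 2) := by ring
        _ ≤ _ := by gcongr
  have hnebot : (nhdsWithin K' (Ioo 0 K')).NeBot := by
    rw [nhdsWithin_Ioo_eq_nhdsLT hK'p]; infer_instance
  have hlim1 : Filter.Tendsto (fun v => |D * Real.cosh (ω * v) - π|) (nhdsWithin K' (Ioo 0 K'))
      (nhds |D * Real.cosh (ω * K') - π|) :=
    (Continuous.tendsto (by fun_prop) K').mono_left nhdsWithin_le_nhds
  have hlim2 : Filter.Tendsto (fun v => (jcn (1 - m) v * ω ^ 2 / (c0 * jsn (1 - m) v ^ 2)) * (2 *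
      K))
      (nhdsWithin K' (Ioo 0 K')) (nhds ((jcn (1 - m) K' * ω ^ 2 / (c0 * jsn (1 - m) K' ^ 2)) * (2 *
          K))) := by
    have c1 := continuous_jcn i0 i1
    have c2 := continuous_jsn i0 i1
    refine Filter.Tendsto.mono_left ?_ nhdsWithin_le_nhds
    refine (Filter.Tendsto.div (Continuous.tendsto (by fun_prop) K') (Continuous.tendsto (by
        fun_prop) K') ?_).mul_const _
    rw [hK', jsn_ellK i0 i1]; simpa using hc0p.ne'
  have := le_of_tendsto_of_tendsto hlim1 hlim2 (Filter.eventually_of_mem self_mem_nhdsWithin hbound)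
  rw [hK', jcn_ellK i0 i1] at this
  simp only [zero_mul, zero_div] at this
  have h9 := sub_eq_zero.1 (abs_nonpos_iff.1 this)
  rw [eq_div_iff (Real.cosh_pos _).ne']
  exact h9

end DnFourier

/-- The four diagonal steps. -/
def diagSteps : Finset (ℤ × ℤ) := {(1, 1), (1, -1), (-1, -1), (-1, 1)}

lemma isDiagStep_iff (x y : ℤ × ℤ) : IsDiagStep x y ↔ ∃ s ∈ diagSteps, y = x + s := by
  simp only [IsDiagStep, diagSteps, Finset.mem_insert, Finset.mem_singleton, sub_eq_iff_eq_add']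
  constructor
  · rintro (h | h | h | h) <;> exact ⟨_, by simp, h⟩
  · rintro ⟨s, rfl | rfl | rfl | rfl, h⟩ <;> simp [h]

/-- The weight of a single step. -/
def stepWt (b : ℝ) (x y : ℤ × ℤ) : ℂ := Complex.exp (Complex.I * b * (ptC y / ptC x).arg)

/-- The total weight of walks of length `n` from `x` to the origin avoiding it before. -/
def walkWt (b : ℝ) : ℕ → ℤ × ℤ → ℂ
  | 0, x => if x = 0 then 1 else 0
  | n + 1, x => if x = 0 then 0 else ∑ s ∈ diagSteps, stepWt b x (x + s) * walkWt b n (x + s)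

/-- The walks of length `n` from `x` to the origin avoiding it before. -/
def walksTo : ℕ → ℤ × ℤ → Finset (List (ℤ × ℤ))
  | 0, x => if x = 0 then {[0]} else ∅
  | n + 1, x => if x = 0 then ∅ else
      diagSteps.biUnion fun s => (walksTo n (x + s)).image (List.cons x)

lemma mem_walksTo (n : ℕ) (x : ℤ × ℤ) (w : List (ℤ × ℤ)) :
    w ∈ walksTo n x ↔ w.length = n + 1 ∧ w.IsChain IsDiagStep ∧ w.head? = some x ∧
      w.getLast? = some (0, 0) ∧ ∀ i < n, w.getD i 0 ≠ (0, 0) := by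
  induction n generalizing x w with
  | zero =>
    by_cases hx : x = 0
    · subst hx
      simp only [walksTo, if_true, Finset.mem_singleton]
      constructor
      · rintro rfl; simp; rfl
      · rintro ⟨h1, -, h3, -⟩
        obtain ⟨a, rfl⟩ := List.length_eq_one_iff.1 h1
        simpa using h3
    · simp only [walksTo, hx, if_false, Finset.notMem_empty, false_iff]
      rintro ⟨h1, -, h3, h4, -⟩
      obtain ⟨a, rfl⟩ := List.length_eq_one_iff.1 h1
      simp at h3 h4
      exact hx (h3 ▸ h4)
  | succ n ih =>
    by_cases hx : x = 0
    · simp only [walksTo, hx, if_true, Finset.notMem_empty, false_iff]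
      rintro ⟨h1, -, h3, h4, h5⟩
      cases w with
      | nil => simp at h1
      | cons a w => 
        have := h5 0 (by omega)
        simp at h3 this
        exact this h3
    · simp only [walksTo, hx, if_false, Finset.mem_biUnion, Finset.mem_image, ih]
      constructor
      · rintro ⟨s, hs, w', ⟨h1, h2, h3, h4, h5⟩, rfl⟩
        cases w' with
        | nil => simp at h1
        | cons a w' =>
          simp only [List.head?_cons, Option.some.injEq] at h3
          subst h3
          refine ⟨by simpa using h1, ?_, by simp, by simpa using h4, ?_⟩
          · rw [List.isChain_cons_cons]
            exact ⟨(isDiagStep_iff _ _).2 ⟨s, hs, rfl⟩, h2⟩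
          · intro i hi
            cases i with
            | zero => simp only [List.getD_cons_zero]; exact hx
            | succ i => simpa using h5 i (by omega)
      · rintro ⟨h1, h2, h3, h4, h5⟩
        match w, h1, h2, h3, h4, h5 with
        | [a], h1, _, _, _, _ => simp at h1
        | a :: y :: w', h1, h2, h3, h4, h5 =>
          simp only [List.head?_cons, Option.some.injEq] at h3
          subst h3
          rw [List.isChain_cons_cons] at h2
          obtain ⟨s, hs, rfl⟩ := (isDiagStep_iff _ _).1 h2.1
          refine ⟨s, hs, _, ⟨by simpa using h1, h2.2, by simp, by simpa using h4, ?_⟩, rfl⟩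
          intro i hi
          simpa using h5 (i + 1) (by omega)

lemma head_of_mem_walksTo {n : ℕ} {x : ℤ × ℤ} {w : List (ℤ × ℤ)} (h : w ∈ walksTo n x) :
    ∃ w', w = x :: w' := by
  obtain ⟨-, -, h3, -⟩ := (mem_walksTo n x w).1 h
  cases w with
  | nil => simp at h3
  | cons a w => simp at h3; exact ⟨w, by rw [h3]⟩

lemma windTo_cons_cons (x y : ℤ × ℤ) (w : List (ℤ × ℤ)) (n : ℕ) :
    windTo (x :: y :: w) (n + 1) = (ptC y / ptC x).arg + windTo (y :: w) n := by
  simp [windTo, Finset.sum_range_succ']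
  ring

lemma sum_walks_cons {β : Type*} [AddCommMonoid β] (n : ℕ) (x : ℤ × ℤ) (a : ℤ × ℤ)
    (f : List (ℤ × ℤ) → β) :
    ∑ w ∈ diagSteps.biUnion fun s => (walksTo n (x + s)).image (List.cons a), f w =
      ∑ s ∈ diagSteps, ∑ w ∈ walksTo n (x + s), f (a :: w) := by
  rw [Finset.sum_biUnion]
  · refine Finset.sum_congr rfl fun s _ => ?_
    rw [Finset.sum_image]
    intro p _ q _ h; simpa using h
  · intro s _ s' _ hss
    rw [Function.onFun, Finset.disjoint_left]
    intro w hw hw'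
    rw [Finset.mem_image] at hw hw'
    obtain ⟨p, hp, rfl⟩ := hw
    obtain ⟨q, hq, h⟩ := hw'
    obtain ⟨p', rfl⟩ := head_of_mem_walksTo hp
    obtain ⟨q', rfl⟩ := head_of_mem_walksTo hq
    simp at h
    exact hss h.1.symm

lemma sum_walksTo (b : ℝ) (n : ℕ) (x : ℤ × ℤ) :
    ∑ w ∈ walksTo n x, Complex.exp (Complex.I * b * windTo w n) = walkWt b n x := by
  induction n generalizing x with
  | zero => by_cases hx : x = 0 <;> simp [walksTo, walkWt, hx, windTo]
  | succ n ih =>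
    by_cases hx : x = 0
    · simp [walksTo, walkWt, hx]
    · simp only [walksTo, walkWt, hx, if_false, sum_walks_cons, ← ih, Finset.mul_sum]
      refine Finset.sum_congr rfl fun s _ => Finset.sum_congr rfl fun w hw => ?_
      obtain ⟨w', rfl⟩ := head_of_mem_walksTo hw
      rw [windTo_cons_cons, stepWt, ← Complex.exp_add]
      push_cast; ring_nf

lemma isExcursion_iff (n : ℕ) (w : List (ℤ × ℤ)) :
    (IsExcursion w ∧ w.length - 1 = n + 1) ↔
      w ∈ diagSteps.biUnion fun s => (walksTo n (0 + s)).image (List.cons 0) := by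
  simp only [Finset.mem_biUnion, Finset.mem_image, mem_walksTo, IsExcursion]
  constructor
  · rintro ⟨⟨h1, h2, h3, h4, h5⟩, h6⟩
    match w, h1, h2, h3, h4, h5, h6 with
    | a :: y :: w', h1, h2, h3, h4, h5, h6 =>
      simp only [List.head?_cons, Option.some.injEq] at h3
      subst h3
      replace h2 := List.isChain_cons_cons.1 h2
      obtain ⟨s, hs, rfl⟩ := (isDiagStep_iff _ _).1 h2.1
      simp at h6
      refine ⟨s, hs, _, ⟨by simpa using h6, h2.2, by simp, by simpa using h4, ?_⟩, rfl⟩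
      intro i hi
      simpa using h5 (i + 1) (by omega) (by simp; omega)
  · rintro ⟨s, hs, w', ⟨h1, h2, h3, h4, h5⟩, rfl⟩
    cases w' with
    | nil => simp at h1
    | cons a w' =>
      simp only [List.head?_cons, Option.some.injEq] at h3
      subst h3
      simp at h1
      refine ⟨⟨by simp, ?_, by simp; rfl, by simpa using h4, ?_⟩, by simp [h1]⟩
      · refine List.isChain_cons_cons.2 ⟨(isDiagStep_iff _ _).2 ⟨s, hs, rfl⟩, h2⟩
      · intro i hi hi'
        obtain ⟨i, rfl⟩ := Nat.exists_eq_add_of_le' hi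
        simp at hi'
        simpa using h5 i (by omega)

lemma windExc_cons {n : ℕ} {x : ℤ × ℤ} {w : List (ℤ × ℤ)} (h : w ∈ walksTo n x) :
    windExc (0 :: w) = windTo w n := by
  obtain ⟨h1, -, h3, h4, -⟩ := (mem_walksTo n x w).1 h
  have hlast : w.getD n 0 = 0 := by
    rw [List.getLast?_eq_getElem?, h1] at h4
    simp at h4
    simp [List.getD, h4]
  simp only [windExc, windExcTo, windTo, List.length_cons, h1]
  cases n with
  | zero => simp
  | succ n =>
    rw [Finset.sum_range_succ, hlast]
    have : min (n + 1 + 1 + 1 - 1) (n + 1 + 1 + 1 - 2) = n + 1 := by omega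
    have h0 : ptC 0 = 0 := by simp [ptC]
    have hI : Finset.Icc 2 (n + 1) = Finset.Ico 2 (n + 2) := by ext; simp; omega
    rw [this, hI, Finset.sum_Ico_eq_sum_range, h0]
    simp only [Nat.add_sub_cancel, zero_div, Complex.arg_zero, add_zero]
    refine Finset.sum_congr rfl fun j _ => ?_
    rw [show 2 + j = j + 1 + 1 by ring, Nat.add_sub_cancel, List.getD_cons_succ,
        List.getD_cons_succ]

/-- The excursion sum in terms of walk weights. -/
lemma cExc_succ (b : ℝ) (n : ℕ) : cExc (n + 1) b = ∑ s ∈ diagSteps, walkWt b n s := by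
  have : ∀ s ∈ diagSteps, walkWt b n s =
      ∑ w ∈ walksTo n (0 + s), Complex.exp (Complex.I * b * windExc (0 :: w)) := by
    intro s _
    rw [zero_add, ← sum_walksTo]
    exact Finset.sum_congr rfl fun w hw => by rw [windExc_cons hw]
  rw [Finset.sum_congr rfl this, ← sum_walks_cons n 0 0 fun w => Complex.exp (Complex.I * b *
      windExc w)]
  rw [← Finset.tsum_subtype]
  unfold cExc
  have he : {w | IsExcursion w ∧ w.length - 1 = n + 1} =
      ((diagSteps.biUnion fun s => (walksTo n (0 + s)).image (List.cons 0) : Finset _) : Set (List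
          (ℤ × ℤ))) := by
    ext w; exact isExcursion_iff n w
  exact tsum_congr_set_coe (fun w => Complex.exp (Complex.I * b * windExc w)) he

section Symmetry

lemma sum_diagSteps {β : Type*} [AddCommMonoid β] (f : ℤ × ℤ → β) :
    ∑ s ∈ diagSteps, f s = f (1, 1) + (f (1, -1) + (f (-1, -1) + f (-1, 1))) := by
  simp [diagSteps]

lemma ptC_eq_zero {x : ℤ × ℤ} : ptC x = 0 ↔ x = 0 := by
  rw [Complex.ext_iff, Prod.ext_iff]; simp [ptC]

lemma ptC_re (x : ℤ × ℤ) : (ptC x).re = x.1 := by simp [ptC]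

lemma ptC_im (x : ℤ × ℤ) : (ptC x).im = x.2 := by simp [ptC]

/-- A diagonal step never reverses the direction seen from the origin. -/
lemma arg_step_ne_pi (x s : ℤ × ℤ) (hs : s ∈ diagSteps) : (ptC (x + s) / ptC x).arg ≠ π := by
  intro h
  rw [Complex.arg_eq_pi_iff] at h
  obtain ⟨h1, h2⟩ := h
  set r := ptC (x + s) / ptC x with hr
  have hx : ptC x ≠ 0 := by
    intro hx; rw [hx] at hr; simp [hr] at h1
  have h3 : ptC (x + s) = r * ptC x := by rw [hr]; field_simp
  have e1 := congrArg Complex.re h3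
  have e2 := congrArg Complex.im h3
  rw [Complex.mul_re, h2, ptC_re, ptC_re] at e1
  rw [Complex.mul_im, h2, ptC_im, ptC_im] at e2
  simp only [Prod.fst_add, Prod.snd_add, zero_mul, sub_zero, add_zero, Int.cast_add] at e1 e2
  have hs1 : |(s.1 : ℝ)| = 1 := by
    simp [diagSteps] at hs; rcases hs with rfl | rfl | rfl | rfl <;> simp
  have f1 : (s.1 : ℝ) = (r.re - 1) * x.1 := by linarith
  have f2 : x.1 = 0 := by
    by_contra h0
    have : (1 : ℝ) ≤ |(x.1 : ℝ)| := by exact_mod_cast Int.one_le_abs h0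
    rw [f1, abs_mul, abs_of_neg (by linarith)] at hs1
    nlinarith
  rw [f2] at f1
  rw [f1] at hs1; simp at hs1

lemma arg_step_symm (x s : ℤ × ℤ) (hs : s ∈ diagSteps) :
    (ptC x / ptC (x + s)).arg = -(ptC (x + s) / ptC x).arg := by
  rw [← inv_div, Complex.arg_inv, if_neg (arg_step_ne_pi x s hs)]

lemma conj_exp_I_mul (a b : ℝ) : (starRingEnd ℂ) (Complex.exp (Complex.I * b * a)) =
    Complex.exp (Complex.I * b * (-a : ℝ)) := by
  rw [← Complex.exp_conj]; simp

lemma conj_stepWt (b : ℝ) (x s : ℤ × ℤ) (hs : s ∈ diagSteps) :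
    (starRingEnd ℂ) (stepWt b x (x + s)) = stepWt b (x + s) x := by
  rw [stepWt, stepWt, conj_exp_I_mul, arg_step_symm x s hs]

lemma norm_stepWt (b : ℝ) (x y : ℤ × ℤ) : ‖stepWt b x y‖ = 1 := by
  rw [stepWt, mul_assoc, ← Complex.ofReal_mul, mul_comm]
  exact Complex.norm_exp_ofReal_mul_I _

lemma walkWt_succ (b : ℝ) (n : ℕ) {x : ℤ × ℤ} (hx : x ≠ 0) :
    walkWt b (n + 1) x = ∑ s ∈ diagSteps, stepWt b x (x + s) * walkWt b n (x + s) := by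
  simp [walkWt, hx]

lemma walkWt_succ_zero (b : ℝ) (n : ℕ) : walkWt b (n + 1) 0 = 0 := by simp [walkWt]

lemma walkWt_rot (b : ℝ) (n : ℕ) (x y : ℤ) : walkWt b n (-y, x) = walkWt b n (x, y) := by
  induction n generalizing x y with
  | zero => simp [walkWt, Prod.ext_iff, and_comm]
  | succ n ih =>
    by_cases h : (x, y) = 0
    · have : (-y, x) = (0 : ℤ × ℤ) := by
        simp [Prod.ext_iff] at h ⊢; tauto
      rw [h, this]
    · have h' : (-y, x) ≠ (0 : ℤ × ℤ) := by
        simp [Prod.ext_iff] at h ⊢; tauto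
      have key : ∀ u v u' v' : ℤ, stepWt b (-y, x) ((-y, x) + (-v, u)) * walkWt b n ((-y, x) +
          (-v, u))
          = stepWt b (x, y) ((x, y) + (u, v)) * walkWt b n ((x, y) + (u, v)) := by
        intro u v u' v'
        have e : ((-y, x) + (-v, u) : ℤ × ℤ) = (-(y + v), x + u) := by simp [Prod.ext_iff]; ring
        rw [e, ih]
        congr 1
        have hr : ∀ p q : ℤ, ptC (-q, p) = Complex.I * ptC (p, q) := by
          intro p q; simp only [ptC]; push_cast; linear_combination (-(q : ℂ)) * Complex.I_sq
        rw [stepWt, stepWt, hr, hr, mul_div_mul_left _ _ Complex.I_ne_zero]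
        rfl
      rw [walkWt_succ b n h, walkWt_succ b n h', sum_diagSteps, sum_diagSteps]
      have k1 := key 1 1 0 0
      have k2 := key 1 (-1) 0 0
      have k3 := key (-1) (-1) 0 0
      have k4 := key (-1) 1 0 0
      rw [← k1, ← k2, ← k3, ← k4]
      simp only [neg_neg]
      ring

lemma walkWt_conj (b : ℝ) (n : ℕ) (x y : ℤ) :
    walkWt b n (x, -y) = (starRingEnd ℂ) (walkWt b n (x, y)) := by
  induction n generalizing x y with
  | zero => by_cases h : (x, y) = 0 <;> simp_all [walkWt, Prod.ext_iff]
  | succ n ih =>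
    by_cases h : (x, y) = 0
    · have : (x, -y) = (0 : ℤ × ℤ) := by
        simp [Prod.ext_iff] at h ⊢; tauto
      rw [h, this, walkWt_succ_zero]; simp
    · have h' : (x, -y) ≠ (0 : ℤ × ℤ) := by
        simp [Prod.ext_iff] at h ⊢; tauto
      have key : ∀ u v : ℤ, (u, v) ∈ diagSteps →
          stepWt b (x, -y) ((x, -y) + (u, -v)) * walkWt b n ((x, -y) + (u, -v))
          = (starRingEnd ℂ) (stepWt b (x, y) ((x, y) + (u, v)) * walkWt b n ((x, y) + (u, v))) := by
        intro u v huv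
        have e : ((x, -y) + (u, -v) : ℤ × ℤ) = (x + u, -(y + v)) := by simp [Prod.ext_iff]; ring
        rw [map_mul, conj_stepWt _ _ _ huv, e, ih]
        congr 1
        have hr : ∀ p q : ℤ, ptC (p, -q) = (starRingEnd ℂ) (ptC (p, q)) := by
          intro p q; simp [ptC]
        have := arg_step_ne_pi (x, y) (u, v) huv
        rw [stepWt, stepWt, hr, hr, ← map_div₀, Complex.arg_conj, arg_step_symm _ _ huv]
        rw [if_neg (by exact this)]
        rfl
      rw [walkWt_succ b n h, walkWt_succ b n h', sum_diagSteps, sum_diagSteps]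
      rw [map_add, map_add, map_add, ← key 1 1 (by decide), ← key 1 (-1) (by decide),
        ← key (-1) (-1) (by decide), ← key (-1) 1 (by decide)]
      simp only [neg_neg]
      ring

lemma walkWt_axis_im (b : ℝ) (n : ℕ) (x : ℤ) : (walkWt b n (x, 0)).im = 0 := by
  have := walkWt_conj b n x 0
  rw [neg_zero] at this
  exact Complex.conj_eq_iff_im.1 this.symm

lemma walkWt_diag_im (b : ℝ) (n : ℕ) : (walkWt b n (1, 1)).im = 0 := by
  have h1 := walkWt_conj b n 1 1
  have h2 := walkWt_rot b n 1 (-1)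
  rw [neg_neg] at h2
  rw [← h2] at h1
  exact Complex.conj_eq_iff_im.1 h1.symm

lemma cExc_succ_eq (b : ℝ) (n : ℕ) : cExc (n + 1) b = 4 * walkWt b n (1, 1) := by
  rw [cExc_succ, sum_diagSteps]
  have h1 := walkWt_rot b n 1 1
  have h2 := walkWt_rot b n (-1) 1
  have h3 := walkWt_rot b n (-1) (-1)
  rw [neg_neg] at h3
  rw [h3, h2, h1]; ring

lemma walkWt_axis (b : ℝ) (n : ℕ) (y : ℤ) : walkWt b n (0, y) = walkWt b n (|y|, 0) := by
  rcases le_total 0 y with h | h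
  · rw [abs_of_nonneg h]; simpa using walkWt_rot b n y 0
  · rw [abs_of_nonpos h, ← walkWt_rot b n 0 y]

lemma walkWt_parity (b : ℝ) (n : ℕ) (x : ℤ × ℤ) (h : walkWt b n x ≠ 0) :
    (2 : ℤ) ∣ x.1 - n ∧ (2 : ℤ) ∣ x.2 - n := by
  induction n generalizing x with
  | zero =>
    have : x = 0 := by by_contra h'; simp [walkWt, h'] at h
    simp [this]
  | succ n ih =>
    have hx : x ≠ 0 := by rintro rfl; exact h (walkWt_succ_zero b n)
    rw [walkWt_succ b n hx] at h
    obtain ⟨s, hs, h2⟩ := Finset.exists_ne_zero_of_sum_ne_zero h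
    have := ih (x + s) (right_ne_zero_of_mul h2)
    simp [diagSteps] at hs
    rcases hs with rfl | rfl | rfl | rfl <;> simp at this ⊢ <;> omega

lemma walkWt_support (b : ℝ) (n : ℕ) (x : ℤ × ℤ) (h : walkWt b n x ≠ 0) :
    x ∈ Finset.Icc (-(n : ℤ), -(n : ℤ)) ((n : ℤ), (n : ℤ)) := by
  induction n generalizing x with
  | zero =>
    have : x = 0 := by by_contra h'; simp [walkWt, h'] at h
    simp [this]; rfl
  | succ n ih =>
    have hx : x ≠ 0 := by rintro rfl; exact h (walkWt_succ_zero b n)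
    rw [walkWt_succ b n hx] at h
    obtain ⟨s, hs, h2⟩ := Finset.exists_ne_zero_of_sum_ne_zero h
    have := ih (x + s) (right_ne_zero_of_mul h2)
    simp [diagSteps] at hs
    rw [Finset.mem_Icc, Prod.le_def, Prod.le_def] at this ⊢
    rcases hs with rfl | rfl | rfl | rfl <;> simp at this ⊢ <;> omega

end Symmetry

section Hermitian

variable (b : ℝ)

/-- The Hermitian pairing of two walk weight functions. -/
def walkPair (i j : ℕ) : ℂ := ∑' x, (starRingEnd ℂ) (walkWt b i x) * walkWt b j x

lemma finite_support_walkWt (n : ℕ) : (Function.support (walkWt b n)).Finite :=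
  (Finset.finite_toSet _).subset fun x hx => walkWt_support b n x hx

lemma summable_of_walkWt (n : ℕ) (f : ℤ × ℤ → ℂ) : Summable fun x => f x * walkWt b n x :=
  summable_of_hasFiniteSupport ((finite_support_walkWt b n).subset fun x hx => by
    simp at hx; exact hx.2)

lemma summable_walkWt_mul (n : ℕ) (f : ℤ × ℤ → ℂ) :
    Summable fun x => (starRingEnd ℂ) (walkWt b n x) * f x :=
  summable_of_hasFiniteSupport ((finite_support_walkWt b n).subset fun x hx => by
    simp at hx; exact hx.1)

lemma neg_mem_diagSteps {s : ℤ × ℤ} : -s ∈ diagSteps ↔ s ∈ diagSteps := by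
  have : ∀ s ∈ diagSteps, -s ∈ diagSteps := by decide
  exact ⟨fun h => by simpa using this _ h, this s⟩

lemma walkPair_succ (i j : ℕ) : walkPair b (i + 2) (j + 1) = walkPair b (i + 1) (j + 2) := by
  have h1 : walkPair b (i + 2) (j + 1) = ∑ s ∈ diagSteps,
      ∑' x, (starRingEnd ℂ) (stepWt b x (x + s) * walkWt b (i + 1) (x + s)) * walkWt b (j +
          1) x := by
    rw [← Summable.tsum_finsetSum fun s _ => summable_of_walkWt b (j + 1) _]
    refine tsum_congr fun x => ?_
    by_cases hx : x = 0
    · subst hx; simp [walkWt_succ_zero]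
    · rw [walkWt_succ b _ hx, map_sum, Finset.sum_mul]
  have h2 : walkPair b (i + 1) (j + 2) = ∑ s ∈ diagSteps,
      ∑' x, (starRingEnd ℂ) (walkWt b (i + 1) x) * (stepWt b x (x + s) * walkWt b (j + 1) (x +
          s)) := by
    rw [← Summable.tsum_finsetSum fun s _ => summable_walkWt_mul b (i + 1) _]
    refine tsum_congr fun x => ?_
    by_cases hx : x = 0
    · subst hx; simp [walkWt_succ_zero]
    · rw [walkWt_succ b (j + 1) hx, Finset.mul_sum]
  rw [h1, h2]
  refine Finset.sum_bij (fun s _ => -s) (fun s hs => neg_mem_diagSteps.2 hs)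
    (fun s _ t _ h => neg_injective h) (fun s hs => ⟨-s, neg_mem_diagSteps.2 hs, neg_neg s⟩) ?_
  intro s hs
  rw [← (Equiv.addRight s).tsum_eq
    (fun x => (starRingEnd ℂ) (walkWt b (i + 1) x) * (stepWt b x (x + -s) * walkWt b (j + 1) (x +
        -s)))]
  refine tsum_congr fun x => ?_
  simp only [Equiv.coe_addRight, add_neg_cancel_right, map_mul, conj_stepWt _ _ _ hs]
  ring

lemma walkPair_eq (i j : ℕ) : walkPair b (i + 1) (j + 1) = walkPair b 1 (i + j + 1) := by
  induction i generalizing j with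
  | zero => simp
  | succ i ih => rw [walkPair_succ, ih]; congr 1; ring

lemma walkPair_one (n : ℕ) : walkPair b 1 n = cExc (n + 1) b := by
  rw [cExc_succ, walkPair, tsum_eq_sum (s := diagSteps)]
  · refine Finset.sum_congr rfl fun s hs => ?_
    simp [diagSteps] at hs
    rcases hs with rfl | rfl | rfl | rfl <;>
    simp [walkWt, sum_diagSteps, Prod.ext_iff, stepWt, ptC]
  · intro x hx
    have : walkWt b 1 x = 0 := by
      by_cases h0 : x = 0
      · rw [h0, walkWt_succ_zero]
      rw [walkWt_succ b _ h0]
      refine Finset.sum_eq_zero fun s hs => ?_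
      have : x + s ≠ 0 := by
        intro h
        rw [add_eq_zero_iff_eq_neg] at h
        exact hx (h ▸ neg_mem_diagSteps.2 hs)
      simp [walkWt, this]
    rw [this]; simp

/-- The squared norm of the vector of walk weights of length `l`. -/
def walkNorm (l : ℕ) : ℝ := ∑' x, ‖walkWt b l x‖ ^ 2

lemma walkNorm_nonneg (l : ℕ) : 0 ≤ walkNorm b l := tsum_nonneg fun _ => by positivity

lemma cExc_two_mul (l : ℕ) : cExc (2 * (l + 1)) b = walkNorm b (l + 1) := by
  have := walkPair_eq b l l
  rw [walkPair_one] at this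
  rw [show 2 * (l + 1) = l + l + 1 + 1 by ring, ← this, walkNorm, walkPair, Complex.ofReal_tsum]
  refine tsum_congr fun x => ?_
  rw [mul_comm, Complex.mul_conj, Complex.normSq_eq_norm_sq]

lemma summable_walkNorm (n : ℕ) : Summable fun x => ‖walkWt b n x‖ ^ 2 :=
  summable_of_hasFiniteSupport ((finite_support_walkWt b n).subset fun x hx => by
    simpa using hx)

lemma walkNorm_succ_le (l : ℕ) : walkNorm b (l + 1) ≤ 16 * walkNorm b l := by
  have hs : ∀ s, Summable fun x => ‖walkWt b l (x + s)‖ ^ 2 := fun s =>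
    (Equiv.addRight s).summable_iff.2 (summable_walkNorm b l)
  have h1 : walkNorm b (l + 1) ≤ ∑' x, ∑ s ∈ diagSteps, 4 * ‖walkWt b l (x + s)‖ ^ 2 := by
    refine Summable.tsum_le_tsum (fun x => ?_) (summable_walkNorm b _)
      (summable_sum fun s _ => (hs s).mul_left 4)
    by_cases hx : x = 0
    · rw [hx, walkWt_succ_zero]; rw [norm_zero, zero_pow two_ne_zero]; positivity
    · rw [walkWt_succ b _ hx]
      have h2 : ‖∑ s ∈ diagSteps, stepWt b x (x + s) * walkWt b l (x + s)‖ ≤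
          ∑ s ∈ diagSteps, ‖walkWt b l (x + s)‖ := by
        refine (norm_sum_le _ _).trans (le_of_eq ?_)
        exact Finset.sum_congr rfl fun s _ => by rw [norm_mul, norm_stepWt, one_mul]
      have h3 := sq_sum_le_card_mul_sum_sq (s := diagSteps) (f := fun s => ‖walkWt b l (x + s)‖)
      have h4 : diagSteps.card = 4 := by decide
      rw [h4] at h3
      rw [← Finset.mul_sum]
      calc _ ≤ (∑ s ∈ diagSteps, ‖walkWt b l (x + s)‖) ^ 2 := by gcongr
        _ ≤ _ := by exact_mod_cast h3
  refine h1.trans (le_of_eq ?_)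
  rw [Summable.tsum_finsetSum fun s _ => (hs s).mul_left 4]
  have h5 : ∀ s ∈ diagSteps, ∑' x, 4 * ‖walkWt b l (x + s)‖ ^ 2 = 4 * walkNorm b l := by
    intro s _
    rw [tsum_mul_left, walkNorm, ← (Equiv.addRight s).tsum_eq (fun x => ‖walkWt b l x‖ ^ 2)]
    rfl
  rw [Finset.sum_congr rfl h5]
  simp [show diagSteps.card = 4 by decide]; ring

/-- The normalised excursion sums `c_{2l}(b) / 16 ^ l`. -/
def excNorm (l : ℕ) : ℝ := (cExc (2 * l) b).re / 16 ^ l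

lemma cExc_eq_excNorm {l : ℕ} (hl : 1 ≤ l) : cExc (2 * l) b = (excNorm b l * 16 ^ l : ℝ) := by
  obtain ⟨l, rfl⟩ := Nat.exists_eq_add_of_le' hl
  rw [excNorm, cExc_two_mul, Complex.ofReal_re, div_mul_cancel₀ _ (by positivity)]

lemma excNorm_succ (l : ℕ) : excNorm b (l + 1) = walkNorm b (l + 1) / 16 ^ (l + 1) := by
  rw [excNorm, cExc_two_mul, Complex.ofReal_re]

lemma excNorm_nonneg {l : ℕ} (hl : 1 ≤ l) : 0 ≤ excNorm b l := by
  obtain ⟨l, rfl⟩ := Nat.exists_eq_add_of_le' hl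
  rw [excNorm_succ]
  have := walkNorm_nonneg b (l + 1)
  positivity

lemma excNorm_succ_le {l : ℕ} (hl : 1 ≤ l) : excNorm b (l + 1) ≤ excNorm b l := by
  obtain ⟨l, rfl⟩ := Nat.exists_eq_add_of_le' hl
  rw [excNorm_succ, excNorm_succ, pow_succ 16 (l + 1), ← div_div, div_right_comm]
  have := walkNorm_succ_le b (l + 1)
  gcongr
  linarith

end Hermitian

/-- A solution of the half-plane recursion for walk weights, with boundary parameter `β`. -/
structure IsHalfPlane (β : ℝ) (h : ℕ → ℤ → ℤ → ℝ) : Prop where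
  init_zero : h 0 0 0 = 1
  init_of_ne : ∀ x y, 0 ≤ x → (x, y) ≠ (0, 0) → h 0 x y = 0
  succ_zero : ∀ n, h (n + 1) 0 0 = 0
  step : ∀ n x y, 0 < x → h (n + 1) x y =
    h n (x + 1) (y + 1) + h n (x + 1) (y - 1) + h n (x - 1) (y - 1) + h n (x - 1) (y + 1)
  boundary : ∀ n y, y ≠ 0 → h n 0 y = β * h n |y| 0
  parity : ∀ n x y, 0 ≤ x → h n x y ≠ 0 → (2 : ℤ) ∣ x - n ∧ (2 : ℤ) ∣ y - n

/-- The rotated walk weights on the right half-plane. -/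
def halfWt (b : ℝ) (n : ℕ) (x y : ℤ) : ℝ :=
  if (x, y) = 0 then (if n = 0 then 1 else 0) else
    (Complex.exp (Complex.I * b * (ptC (x, y)).arg) * walkWt b n (x, y)).re / Real.cos (π * b / 4)

lemma exp_arg_mul_stepWt (b : ℝ) {x y : ℤ × ℤ} (hx : 0 < x.1) (hy : 0 ≤ y.1) (hy0 : y ≠ 0) :
    Complex.exp (Complex.I * b * (ptC x).arg) * stepWt b x y =
      Complex.exp (Complex.I * b * (ptC y).arg) := by
  have hx0 : ptC x ≠ 0 := by
    rw [Ne, ptC_eq_zero]; rintro rfl; simp at hx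
  have hy0 : ptC y ≠ 0 := by rwa [Ne, ptC_eq_zero]
  have h1 : |(ptC x).arg| < π / 2 := Complex.abs_arg_lt_pi_div_two_iff.2 (Or.inl (by
    rw [ptC_re]; exact_mod_cast hx))
  have h2 : |(ptC y).arg| ≤ π / 2 := Complex.abs_arg_le_pi_div_two_iff.2 (by
    rw [ptC_re]; exact_mod_cast hy)
  rw [abs_lt] at h1
  rw [abs_le] at h2
  have : (ptC y / ptC x).arg = (ptC y).arg - (ptC x).arg := by
    rw [div_eq_mul_inv, Complex.arg_mul hy0 (inv_ne_zero hx0), Complex.arg_inv,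
        if_neg (by linarith)]
    · ring
    · rw [Complex.arg_inv, if_neg (by linarith)]
      constructor <;> linarith
  rw [stepWt, ← Complex.exp_add, this]
  push_cast; ring_nf

lemma re_exp_I_mul (b a : ℝ) : (Complex.exp (Complex.I * b * a)).re = Real.cos (b * a) := by
  rw [mul_assoc, ← Complex.ofReal_mul, mul_comm, Complex.exp_ofReal_mul_I_re]

lemma halfWt_of_ne (b : ℝ) (n : ℕ) {x y : ℤ} (h : (x, y) ≠ 0) : halfWt b n x y =
    (Complex.exp (Complex.I * b * (ptC (x, y)).arg) * walkWt b n (x,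
        y)).re / Real.cos (π * b / 4) := by
  rw [halfWt, if_neg h]

lemma arg_ptC_diag : (ptC (1, 1)).arg = π / 4 := by
  have : ptC (1, 1) = (√2 : ℝ) * (Complex.cos (π / 4 : ℝ) +
      Complex.sin (π / 4 : ℝ) * Complex.I) := by
    rw [← Complex.ofReal_cos, ← Complex.ofReal_sin, Real.cos_pi_div_four, Real.sin_pi_div_four]
    have : ((√2 : ℝ) : ℂ) * ((√2 : ℝ) : ℂ) = 2 := by
      rw [← Complex.ofReal_mul, Real.mul_self_sqrt (by norm_num)]; simp
    simp [ptC]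
    linear_combination (-(1 + Complex.I) / 2) * this
  rw [this, Complex.arg_mul_cos_add_sin_mul_I (by positivity)]
  constructor <;> linarith [Real.pi_pos]

lemma arg_ptC_diag' : (ptC (1, -1)).arg = -(π / 4) := by
  have : ptC (1, -1) = (starRingEnd ℂ) (ptC (1, 1)) := by simp [ptC]
  rw [this, Complex.arg_conj, arg_ptC_diag, if_neg (by linarith [Real.pi_pos])]

lemma halfWt_diag (b : ℝ) (hb : Real.cos (π * b / 4) ≠ 0) (n : ℕ) :
    cExc (n + 1) b = (4 * halfWt b n 1 1 : ℝ) := by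
  rw [cExc_succ_eq, halfWt_of_ne b n (by decide), arg_ptC_diag, Complex.mul_re, walkWt_diag_im,
    re_exp_I_mul, show b * (π / 4) = π * b / 4 by ring]
  have : walkWt b n (1, 1) = ((walkWt b n (1, 1)).re : ℂ) := by
    apply Complex.ext <;> simp [walkWt_diag_im]
  rw [this]
  rw [mul_zero, sub_zero, mul_div_cancel_left₀ _ hb, Complex.ofReal_re]
  push_cast; rfl

lemma arg_ptC_axis_pos {x : ℤ} (hx : 0 ≤ x) : (ptC (x, 0)).arg = 0 := by
  have : ptC (x, 0) = ((x : ℝ) : ℂ) := by simp [ptC]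
  rw [this, Complex.arg_ofReal_of_nonneg (by exact_mod_cast hx)]

lemma isHalfPlane_halfWt (b : ℝ) (hb : Real.cos (π * b / 4) ≠ 0) :
    IsHalfPlane (Real.cos (π * b / 2)) (halfWt b) where
  init_zero := by simp [halfWt]
  init_of_ne x y _ h := by
    rw [halfWt_of_ne b 0 h]
    have : (x, y) ≠ (0 : ℤ × ℤ) := h
    simp [walkWt, this]
  succ_zero n := by simp [halfWt]
  step n x y hx := by
    have hne : (x, y) ≠ (0 : ℤ × ℤ) := by simp [Prod.ext_iff]; omega
    have key : ∀ s ∈ diagSteps, (Complex.exp (Complex.I * b * (ptC (x, y)).arg) *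
        (stepWt b (x, y) ((x, y) + s) * walkWt b n ((x, y) + s))).re / Real.cos (π * b / 4) =
        halfWt b n (x + s.1) (y + s.2) := by
      intro s hs
      have hs1 : 0 ≤ x + s.1 := by
        simp [diagSteps] at hs
        rcases hs with rfl | rfl | rfl | rfl <;> simp <;> omega
      by_cases h0 : (x, y) + s = 0
      · have h0' : (x + s.1, y + s.2) = (0 : ℤ × ℤ) := h0
        rw [halfWt, if_pos h0']
        cases n with
        | succ n => rw [h0, walkWt_succ_zero]; simp
        | zero =>
          have hxs : x = -s.1 := by simp [Prod.ext_iff] at h0'; omega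
          have hys : y = -s.2 := by simp [Prod.ext_iff] at h0'; omega
          rw [h0]
          have e1 : stepWt b (x, y) 0 = 1 := by simp [stepWt, ptC]
          have e2 : walkWt b 0 0 = 1 := by simp [walkWt]
          rw [e1, e2, mul_one, mul_one, re_exp_I_mul, if_pos rfl, div_eq_one_iff_eq hb]
          simp [diagSteps] at hs
          rcases hs with rfl | rfl | rfl | rfl
          · simp at hxs; omega
          · simp at hxs; omega
          · simp at hxs hys; subst hxs hys
            rw [arg_ptC_diag]; ring_nf
          · simp at hxs hys; subst hxs hys
            rw [arg_ptC_diag', ← Real.cos_neg]; ring_nf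
      · rw [← mul_assoc, exp_arg_mul_stepWt b hx hs1 h0, halfWt_of_ne b n h0]
        rfl
    rw [halfWt_of_ne b _ hne, walkWt_succ b n hne, Finset.mul_sum, Complex.re_sum, Finset.sum_div,
      Finset.sum_congr rfl key, sum_diagSteps]
    simp only [← sub_eq_add_neg]
    ring
  boundary n y hy := by
    have h1 : ((0 : ℤ), y) ≠ 0 := by simp [Prod.ext_iff, hy]
    have h2 : (|y|, (0 : ℤ)) ≠ 0 := by simp [Prod.ext_iff, hy]
    rw [halfWt_of_ne b n h1, halfWt_of_ne b n h2, walkWt_axis, arg_ptC_axis_pos (abs_nonneg y),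
      Complex.mul_re, walkWt_axis_im, re_exp_I_mul]
    have : Real.cos (b * (ptC (0, y)).arg) = Real.cos (π * b / 2) := by
      have e : ptC (0, y) = ((y : ℝ) : ℂ) * Complex.I := by simp [ptC]
      rcases lt_or_gt_of_ne hy with h | h
      · have e2 : ptC (0, y) = ((-y : ℝ) : ℂ) * -Complex.I := by simp [ptC]
        rw [e2, Complex.arg_real_mul _ (by simpa using h), Complex.arg_neg_I, ← Real.cos_neg]
        ring_nf
      · rw [e, Complex.arg_real_mul _ (by simpa using h), Complex.arg_I]
        ring_nf
    rw [this]; simp; ring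
  parity n x y hx h := by
    by_cases h0 : (x, y) = 0
    · have hx : x = 0 ∧ y = 0 := by simpa [Prod.ext_iff] using h0
      have : n = 0 := by by_contra h'; simp [halfWt, h', h0] at h
      simp [this, hx.1, hx.2]
    · rw [halfWt_of_ne b n h0] at h
      have : walkWt b n (x, y) ≠ 0 := by rintro h'; simp [h'] at h
      exact walkWt_parity b n _ this

section Explicit

/-- The number of `±1` paths of length `n` from `0` to `x`. -/
def latPath : ℕ → ℤ → ℝ
  | 0, x => if x = 0 then 1 else 0
  | n + 1, x => latPath n (x - 1) + latPath n (x + 1)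

/-- The number of `±1` paths of length `n + 1` from `x` to `0`, reflected at `0`. -/
def latDiff (n : ℕ) (x : ℤ) : ℝ := latPath n (x - 1) - latPath n (x + 1)

lemma latPath_neg (n : ℕ) (x : ℤ) : latPath n (-x) = latPath n x := by
  induction n generalizing x with
  | zero => simp [latPath]
  | succ n ih =>
    rw [latPath, latPath, show -x - 1 = -(x + 1) by ring, show -x + 1 = -(x - 1) by ring, ih, ih,
      add_comm]

lemma latPath_of_lt (n : ℕ) (x : ℤ) (h : (n : ℤ) < x) : latPath n x = 0 := by
  induction n generalizing x with
  | zero => simp at h; simp [latPath, h.ne']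
  | succ n ih => push_cast at h; rw [latPath, ih _ (by omega), ih _ (by omega), add_zero]

lemma latPath_choose (n j : ℕ) : latPath n (n - 2 * j) = n.choose j := by
  induction n generalizing j with
  | zero => cases j <;> simp [latPath] ; omega
  | succ n ih =>
    rw [latPath]
    cases j with
    | zero =>
      have := ih 0
      push_cast at this ⊢
      simp only [sub_zero, Nat.choose_zero_right, Nat.cast_one] at this ⊢
      rw [latPath_of_lt n ((n : ℤ) + 1 + 1) (by omega), add_zero, add_sub_cancel_right, this]
    | succ j =>
      rw [Nat.choose_succ_succ, Nat.cast_add (n.choose j), ← ih, ← ih, add_comm]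
      congr 1 <;> congr 1 <;> push_cast <;> ring

lemma latDiff_succ (n : ℕ) (x : ℤ) : latDiff (n + 1) x = latDiff n (x - 1) + latDiff n (x + 1) := by
  simp only [latDiff, latPath]; ring_nf

lemma latDiff_zero_right (n : ℕ) : latDiff n 0 = 0 := by
  rw [latDiff, zero_sub, zero_add, latPath_neg, sub_self]

lemma latDiff_one (k : ℕ) : latDiff (2 * k) 1 = k.centralBinom / (k + 1) := by
  have h1 := latPath_choose (2 * k) k
  rw [latDiff]
  push_cast at h1
  rw [sub_self] at h1 ⊢
  rw [h1, Nat.centralBinom]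
  cases k with
  | zero => simp [latPath]
  | succ k =>
    have h2 := latPath_choose (2 * (k + 1)) k
    push_cast at h2
    rw [show (2 * ((k : ℤ) + 1) - 2 * k) = 1 + 1 by ring] at h2
    rw [h2]
    have h3 := Nat.choose_succ_right_eq (2 * (k + 1)) k
    rw [show 2 * (k + 1) - k = k + 2 by omega] at h3
    have h4 : (((2 * (k + 1)).choose (k + 1) : ℕ) : ℝ) * (k + 1) = ((2 * (k +
        1)).choose k : ℕ) * (k + 2) := by
      exact_mod_cast h3
    push_cast
    field_simp
    linarith

lemma latPath_one (k : ℕ) : latPath (2 * k + 1) 1 = (k.centralBinom * (2 * k + 1)) / (k + 1) := by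
  have h1 := latPath_choose (2 * k + 1) k
  push_cast at h1
  rw [show (2 * (k : ℤ) + 1 - 2 * k) = 1 by ring] at h1
  rw [h1]
  have h2 := Nat.add_one_mul_choose_eq (2 * k) k
  have h3 := Nat.choose_symm_half k
  rw [eq_div_iff (by positivity), ← h3, Nat.centralBinom]
  have h4 : ((2 * k + 1 : ℕ) : ℝ) * ((2 * k).choose k : ℕ) = ((2 * k + 1).choose (k +
      1) : ℕ) * (k + 1 : ℕ) := by
    exact_mod_cast h2
  push_cast at h4
  linarith

lemma exp_arg_mul (x y : ℂ) (hx : x ≠ 0) (hy : y ≠ 0) :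
    Complex.exp (Complex.I * (2 : ℝ) * x.arg) * Complex.exp (Complex.I * (2 : ℝ) * (y / x).arg) =
      Complex.exp (Complex.I * (2 : ℝ) * y.arg) := by
  have key : ∀ z : ℂ, z ≠ 0 → Complex.exp (Complex.I * (2 : ℝ) * z.arg) = (z / ‖z‖) ^ 2 := by
    intro z hz
    have hz' : (‖z‖ : ℂ) ≠ 0 := by simpa using hz
    have := Complex.norm_mul_exp_arg_mul_I z
    have h2 : Complex.exp (z.arg * Complex.I) = z / ‖z‖ := by
      rw [eq_div_iff hz', mul_comm]; exact this
    rw [← h2, ← Complex.exp_nat_mul]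
    push_cast; ring_nf
  rw [key x hx, key y hy, key _ (div_ne_zero hy hx)]
  have hx' : (‖x‖ : ℂ) ≠ 0 := by simpa using hx
  have hy' : (‖y‖ : ℂ) ≠ 0 := by simpa using hy
  rw [norm_div]
  push_cast
  field_simp

lemma walkWt_two (n : ℕ) (x : ℤ × ℤ) :
    Complex.exp (Complex.I * (2 : ℝ) * (ptC x).arg) * walkWt 2 (n + 1) x =
      Complex.I * latDiff n x.1 * latDiff n x.2 := by
  induction n generalizing x with
  | zero =>
    by_cases hx : x = 0
    · subst hx; simp [walkWt_succ_zero, latDiff_zero_right]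
    by_cases hx' : x ∈ diagSteps
    · have hw : walkWt 2 1 x = 1 := by
        simp [diagSteps] at hx'
        rcases hx' with rfl | rfl | rfl | rfl <;>
          simp [walkWt, sum_diagSteps, Prod.ext_iff, stepWt, ptC]
      have key : ∀ z : ℂ, Complex.exp (Complex.I * (2 : ℝ) * z.arg) =
          Complex.exp (z.arg * Complex.I) ^ 2 := by
        intro z; rw [← Complex.exp_nat_mul]; push_cast; ring_nf
      have hs : ((√2 : ℝ) : ℂ) ^ 2 = 2 := by
        rw [← Complex.ofReal_pow, Real.sq_sqrt (by norm_num)]; simp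
      have key2 : ∀ z : ℂ, ‖z‖ = √2 → Complex.exp (z.arg * Complex.I) ^ 2 = z ^ 2 / 2 := by
        intro z hz
        have := Complex.norm_mul_exp_arg_mul_I z
        rw [hz] at this
        rw [eq_div_iff two_ne_zero]
        nth_rewrite 2 [← this]
        rw [mul_pow, hs, mul_comm]
      have hn : ‖ptC x‖ = √2 := by
        rw [Complex.norm_eq_sqrt_sq_add_sq, ptC_re, ptC_im]
        simp [diagSteps] at hx'
        rcases hx' with rfl | rfl | rfl | rfl <;> norm_num
      rw [hw, key, key2 _ hn]
      simp [diagSteps] at hx'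
      rcases hx' with rfl | rfl | rfl | rfl <;> simp [latDiff, latPath, ptC] <;>
        linear_combination (Complex.I_sq) / 2
    · have hw : walkWt 2 1 x = 0 := by
        rw [walkWt_succ _ _ hx]
        refine Finset.sum_eq_zero fun s hs => ?_
        have : x + s ≠ 0 := by
          intro h
          rw [add_eq_zero_iff_eq_neg] at h
          exact hx' (h ▸ neg_mem_diagSteps.2 hs)
        simp [walkWt, this]
      have h0 : ∀ y : ℤ, y ≠ 1 → y ≠ -1 → latDiff 0 y = 0 := by
        intro y h1 h2
        simp only [latDiff, latPath]
        rw [if_neg (by omega), if_neg (by omega), sub_zero]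
      obtain ⟨p, q⟩ := x
      rw [hw, mul_zero]
      by_cases hp : p ≠ 1 ∧ p ≠ -1
      · rw [h0 _ hp.1 hp.2]; simp
      · have hq : q ≠ 1 ∧ q ≠ -1 := by
          simp [diagSteps] at hx'; omega
        simp only [h0 _ hq.1 hq.2]; simp
  | succ n ih =>
    by_cases hx : x = 0
    · subst hx; simp [walkWt_succ_zero, latDiff_zero_right]
    have key : ∀ s, Complex.exp (Complex.I * (2 : ℝ) * (ptC x).arg) *
        (stepWt 2 x (x + s) * walkWt 2 (n + 1) (x + s)) =
        Complex.I * latDiff n (x.1 + s.1) * latDiff n (x.2 + s.2) := by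
      intro s
      have := ih (x + s)
      rw [Prod.fst_add, Prod.snd_add] at this
      rw [← this]
      by_cases h0 : x + s = 0
      · rw [h0, walkWt_succ_zero]; simp
      · rw [← mul_assoc, stepWt, exp_arg_mul _ _ (by rwa [Ne, ptC_eq_zero]) (by rwa [Ne,
            ptC_eq_zero])]
    rw [walkWt_succ _ _ hx, Finset.mul_sum, Finset.sum_congr rfl fun s _ => key s, sum_diagSteps,
      latDiff_succ, latDiff_succ]
    simp only [← sub_eq_add_neg]
    push_cast; ring

lemma cExc_two_eq (k : ℕ) : cExc (2 * (k + 1)) 2 = (4 * (k.centralBinom / (k + 1)) ^ 2 : ℝ) := by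
  rw [show 2 * (k + 1) = 2 * k + 1 + 1 by ring, cExc_succ_eq]
  have h := walkWt_two (2 * k) (1, 1)
  rw [arg_ptC_diag, latDiff_one] at h
  have : Complex.exp (Complex.I * (2 : ℝ) * ((π / 4 : ℝ) : ℂ)) = Complex.I := by
    refine Eq.trans ?_ Complex.exp_pi_div_two_mul_I
    push_cast; ring_nf
  rw [this, mul_assoc] at h
  rw [mul_left_cancel₀ Complex.I_ne_zero h]
  push_cast; ring

/-- Solutions with `β = 0` factorise. -/
lemma IsHalfPlane.eq_of_zero {h : ℕ → ℤ → ℤ → ℝ} (hh : IsHalfPlane 0 h) (n : ℕ) (x y : ℤ)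
    (hx : 0 ≤ x) : h (n + 1) x y = latDiff n x * latPath (n + 1) y := by
  have hb : ∀ n y, h (n + 1) 0 y = 0 := by
    intro n y
    by_cases hy : y = 0
    · rw [hy, hh.succ_zero]
    · rw [hh.boundary _ _ hy, zero_mul]
  induction n generalizing x y with
  | zero =>
    rcases hx.eq_or_lt with rfl | hx
    · rw [hb, latDiff_zero_right, zero_mul]
    · rw [hh.step _ _ _ hx, hh.init_of_ne _ _ (by omega) (by simp; omega),
        hh.init_of_ne _ _ (by omega) (by simp; omega)]
      by_cases h1 : x = 1
      · subst h1
        have key : ∀ z, h 0 (1 - 1) z = if z = 0 then 1 else 0 := by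
          intro z
          split_ifs with hz
          · rw [hz]; exact hh.init_zero
          · rw [hh.init_of_ne _ _ (by omega) (by simp; omega)]
        rw [key, key]
        simp [latDiff, latPath]
      · rw [hh.init_of_ne _ _ (by omega) (by simp; omega), hh.init_of_ne _ _ (by omega) (by simp; omega)]
        simp only [latDiff, latPath]
        rw [if_neg (by omega : ¬ (x - 1 = 0)), if_neg (by omega : ¬ (x + 1 = 0))]
        simp
  | succ n ih =>
    rcases hx.eq_or_lt with rfl | hx
    · rw [hb, latDiff_zero_right, zero_mul]
    · rw [hh.step _ _ _ hx, ih _ _ (by omega), ih _ _ (by omega), ih _ _ (by omega),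
        ih _ _ (by omega), latDiff_succ, show latPath (n + 1 + 1) y =
          latPath (n + 1) (y - 1) + latPath (n + 1) (y + 1) from rfl]
      ring

lemma cExc_one_eq (k : ℕ) :
    cExc (2 * (k + 1)) 1 = (4 * k.centralBinom ^ 2 * (2 * k + 1) / (k + 1) ^ 2 : ℝ) := by
  have hc : Real.cos (π * 1 / 4) ≠ 0 := by
    rw [mul_one, Real.cos_pi_div_four]; positivity
  have hh := isHalfPlane_halfWt 1 hc
  rw [mul_one, Real.cos_pi_div_two] at hh
  rw [show 2 * (k + 1) = 2 * k + 1 + 1 by ring, halfWt_diag 1 hc, hh.eq_of_zero _ _ _ zero_le_one,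
    latDiff_one, latPath_one]
  congr 1
  field_simp

lemma wallis_centralBinom (k : ℕ) :
    (k.centralBinom : ℝ) ^ 2 * (2 * k + 1) * Real.Wallis.W k = 16 ^ k := by
  rw [Real.Wallis.W_eq_factorial_ratio]
  have h := Nat.centralBinom_eq_two_mul_choose k
  have h2 : (k.centralBinom : ℝ) * (k.factorial ^ 2) = (2 * k).factorial := by
    have := Nat.choose_mul_factorial_mul_factorial (show k ≤ 2 * k by omega)
    rw [show 2 * k - k = k by omega, ← h] at this
    rw [← this]; push_cast; ring
  rw [← h2, show (2 : ℝ) ^ (4 * k) = 16 ^ k by rw [pow_mul]; norm_num]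
  have h3 : (k.factorial : ℝ) ≠ 0 := by positivity
  have h4 : (k.centralBinom : ℝ) ≠ 0 := by exact_mod_cast (Nat.centralBinom_pos k).ne'
  field_simp

lemma tendsto_cExc_two : Filter.Tendsto (fun l : ℕ => cExc (2 * l) 2 /
      (((4 : ℝ) ^ (2 * l) / (4 * π * (l : ℝ) ^ 3) : ℝ) : ℂ)) Filter.atTop (nhds 1) := by
  rw [← Filter.tendsto_add_atTop_iff_nat 1]
  have h1 := Real.Wallis.tendsto_W_nhds_pi_div_two
  have h2 : Filter.Tendsto (fun k : ℕ => ((k : ℝ) + 1) / (2 * k +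
      1)) Filter.atTop (nhds (1 / 2)) := by
    have := (tendsto_one_div_add_atTop_nhds_zero_nat (𝕜 := ℝ))
    have h3 : Filter.Tendsto (fun k : ℕ => 1 / (2 - 1 / ((k : ℝ) +
        1))) Filter.atTop (nhds (1 / (2 - 0))) :=
      tendsto_const_nhds.div (tendsto_const_nhds.sub this) (by norm_num)
    rw [sub_zero] at h3
    refine h3.congr fun k => ?_
    have : (2 * (k : ℝ) + 1) ≠ 0 := by positivity
    rw [div_eq_div_iff]
    · field_simp; ring
    · rw [Ne, sub_eq_zero, eq_div_iff (by positivity)]; intro h; apply this; linarith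
    · exact this
  have h3 : Filter.Tendsto (fun k : ℕ => π * (((k : ℝ) + 1) / (2 * k + 1)) / Real.Wallis.W k)
      Filter.atTop (nhds 1) := by
    have := (h2.const_mul π).div h1 (by positivity)
    rwa [show π * (1 / 2) / (π / 2) = 1 by field_simp] at this
  have h4 := (Complex.continuous_ofReal.tendsto 1).comp h3
  rw [Complex.ofReal_one] at h4
  refine h4.congr fun k => ?_
  rw [Function.comp_apply, cExc_two_eq, ← Complex.ofReal_div]
  congr 1
  have h5 := wallis_centralBinom k
  have h6 := Real.Wallis.W_pos k
  rw [show (4 : ℝ) ^ (2 * (k + 1)) = 16 * 16 ^ k by rw [pow_mul]; norm_num [pow_succ]; ring, ← h5]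
  have h4 : (k.centralBinom : ℝ) ≠ 0 := by exact_mod_cast (Nat.centralBinom_pos k).ne'
  push_cast
  field_simp
  ring

lemma tendsto_cExc_one : Filter.Tendsto (fun l : ℕ => cExc (2 * l) 1 /
      (((4 : ℝ) ^ (2 * l) / (2 * π * (l : ℝ) ^ 2) : ℝ) : ℂ)) Filter.atTop (nhds 1) := by
  rw [← Filter.tendsto_add_atTop_iff_nat 1]
  have h1 := Real.Wallis.tendsto_W_nhds_pi_div_two
  have h3 : Filter.Tendsto (fun k : ℕ => (π / 2) / Real.Wallis.W k) Filter.atTop (nhds 1) := by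
    have := (tendsto_const_nhds (x := π / 2)).div h1 (by positivity)
    rwa [div_self (by positivity)] at this
  have h4 := (Complex.continuous_ofReal.tendsto 1).comp h3
  rw [Complex.ofReal_one] at h4
  refine h4.congr fun k => ?_
  rw [Function.comp_apply, cExc_one_eq, ← Complex.ofReal_div]
  congr 1
  have h5 := wallis_centralBinom k
  have h6 := Real.Wallis.W_pos k
  rw [show (4 : ℝ) ^ (2 * (k + 1)) = 16 * 16 ^ k by rw [pow_mul]; norm_num [pow_succ]; ring, ← h5]
  have h4 : (k.centralBinom : ℝ) ≠ 0 := by exact_mod_cast (Nat.centralBinom_pos k).ne'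
  push_cast
  field_simp
  ring

end Explicit

section Generating

variable {β : ℝ} {h : ℕ → ℤ → ℤ → ℝ} {t : ℝ}

lemma IsHalfPlane.eq_zero_of_lt (hh : IsHalfPlane β h) (n : ℕ) (x y : ℤ) (hx : 0 ≤ x)
    (hn : (n : ℤ) < x ∨ (n : ℤ) < |y|) : h n x y = 0 := by
  induction n generalizing x y with
  | zero =>
    refine hh.init_of_ne _ _ hx ?_
    rintro h
    simp [Prod.ext_iff] at h hn
    omega
  | succ n ih =>
    have key : ∀ x y, 0 < x → (((n + 1 : ℕ) : ℤ) < x ∨ ((n + 1 : ℕ) : ℤ) < |y|) → h (n + 1) x y =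
        0 := by
      intro x y hx hn
      push_cast at hn
      have e1 : (n : ℤ) < x - 1 ∨ (n : ℤ) < |y + 1| := by
        rcases hn with hn | hn
        · left; omega
        · right; rw [lt_abs] at hn ⊢; omega
      have e2 : (n : ℤ) < x - 1 ∨ (n : ℤ) < |y - 1| := by
        rcases hn with hn | hn
        · left; omega
        · right; rw [lt_abs] at hn ⊢; omega
      rw [hh.step _ _ _ hx, ih _ _ (by omega) (by omega), ih _ _ (by omega) (by omega),
        ih _ _ (by omega) (by omega), ih _ _ (by omega) (by omega)]
      simp
    rcases hx.eq_or_lt with rfl | hx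
    · by_cases hy : y = 0
      · subst hy; simp at hn; omega
      · rw [hh.boundary _ _ hy, key _ _ (abs_pos.2 hy) (by push_cast at hn ⊢; omega), mul_zero]
    · exact key x y hx hn

lemma IsHalfPlane.abs_le_pow (hh : IsHalfPlane β h) (hβ : |β| ≤ 1) (n : ℕ) (x y : ℤ) (hx : 0 ≤ x) :
    |h n x y| ≤ 4 ^ n := by
  induction n generalizing x y with
  | zero =>
    by_cases h0 : (x, y) = (0, 0)
    · obtain ⟨rfl, rfl⟩ := Prod.ext_iff.1 h0; simp [hh.init_zero]
    · simp [hh.init_of_ne _ _ hx h0]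
  | succ n ih =>
    have key : ∀ x y, 0 < x → |h (n + 1) x y| ≤ 4 ^ (n + 1) := by
      intro x y hx
      rw [hh.step _ _ _ hx]
      have h1 := ih (x + 1) (y + 1) (by omega)
      have h2 := ih (x + 1) (y - 1) (by omega)
      have h3 := ih (x - 1) (y - 1) (by omega)
      have h4 := ih (x - 1) (y + 1) (by omega)
      rw [abs_le] at h1 h2 h3 h4 ⊢
      rw [pow_succ]
      constructor <;> linarith [h1.1, h1.2, h2.1, h2.2, h3.1, h3.2, h4.1, h4.2]
    rcases hx.eq_or_lt with rfl | hx
    · by_cases hy : y = 0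
      · subst hy; rw [hh.succ_zero]; simp
      · rw [hh.boundary _ _ hy, abs_mul]
        have := key _ 0 (abs_pos.2 hy)
        calc _ ≤ 1 * |h (n + 1) |y| 0| := by gcongr
          _ ≤ _ := by rw [one_mul]; exact this
    · exact key x y hx

/-- The generating function of a half-plane solution. -/
def halfGen (h : ℕ → ℤ → ℤ → ℝ) (t : ℝ) (x y : ℤ) : ℝ := ∑' n, t ^ n * h n x y

lemma IsHalfPlane.summable (hh : IsHalfPlane β h) (hβ : |β| ≤ 1) (ht0 : 0 ≤ t) (ht1 : 4 * t < 1)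
    {x y : ℤ} (hx : 0 ≤ x) : Summable fun n => t ^ n * h n x y := by
  refine Summable.of_norm_bounded (summable_geometric_of_lt_one (by positivity) ht1) fun n => ?_
  rw [Real.norm_eq_abs, abs_mul, abs_of_nonneg (by positivity), mul_pow, mul_comm]
  gcongr
  exact hh.abs_le_pow hβ n x y hx

lemma IsHalfPlane.abs_halfGen_le (hh : IsHalfPlane β h) (hβ : |β| ≤ 1) (ht0 : 0 ≤ t)
    (ht1 : 4 * t < 1) {x y : ℤ} (hx : 0 ≤ x) :
    |halfGen h t x y| ≤ (4 * t) ^ x.toNat * (1 - 4 * t)⁻¹ := by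
  have hz : ∀ i ∈ Finset.range x.toNat, t ^ i * h i x y = 0 := by
    intro i hi
    rw [Finset.mem_range] at hi
    rw [hh.eq_zero_of_lt i x y hx (by omega), mul_zero]
  have hsum : halfGen h t x y = ∑' n, t ^ (n + x.toNat) * h (n + x.toNat) x y := by
    have h2 := (hh.summable hβ ht0 ht1 (y := y) hx).sum_add_tsum_nat_add x.toNat
    rw [Finset.sum_eq_zero hz, zero_add] at h2
    exact h2.symm
  rw [hsum, ← Real.norm_eq_abs]
  refine tsum_of_norm_bounded ((hasSum_geometric_of_lt_one (by positivity) ht1).mul_left _) fun n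
      => ?_
  rw [Real.norm_eq_abs, abs_mul, abs_of_nonneg (by positivity), ← pow_add, add_comm, mul_pow,
      mul_comm]
  gcongr
  exact hh.abs_le_pow hβ _ x y hx

lemma IsHalfPlane.halfGen_zero (hh : IsHalfPlane β h) (t : ℝ) : halfGen h t 0 0 = 1 := by
  rw [halfGen, tsum_eq_single 0]
  · simp [hh.init_zero]
  · intro n hn
    obtain ⟨n, rfl⟩ := Nat.exists_eq_succ_of_ne_zero hn
    rw [hh.succ_zero, mul_zero]

lemma IsHalfPlane.halfGen_boundary (hh : IsHalfPlane β h) (t : ℝ) {y : ℤ} (hy : y ≠ 0) :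
    halfGen h t 0 y = β * halfGen h t |y| 0 := by
  rw [halfGen, halfGen, ← tsum_mul_left]
  exact tsum_congr fun n => by rw [hh.boundary _ _ hy]; ring

lemma IsHalfPlane.halfGen_step (hh : IsHalfPlane β h) (hβ : |β| ≤ 1) (ht0 : 0 ≤ t)
    (ht1 : 4 * t < 1) {x : ℤ} (y : ℤ) (hx : 0 < x) :
    halfGen h t x y = t * (halfGen h t (x + 1) (y + 1) + halfGen h t (x + 1) (y - 1) +
      halfGen h t (x - 1) (y - 1) + halfGen h t (x - 1) (y + 1)) := by
  have hs := fun (x y : ℤ) (hx : 0 ≤ x) => hh.summable hβ ht0 ht1 (y := y) hx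
  have h1 := hs (x + 1) (y + 1) (by omega)
  have h2 := hs (x + 1) (y - 1) (by omega)
  have h3 := hs (x - 1) (y - 1) (by omega)
  have h4 := hs (x - 1) (y + 1) (by omega)
  unfold halfGen
  rw [← h1.tsum_add h2, ← (h1.add h2).tsum_add h3, ← ((h1.add h2).add h3).tsum_add h4,
    ← tsum_mul_left, (hs x y hx.le).tsum_eq_zero_add, hh.init_of_ne _ _ hx.le (by simp; omega), mul_zero,
    zero_add]
  exact tsum_congr fun n => by rw [hh.step _ _ _ hx]; ring

lemma halfPlane_unique (ht0 : 0 ≤ t) (ht1 : 4 * t < 1) {D : ℤ → ℤ → ℝ} {M : ℝ}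
    (hM : ∀ x y, 0 ≤ x → |D x y| ≤ M) (h0 : ∀ y, D 0 y = 0)
    (hstep : ∀ x y, 0 < x → D x y = t * (D (x + 1) (y + 1) + D (x + 1) (y - 1) +
      D (x - 1) (y - 1) + D (x - 1) (y + 1))) {x y : ℤ} (hx : 0 ≤ x) : D x y = 0 := by
  have hM0 : 0 ≤ M := (abs_nonneg _).trans (hM 0 0 le_rfl)
  have key : ∀ n : ℕ, ∀ x y, 0 ≤ x → |D x y| ≤ M * (4 * t) ^ n := by
    intro n
    induction n with
    | zero => simpa using hM
    | succ n ih =>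
      intro x y hx
      rcases hx.eq_or_lt with rfl | hx
      · rw [h0, abs_zero]; positivity
      · rw [hstep _ _ hx, abs_mul, abs_of_nonneg ht0]
        have h1 := ih (x + 1) (y + 1) (by omega)
        have h2 := ih (x + 1) (y - 1) (by omega)
        have h3 := ih (x - 1) (y - 1) (by omega)
        have h4 := ih (x - 1) (y + 1) (by omega)
        have : |D (x + 1) (y + 1) + D (x + 1) (y - 1) + D (x - 1) (y - 1) + D (x - 1) (y + 1)| ≤
            4 * (M * (4 * t) ^ n) := by
          rw [abs_le] at h1 h2 h3 h4 ⊢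
          constructor <;> linarith [h1.1, h1.2, h2.1, h2.2, h3.1, h3.2, h4.1, h4.2]
        calc _ ≤ t * (4 * (M * (4 * t) ^ n)) := by gcongr
          _ = _ := by ring
  have h2 : Filter.Tendsto (fun n : ℕ => M * (4 * t) ^ n) Filter.atTop (nhds (M * 0)) :=
    (tendsto_pow_atTop_nhds_zero_of_lt_one (by positivity) ht1).const_mul M
  rw [mul_zero] at h2
  exact abs_nonpos_iff.1 (ge_of_tendsto' h2 fun n => key n x y hx)

end Generating

section Kernel

variable {k : ℝ}

/-- The small root `ψ` of `k c (1 + ψ ^ 2) = 2 ψ` with `c = cos θ`. -/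
def smallRoot (k θ : ℝ) : ℝ := k * Real.cos θ / (1 + √(1 - k ^ 2 * Real.cos θ ^ 2))

lemma one_sub_sq_mul_cos_sq_pos (h0 : 0 ≤ k) (h1 : k < 1) (θ : ℝ) :
    0 < 1 - k ^ 2 * Real.cos θ ^ 2 := by
  have : k ^ 2 < 1 := by nlinarith
  nlinarith [Real.cos_sq_le_one θ, sq_nonneg (Real.cos θ), sq_nonneg k]

lemma continuous_smallRoot (k : ℝ) : Continuous (smallRoot k) := by
  unfold smallRoot
  refine Continuous.div (by fun_prop) (by fun_prop) fun θ => ?_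
  have := Real.sqrt_nonneg (1 - k ^ 2 * Real.cos θ ^ 2)
  positivity

lemma mul_smallRoot (h0 : 0 ≤ k) (h1 : k < 1) (θ : ℝ) :
    k * Real.cos θ * smallRoot k θ = 1 - √(1 - k ^ 2 * Real.cos θ ^ 2) := by
  have hs := Real.sqrt_nonneg (1 - k ^ 2 * Real.cos θ ^ 2)
  have h2 := Real.sq_sqrt (one_sub_sq_mul_cos_sq_pos h0 h1 θ).le
  rw [smallRoot, mul_div_assoc', div_eq_iff (by positivity)]
  linear_combination h2

lemma smallRoot_quadratic (h0 : 0 ≤ k) (h1 : k < 1) (θ : ℝ) :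
    k * Real.cos θ * (1 + smallRoot k θ ^ 2) = 2 * smallRoot k θ := by
  have hs := Real.sqrt_nonneg (1 - k ^ 2 * Real.cos θ ^ 2)
  have h2 := mul_smallRoot h0 h1 θ
  have h3 : smallRoot k θ * (1 + √(1 - k ^ 2 * Real.cos θ ^ 2)) = k * Real.cos θ := by
    rw [smallRoot, div_mul_cancel₀ _ (by positivity)]
  linear_combination smallRoot k θ * h2 - h3

lemma abs_smallRoot_le (h0 : 0 ≤ k) (θ : ℝ) : |smallRoot k θ| ≤ k := by
  have hs := Real.sqrt_nonneg (1 - k ^ 2 * Real.cos θ ^ 2)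
  have hp : 0 < 1 + √(1 - k ^ 2 * Real.cos θ ^ 2) := by positivity
  rw [smallRoot, abs_div, abs_mul, abs_of_nonneg h0, abs_of_pos hp, div_le_iff₀ hp]
  have := Real.abs_cos_le_one θ
  nlinarith [mul_nonneg h0 hs]

/-- `1 + 2 ∑ ψ ^ p cos (p θ')` in closed form. -/
lemma hasSum_poisson (h0 : 0 ≤ k) (h1 : k < 1) (θ θ' : ℝ) :
    HasSum (fun p : ℕ => 2 * smallRoot k θ ^ (p + 1) * Real.cos ((p + 1) * θ'))
      (√(1 - k ^ 2 * Real.cos θ ^ 2) / (1 - k * Real.cos θ * Real.cos θ') - 1) := by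
  set r := smallRoot k θ with hr
  have hrk := abs_smallRoot_le h0 θ
  rw [← hr] at hrk
  set z : ℂ := r * Complex.exp (θ' * Complex.I) with hz
  have hzn : ‖z‖ < 1 := by
    rw [hz, norm_mul, Complex.norm_exp_ofReal_mul_I, Complex.norm_real,
        mul_one]; exact hrk.trans_lt h1
  have hs := (hasSum_geometric_of_norm_lt_one hzn).mul_left (2 * z)
  have hre := Complex.hasSum_re hs
  have hzre : z.re = r * Real.cos θ' := by
    rw [hz, Complex.re_ofReal_mul, Complex.exp_ofReal_mul_I_re]
  have hzim : z.im = r * Real.sin θ' := by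
    rw [hz, Complex.im_ofReal_mul, Complex.exp_ofReal_mul_I_im]
  have hterm : ∀ p : ℕ, (2 * z * z ^ p).re = 2 * r ^ (p + 1) * Real.cos ((p + 1) * θ') := by
    intro p
    have : 2 * z * z ^ p = ((2 * r ^ (p + 1) : ℝ) : ℂ) * Complex.exp (((p +
        1) * θ' : ℝ) * Complex.I) := by
      rw [mul_assoc, ← pow_succ', hz, mul_pow, ← Complex.exp_nat_mul]
      push_cast; ring_nf
    rw [this, Complex.re_ofReal_mul, Complex.exp_ofReal_mul_I_re]
  have hval : (2 * z * (1 - z)⁻¹).re =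
      √(1 - k ^ 2 * Real.cos θ ^ 2) / (1 - k * Real.cos θ * Real.cos θ') - 1 := by
    have e1 := mul_smallRoot h0 h1 θ
    have e2 := smallRoot_quadratic h0 h1 θ
    rw [← hr] at e1 e2
    have hn : Complex.normSq (1 - z) = 1 - 2 * r * Real.cos θ' + r ^ 2 := by
      rw [Complex.normSq_apply]
      simp only [Complex.sub_re, Complex.one_re, Complex.sub_im, Complex.one_im, hzre, hzim]
      linear_combination r ^ 2 * Real.sin_sq_add_cos_sq θ'
    have hz1 : 1 - z ≠ 0 := by
      intro h
      have : z = 1 := by linear_combination -h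
      rw [this] at hzn; simp at hzn
    have hnp : 1 - 2 * r * Real.cos θ' + r ^ 2 ≠ 0 := by
      rw [← hn]; exact (Complex.normSq_pos.2 hz1).ne'
    have e3 : (1 - k * Real.cos θ * Real.cos θ') * (1 + r ^ 2) = 1 - 2 * r * Real.cos θ' +
        r ^ 2 := by
      linear_combination -Real.cos θ' * e2
    have hd : 1 - k * Real.cos θ * Real.cos θ' ≠ 0 := by
      intro h; rw [h, zero_mul] at e3; exact hnp e3.symm
    have e4 : √(1 - k ^ 2 * Real.cos θ ^ 2) * (1 + r ^ 2) = 1 - r ^ 2 := by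
      linear_combination (1 + r ^ 2) * e1 - r * e2
    have e5 : (2 * z * (1 - z)⁻¹).re = 2 * (r * Real.cos θ' - r ^ 2) / (1 - 2 * r * Real.cos θ' +
        r ^ 2) := by
      rw [Complex.inv_def, hn, ← mul_assoc, Complex.re_mul_ofReal, ← div_eq_mul_inv]
      congr 1
      simp [Complex.mul_re, hzre, hzim]
      linear_combination (-2) * r ^ 2 * Real.sin_sq_add_cos_sq θ'
    rw [e5, ← e3, eq_sub_iff_add_eq]
    rw [div_add_one (by rw [e3]; exact hnp), div_eq_div_iff (by rw [e3]; exact hnp) hd]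
    linear_combination (1 - k * Real.cos θ * Real.cos θ') * (e3 - e4)
  rw [hval] at hre
  simpa only [hterm] using hre
end Kernel

section Orthogonality

lemma integral_cos_int_mul (n : ℤ) : ∫ θ in (0:ℝ)..π, Real.cos (n * θ) = if n =
    0 then π else 0 := by
  split_ifs with h
  · simp [h]
  · have hn : (n : ℝ) ≠ 0 := by exact_mod_cast h
    rw [intervalIntegral.integral_comp_mul_left (fun x => Real.cos x) hn, integral_cos]
    simp [Real.sin_int_mul_pi]

lemma integral_cos_mul_cos_int (p y : ℤ) : ∫ θ in (0:ℝ)..π, Real.cos (p * θ) * Real.cos (y * θ) =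
    ((if p - y = 0 then π else 0) + (if p + y = 0 then π else 0)) / 2 := by
  rw [← integral_cos_int_mul, ← integral_cos_int_mul, ← intervalIntegral.integral_add
    (by apply Continuous.intervalIntegrable; fun_prop)
    (by apply Continuous.intervalIntegrable; fun_prop),
    ← intervalIntegral.integral_div]
  refine intervalIntegral.integral_congr fun θ _ => ?_
  push_cast
  rw [sub_mul, add_mul, Real.cos_sub, Real.cos_add]; ring

end Orthogonality

section Boundary

variable {β : ℝ} {h : ℕ → ℤ → ℤ → ℝ} {k : ℝ}

/-- The boundary density attached to a half-plane solution. -/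
def bdryFun (β : ℝ) (h : ℕ → ℤ → ℤ → ℝ) (k θ : ℝ) : ℝ :=
  1 + ∑' p : ℕ, 2 * β * halfGen h (k / 4) (p + 1) 0 * Real.cos ((p + 1) * θ)

lemma IsHalfPlane.abs_coeff_le (hh : IsHalfPlane β h) (hβ : |β| ≤ 1) (h0 : 0 ≤ k) (h1 : k < 1)
    (p : ℕ) : |2 * β * halfGen h (k / 4) (p + 1) 0| ≤ 2 * (k ^ (p + 1) * (1 - k)⁻¹) := by
  have := hh.abs_halfGen_le hβ (t := k / 4) (by positivity) (by linarith) (x :=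
      (p : ℤ) + 1) (y := 0)
    (by omega)
  rw [show 4 * (k / 4) = k by ring, show ((p : ℤ) + 1).toNat = p + 1 by omega] at this
  rw [abs_mul, abs_mul, abs_two]
  have h3 := abs_nonneg (halfGen h (k / 4) (p + 1) 0)
  nlinarith [abs_nonneg β]

lemma summable_coeff_bound (h0 : 0 ≤ k) (h1 : k < 1) :
    Summable fun p : ℕ => 2 * (k ^ (p + 1) * (1 - k)⁻¹) :=
  (((summable_nat_add_iff 1).2 (summable_geometric_of_lt_one h0 h1)).mul_right _).mul_left _

lemma IsHalfPlane.abs_term_le (hh : IsHalfPlane β h) (hβ : |β| ≤ 1) (h0 : 0 ≤ k) (h1 : k < 1)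
    (p : ℕ) (θ : ℝ) : ‖2 * β * halfGen h (k / 4) (p + 1) 0 * Real.cos ((p + 1) * θ)‖ ≤
      2 * (k ^ (p + 1) * (1 - k)⁻¹) := by
  rw [Real.norm_eq_abs, abs_mul]
  exact (mul_le_of_le_one_right (abs_nonneg _) (Real.abs_cos_le_one _)).trans
    (hh.abs_coeff_le hβ h0 h1 p)

lemma IsHalfPlane.hasSum_bdryFun (hh : IsHalfPlane β h) (hβ : |β| ≤ 1) (h0 : 0 ≤ k) (h1 : k < 1)
    (θ : ℝ) : HasSum (fun p : ℕ => 2 * β * halfGen h (k / 4) (p + 1) 0 * Real.cos ((p + 1) * θ))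
      (bdryFun β h k θ - 1) := by
  have := (Summable.of_norm_bounded (summable_coeff_bound h0 h1)
    fun p => hh.abs_term_le hβ h0 h1 p θ).hasSum
  rwa [bdryFun, add_sub_cancel_left]

lemma IsHalfPlane.continuous_bdryFun (hh : IsHalfPlane β h) (hβ : |β| ≤ 1) (h0 : 0 ≤ k)
    (h1 : k < 1) : Continuous (bdryFun β h k) :=
  continuous_const.add (continuous_tsum (fun p => by fun_prop) (summable_coeff_bound h0 h1)
    fun p θ => hh.abs_term_le hβ h0 h1 p θ)

lemma bdryFun_neg (θ : ℝ) : bdryFun β h k (-θ) = bdryFun β h k θ := by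
  simp [bdryFun]

lemma IsHalfPlane.halfGen_eq_zero (hh : IsHalfPlane β h) (t : ℝ) {p : ℤ} (hp : 0 ≤ p)
    (hodd : ¬ (2 : ℤ) ∣ p) : halfGen h t p 0 = 0 := by
  have : ∀ n, t ^ n * h n p 0 = 0 := by
    intro n
    by_contra hn
    have := hh.parity n p 0 hp (right_ne_zero_of_mul hn)
    omega
  simp [halfGen, this]

lemma IsHalfPlane.bdryFun_pi_sub (hh : IsHalfPlane β h) (θ : ℝ) :
    bdryFun β h k (π - θ) = bdryFun β h k θ := by
  unfold bdryFun
  congr 1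
  refine tsum_congr fun p => ?_
  by_cases hp : (2 : ℤ) ∣ p + 1
  · obtain ⟨q, hq⟩ := hp
    have hq' : ((p : ℝ) + 1) = 2 * q := by exact_mod_cast hq
    congr 1
    rw [hq', show 2 * (q : ℝ) * (π - θ) = -(2 * q * θ) + q * (2 * π) by ring,
      Real.cos_add_int_mul_two_pi, Real.cos_neg]
  · rw [hh.halfGen_eq_zero _ (by omega) hp]; simp

/-- Integrals against the boundary density can be expanded termwise. -/
lemma IsHalfPlane.hasSum_integral_bdryFun (hh : IsHalfPlane β h) (hβ : |β| ≤ 1) (h0 : 0 ≤ k)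
    (h1 : k < 1) {f : ℝ → ℝ} (hf : Continuous f) (hf1 : ∀ θ, |f θ| ≤ 1) :
    HasSum (fun p : ℕ => ∫ θ in (0:ℝ)..π,
      2 * β * halfGen h (k / 4) (p + 1) 0 * Real.cos ((p + 1) * θ) * f θ)
      (∫ θ in (0:ℝ)..π, (bdryFun β h k θ - 1) * f θ) := by
  refine intervalIntegral.hasSum_integral_of_dominated_convergence
    (fun p _ => 2 * (k ^ (p + 1) * (1 - k)⁻¹)) (fun p => ?_) (fun p => ?_) ?_ ?_ ?_
  · apply Continuous.aestronglyMeasurable; fun_prop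
  · refine Filter.Eventually.of_forall fun θ _ => ?_
    rw [norm_mul]
    exact (mul_le_of_le_one_right (norm_nonneg _) (hf1 θ)).trans (hh.abs_term_le hβ h0 h1 p θ)
  · exact Filter.Eventually.of_forall fun θ _ => summable_coeff_bound h0 h1
  · exact intervalIntegrable_const
  · exact Filter.Eventually.of_forall fun θ _ => (hh.hasSum_bdryFun hβ h0 h1 θ).mul_right _

/-- The Fourier coefficients of the boundary density. -/
lemma IsHalfPlane.integral_cos_bdryFun (hh : IsHalfPlane β h) (hβ : |β| ≤ 1) (h0 : 0 ≤ k)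
    (h1 : k < 1) (y : ℤ) : ∫ θ in (0:ℝ)..π, bdryFun β h k θ * Real.cos (y * θ) =
      π * halfGen h (k / 4) 0 y := by
  have hs := hh.hasSum_integral_bdryFun hβ h0 h1 (f := fun θ => Real.cos (y * θ)) (by fun_prop)
    fun θ => Real.abs_cos_le_one _
  have hterm : ∀ p : ℕ, ∫ θ in (0:ℝ)..π, 2 * β * halfGen h (k / 4) (p + 1) 0 *
      Real.cos ((p + 1) * θ) * Real.cos (y * θ) = 2 * β * halfGen h (k / 4) (p + 1) 0 *
      (((if (p + 1 : ℤ) - y = 0 then π else 0) + (if (p + 1 : ℤ) + y = 0 then π else 0)) / 2) := by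
    intro p
    rw [← integral_cos_mul_cos_int, ← intervalIntegral.integral_const_mul]
    refine intervalIntegral.integral_congr fun θ _ => ?_
    push_cast; ring
  simp only [hterm] at hs
  have hc := hh.continuous_bdryFun hβ h0 h1
  have hsub : ∫ θ in (0:ℝ)..π, bdryFun β h k θ * Real.cos (y * θ) =
      (∫ θ in (0:ℝ)..π, (bdryFun β h k θ - 1) * Real.cos (y * θ)) + if y = 0 then π else 0 := by
    rw [← integral_cos_int_mul, ← intervalIntegral.integral_add
      (by apply Continuous.intervalIntegrable; fun_prop)
      (by apply Continuous.intervalIntegrable; fun_prop)]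
    refine intervalIntegral.integral_congr fun θ _ => ?_
    ring
  rw [hsub, ← hs.tsum_eq]
  by_cases hy : y = 0
  · subst hy
    have hz : ∀ p : ℕ, 2 * β * halfGen h (k / 4) (p + 1) 0 *
        (((if (p + 1 : ℤ) - 0 = 0 then π else 0) + (if (p + 1 : ℤ) + 0 = 0 then π else 0)) / 2) =
            0 := by
      intro p
      rw [if_neg (by omega), if_neg (by omega)]; ring
    simp only [hz, tsum_zero, hh.halfGen_zero]
    simp
  · rw [if_neg hy, hh.halfGen_boundary _ hy, tsum_eq_single (y.natAbs - 1)]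
    · have e : (((y.natAbs - 1 : ℕ) : ℤ) + 1) = |y| := by rw [Int.abs_eq_natAbs]; omega
      rw [e]
      rcases abs_cases y with ⟨h1, h2⟩ | ⟨h1, h2⟩
      · rw [h1, if_pos (by ring), if_neg (by omega)]; ring
      · rw [h1, if_pos (by ring : -y + y = 0), if_neg (by omega)]; ring
    · intro p hp
      rw [if_neg (by omega), if_neg (by omega)]; ring

end Boundary

section Representation

variable {β : ℝ} {h : ℕ → ℤ → ℤ → ℝ} {k : ℝ}

lemma IsHalfPlane.halfGen_eq_integral (hh : IsHalfPlane β h) (hβ : |β| ≤ 1) (h0 : 0 ≤ k)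
    (h1 : k < 1) {x : ℤ} (y : ℤ) (hx : 0 ≤ x) : ∫ θ in (0:ℝ)..π,
      bdryFun β h k θ * (smallRoot k θ ^ x.toNat * Real.cos (y * θ)) =
      π * halfGen h (k / 4) x y := by
  have hc := hh.continuous_bdryFun hβ h0 h1
  have hr := continuous_smallRoot k
  set I : ℤ → ℤ → ℝ := fun x y => ∫ θ in (0:ℝ)..π,
      bdryFun β h k θ * (smallRoot k θ ^ x.toNat * Real.cos (y * θ)) with hI
  obtain ⟨B, hB⟩ := (isCompact_uIcc (a := 0) (b := π)).exists_bound_of_continuousOn hc.continuousOn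
  have hbd : ∀ x y, |I x y| ≤ B * π := by
    intro x y
    have := intervalIntegral.norm_integral_le_of_norm_le_const (a := 0) (b := π) (C := B)
      (f := fun θ => bdryFun β h k θ * (smallRoot k θ ^ x.toNat * Real.cos (y * θ))) (fun θ hθ => by
        rw [norm_mul]
        refine (mul_le_of_le_one_right (norm_nonneg _) ?_).trans (hB θ (Set.uIoc_subset_uIcc hθ))
        rw [Real.norm_eq_abs, abs_mul, abs_pow]
        have h2 := (abs_smallRoot_le h0 θ).trans h1.le
        exact mul_le_one₀ (pow_le_one₀ (abs_nonneg _) h2) (abs_nonneg _) (Real.abs_cos_le_one _))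
    rwa [sub_zero, abs_of_pos Real.pi_pos] at this
  have hD := halfPlane_unique (t := k / 4) (D := fun x y => I x y - π * halfGen h (k / 4) x y)
    (M := B * π + π * (1 - k)⁻¹) (by positivity) (by linarith) (fun x y hx => ?_) (fun y => ?_)
    (fun x y hx => ?_) (y := y) hx
  · linarith
  · have h2 := hh.abs_halfGen_le hβ (t := k / 4) (by positivity) (by linarith) (y := y) hx
    rw [show 4 * (k / 4) = k by ring] at h2
    have h3 : k ^ x.toNat * (1 - k)⁻¹ ≤ (1 - k)⁻¹ :=
      mul_le_of_le_one_left (inv_nonneg.2 (by linarith)) (pow_le_one₀ h0 h1.le)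
    calc _ ≤ |I x y| + |π * halfGen h (k / 4) x y| := abs_sub _ _
      _ ≤ _ := by
        rw [abs_mul, abs_of_pos Real.pi_pos]
        have := hbd x y
        have := Real.pi_pos
        gcongr
        exact h2.trans h3
  · simp only [hI]
    have := hh.integral_cos_bdryFun hβ h0 h1 y
    simpa [sub_eq_zero] using this
  · have e1 := hh.halfGen_step hβ (t := k / 4) (by positivity) (by linarith) y hx
    have e2 : I x y = k / 4 * (I (x + 1) (y + 1) + I (x + 1) (y - 1) + I (x - 1) (y - 1) +
        I (x - 1) (y + 1)) := by
      have hi : ∀ x y : ℤ, IntervalIntegrable (fun θ => bdryFun β h k θ *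
          (smallRoot k θ ^ x.toNat * Real.cos (y * θ))) MeasureTheory.volume 0 π := fun x y => by
        apply Continuous.intervalIntegrable; fun_prop
      simp only [hI]
      rw [← intervalIntegral.integral_add (hi _ _) (hi _ _), ← intervalIntegral.integral_add
        ((hi _ _).add (hi _ _)) (hi _ _), ← intervalIntegral.integral_add
        (((hi _ _).add (hi _ _)).add (hi _ _)) (hi _ _), ← intervalIntegral.integral_const_mul]
      refine intervalIntegral.integral_congr fun θ _ => ?_
      obtain ⟨n, rfl⟩ : ∃ n : ℕ, x = n + 1 := ⟨x.toNat - 1, by omega⟩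
      have a1 : ((n : ℤ) + 1).toNat = n + 1 := by omega
      have a2 : ((n : ℤ) + 1 + 1).toNat = n + 2 := by omega
      have a3 : ((n : ℤ) + 1 - 1).toNat = n := by omega
      simp only [a1, a2, a3]
      push_cast
      rw [add_mul, sub_mul, Real.cos_add, Real.cos_sub, one_mul]
      linear_combination (-(1 / 2) * bdryFun β h k θ * smallRoot k θ ^ n * Real.cos (y * θ)) *
        smallRoot_quadratic h0 h1 θ
    linear_combination e2 - π * e1

/-- The integral equation satisfied by the boundary density. -/
lemma IsHalfPlane.bdryFun_eq_integral (hh : IsHalfPlane β h) (hβ : |β| ≤ 1) (h0 : 0 ≤ k)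
    (h1 : k < 1) (θ' : ℝ) : π * (bdryFun β h k θ' - 1) = β * ∫ θ in (0:ℝ)..π,
      (√(1 - k ^ 2 * Real.cos θ ^ 2) / (1 - k * Real.cos θ * Real.cos θ') - 1) *
        bdryFun β h k θ := by
  have hc := hh.continuous_bdryFun hβ h0 h1
  have hr := continuous_smallRoot k
  obtain ⟨B, hB⟩ := (isCompact_uIcc (a := 0) (b := π)).exists_bound_of_continuousOn hc.continuousOn
  have hB0 : 0 ≤ B := (norm_nonneg _).trans (hB 0 Set.left_mem_uIcc)
  have hs := intervalIntegral.hasSum_integral_of_dominated_convergence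
    (μ := MeasureTheory.volume) (a := 0) (b := π)
    (F := fun (p : ℕ) θ => 2 * smallRoot k θ ^ (p + 1) * Real.cos ((p + 1) * θ') * bdryFun β h k θ)
    (f := fun θ => (√(1 - k ^ 2 * Real.cos θ ^ 2) / (1 - k * Real.cos θ * Real.cos θ') - 1) *
        bdryFun β h k θ)
    (fun p _ => 2 * k ^ (p + 1) * B) (fun p => ?_) (fun p => ?_) ?_ ?_ ?_
  · have h2 := ((hh.hasSum_bdryFun hβ h0 h1 θ').mul_left π)
    refine h2.unique ?_
    convert hs.mul_left β using 1
    funext p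
    have h3 := hh.halfGen_eq_integral hβ h0 h1 (x := (p : ℤ) + 1) 0 (by omega)
    rw [show ((p : ℤ) + 1).toNat = p + 1 by omega] at h3
    calc π * (2 * β * halfGen h (k / 4) (p + 1) 0 * Real.cos ((p + 1) * θ'))
        = β * (2 * Real.cos ((p + 1) * θ') * (π * halfGen h (k / 4) (p + 1) 0)) := by ring
      _ = _ := by
        rw [← h3, ← intervalIntegral.integral_const_mul]
        congr 1
        refine intervalIntegral.integral_congr fun θ _ => ?_
        simp only [Int.cast_zero, zero_mul, Real.cos_zero]
        ring
  · apply Continuous.aestronglyMeasurable; fun_prop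
  · refine Filter.Eventually.of_forall fun θ hθ => ?_
    rw [norm_mul, norm_mul, norm_mul, norm_pow]
    simp only [Real.norm_eq_abs, abs_two]
    have h2 := abs_smallRoot_le h0 θ
    have h3 := hB θ (Set.uIoc_subset_uIcc hθ)
    have h4 := Real.abs_cos_le_one ((p + 1) * θ')
    rw [Real.norm_eq_abs] at h3
    calc _ ≤ 2 * k ^ (p + 1) * 1 * B := by gcongr
      _ = _ := by ring
  · exact Filter.Eventually.of_forall fun θ _ => ((((summable_nat_add_iff 1).2
      (summable_geometric_of_lt_one h0 h1)).mul_left 2).mul_right B)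
  · exact intervalIntegrable_const
  · exact Filter.Eventually.of_forall fun θ _ => (hasSum_poisson h0 h1 θ θ').mul_right _

/-- The symmetric form of the integral equation. -/
lemma IsHalfPlane.bdryFun_eq_integral_symm (hh : IsHalfPlane β h) (hβ : |β| ≤ 1) (h0 : 0 ≤ k)
    (h1 : k < 1) (θ' : ℝ) : π * (bdryFun β h k θ' - 1) = β * ∫ θ in (0:ℝ)..π,
      (√(1 - k ^ 2 * Real.cos θ ^ 2) / (1 - k ^ 2 * Real.cos θ ^ 2 * Real.cos θ' ^ 2) - 1) *
        bdryFun β h k θ := by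
  have hc := hh.continuous_bdryFun hβ h0 h1
  have hpos : ∀ θ θ', 0 < 1 - k * Real.cos θ * Real.cos θ' := by
    intro θ θ'
    have h2 : |k * Real.cos θ * Real.cos θ'| ≤ k * 1 * 1 := by
      rw [abs_mul, abs_mul, abs_of_nonneg h0]
      gcongr <;> exact Real.abs_cos_le_one _
    linarith [(abs_le.1 h2).2]
  have e1 := hh.bdryFun_eq_integral hβ h0 h1 θ'
  have e2 := hh.bdryFun_eq_integral hβ h0 h1 (π - θ')
  rw [hh.bdryFun_pi_sub] at e2
  have hi : ∀ θ', IntervalIntegrable (fun θ => (√(1 - k ^ 2 * Real.cos θ ^ 2) /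
      (1 - k * Real.cos θ * Real.cos θ') - 1) * bdryFun β h k θ) MeasureTheory.volume 0 π := by
    intro θ'
    apply Continuous.intervalIntegrable
    have : Continuous fun θ => √(1 - k ^ 2 * Real.cos θ ^ 2) / (1 - k * Real.cos θ * Real.cos θ') :=
      Continuous.div (by fun_prop) (by fun_prop) fun θ => (hpos θ θ').ne'
    fun_prop
  have e3 : ∫ θ in (0:ℝ)..π,
      (√(1 - k ^ 2 * Real.cos θ ^ 2) / (1 - k ^ 2 * Real.cos θ ^ 2 * Real.cos θ' ^ 2) - 1) *
        bdryFun β h k θ = ((∫ θ in (0:ℝ)..π,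
      (√(1 - k ^ 2 * Real.cos θ ^ 2) / (1 - k * Real.cos θ * Real.cos θ') - 1) *
        bdryFun β h k θ) + ∫ θ in (0:ℝ)..π,
      (√(1 - k ^ 2 * Real.cos θ ^ 2) / (1 - k * Real.cos θ * Real.cos (π - θ')) - 1) *
        bdryFun β h k θ) / 2 := by
    rw [← intervalIntegral.integral_add (hi _) (hi _), ← intervalIntegral.integral_div]
    refine intervalIntegral.integral_congr fun θ _ => ?_
    have a1 := (hpos θ θ').ne'
    have a2 := (hpos θ (π - θ')).ne'
    have a3 : 1 - k ^ 2 * Real.cos θ ^ 2 * Real.cos θ' ^ 2 =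
      (1 - k * Real.cos θ * Real.cos θ') * (1 - k * Real.cos θ * Real.cos (π - θ')) := by
      rw [Real.cos_pi_sub]; ring
    simp only [a3]
    have a4 : (1 - k * Real.cos θ * Real.cos θ') + (1 - k * Real.cos θ * Real.cos (π - θ')) =
        2 := by
      rw [Real.cos_pi_sub]; ring
    generalize 1 - k * Real.cos θ * Real.cos θ' = D₁ at *
    generalize 1 - k * Real.cos θ * Real.cos (π - θ') = D₂ at *
    field_simp
    linear_combination (-√(1 - k ^ 2 * Real.cos θ ^ 2) * bdryFun β h k θ) * a4
  rw [e3]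
  linear_combination (e1 + e2) / 2

/-- The generating function of excursions through the boundary density. -/
lemma IsHalfPlane.bdryFun_half_pi (hh : IsHalfPlane β h) (hβ : |β| ≤ 1) (h0 : 0 ≤ k)
    (h1 : k < 1) : bdryFun β h k (π / 2) = 1 - β * (k * halfGen h (k / 4) 1 1) := by
  have hc := hh.continuous_bdryFun hβ h0 h1
  have e1 := hh.bdryFun_eq_integral hβ h0 h1 (π / 2)
  have e2 := hh.halfGen_eq_integral hβ h0 h1 1 zero_le_one
  have e3 : ∫ θ in (0:ℝ)..π,
      (√(1 - k ^ 2 * Real.cos θ ^ 2) / (1 - k * Real.cos θ * Real.cos (π / 2)) - 1) *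
        bdryFun β h k θ = -k * ∫ θ in (0:ℝ)..π,
      bdryFun β h k θ * (smallRoot k θ ^ (1 : ℤ).toNat * Real.cos ((1 : ℤ) * θ)) := by
    rw [← intervalIntegral.integral_const_mul]
    refine intervalIntegral.integral_congr fun θ _ => ?_
    simp only [Real.cos_pi_div_two, Int.toNat_one, Int.cast_one, pow_one, one_mul, mul_zero,
      sub_zero, div_one]
    linear_combination (bdryFun β h k θ) * mul_smallRoot h0 h1 θ
  rw [e3, e2] at e1
  have := Real.pi_pos.ne'
  apply mul_left_cancel₀ this
  linear_combination e1

lemma hasSum_excNorm (b : ℝ) (hb : Real.cos (π * b / 4) ≠ 0) (h0 : 0 ≤ k) (h1 : k < 1) :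
    HasSum (fun l : ℕ => excNorm b (l + 1) * (k ^ 2) ^ (l + 1))
      (k * halfGen (halfWt b) (k / 4) 1 1) := by
  have hh := isHalfPlane_halfWt b hb
  have hs := ((hh.summable (Real.abs_cos_le_one _) (t := k / 4) (by positivity) (by linarith)
    (x := 1) (y := 1) zero_le_one).hasSum).mul_left k
  have hodd : Function.Injective fun l : ℕ => 2 * l + 1 := fun a b h => by simpa using h
  rw [← hodd.hasSum_iff] at hs
  · refine (funext fun l => ?_ : (fun l : ℕ => excNorm b (l + 1) * (k ^ 2) ^ (l + 1)) = _) ▸ hs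
    have h2 := halfWt_diag b hb (2 * l + 1)
    have h3 := cExc_eq_excNorm (b := b) (l := l + 1) (by omega)
    rw [show 2 * (l + 1) = 2 * l + 1 + 1 by ring, h2] at h3
    have h4 : 4 * halfWt b (2 * l + 1) 1 1 = excNorm b (l + 1) * 16 ^ (l + 1) := by
        exact_mod_cast h3
    simp only [Function.comp]
    have h5 : halfWt b (2 * l + 1) 1 1 = excNorm b (l + 1) * 16 ^ (l + 1) / 4 := by linarith
    rw [h5, div_pow, show (16 : ℝ) = 4 ^ 2 by norm_num, ← pow_mul, ← pow_mul,
      show 2 * (l + 1) = 2 * l + 1 + 1 by ring, pow_succ 4 (2 * l + 1)]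
    have : (4 : ℝ) ^ (2 * l + 1) ≠ 0 := by positivity
    field_simp
    ring
  · intro n hn
    by_contra h2
    have := (hh.parity n 1 1 zero_le_one (right_ne_zero_of_mul (right_ne_zero_of_mul h2))).1
    apply hn
    exact ⟨n / 2, by simp only; omega⟩

end Representation

section IntegralEquation

variable {m β : ℝ} {X : ℝ → ℝ}

/-- The frequencies of the period lattice. -/
def jfreq (m : ℝ) (n : ℤ) : ℝ := n * π / ellK m

lemma jfreq_mul (h0 : 0 ≤ m) (h1 : m < 1) (n : ℤ) : jfreq m n * ellK m = n * π := by
  rw [jfreq, div_mul_cancel₀ _ (ellK_pos h0 h1).ne']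

lemma sin_jfreq_mul (h0 : 0 ≤ m) (h1 : m < 1) (n : ℤ) : Real.sin (jfreq m n * ellK m) = 0 := by
  rw [jfreq_mul h0 h1, Real.sin_int_mul_pi]

lemma periodic_cos_jfreq (h0 : 0 ≤ m) (h1 : m < 1) (n : ℤ) :
    Function.Periodic (fun u => Real.cos (jfreq m n * u)) (2 * ellK m) := fun u => by
  simp only
  rw [mul_add, show jfreq m n * (2 * ellK m) = 2 * (jfreq m n * ellK m) by ring, jfreq_mul h0 h1,
    show 2 * ((n : ℝ) * π) = n * (2 * π) by ring, Real.cos_add_int_mul_two_pi]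

lemma integral_odd_eq_zero {f : ℝ → ℝ} (hf : ∀ u, f (-u) = -f u) (K : ℝ) :
    ∫ u in -K..K, f u = 0 := by
  have h := intervalIntegral.integral_comp_neg (a := -K) (b := K) f
  simp only [hf, neg_neg, intervalIntegral.integral_neg] at h
  linarith

lemma integral_jdn_add_mul_cos (h0 : 0 ≤ m) (h1 : m < 1) (n : ℤ) (u : ℝ) :
    ∫ v in -ellK m..ellK m, jdn m (u + v) * Real.cos (jfreq m n * v) =
      Real.cos (jfreq m n * u) * ∫ v in -ellK m..ellK m, jdn m v * Real.cos (jfreq m n * v) := by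
  set K := ellK m with hK
  set ω := jfreq m n with hω
  have hd := continuous_jdn h0 h1
  have e1 : ∫ v in -K..K, jdn m (u + v) * Real.cos (ω * v) =
      ∫ w in (u - K)..(u - K) + 2 * K, jdn m w * Real.cos (ω * (w - u)) := by
    have := intervalIntegral.integral_comp_add_left (a := -K) (b := K)
      (fun w => jdn m w * Real.cos (ω * (w - u))) u
    simp only [add_sub_cancel_left] at this
    rw [this]; congr 1; ring
  have hper : Function.Periodic (fun w => jdn m w * Real.cos (ω * (w - u))) (2 * K) := fun w => by
    have h2 := periodic_cos_jfreq h0 h1 n (w - u)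
    simp only at h2 ⊢
    rw [jdn_periodic h0 h1, show w + 2 * K - u = w - u + 2 * K by ring]
    rw [h2]
  have e2 := hper.intervalIntegral_add_eq (u - K) (-K)
  rw [show -K + 2 * K = K by ring] at e2
  rw [e1, e2]
  have e3 : ∫ w in -K..K, jdn m w * Real.cos (ω * (w - u)) =
      Real.cos (ω * u) * (∫ w in -K..K, jdn m w * Real.cos (ω * w)) +
      Real.sin (ω * u) * ∫ w in -K..K, jdn m w * Real.sin (ω * w) := by
    rw [← intervalIntegral.integral_const_mul, ← intervalIntegral.integral_const_mul,
      ← intervalIntegral.integral_add (by apply Continuous.intervalIntegrable; fun_prop)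
        (by apply Continuous.intervalIntegrable; fun_prop)]
    congr 1; funext w
    rw [mul_sub, Real.cos_sub]; ring
  have e4 : ∫ w in -K..K, jdn m w * Real.sin (ω * w) = 0 :=
    integral_odd_eq_zero (fun w => by rw [jdn_neg h0 h1, mul_neg, Real.sin_neg]; ring) K
  rw [e3, e4]
  ring

lemma integral_kernel_mul_cos (h0 : 0 ≤ m) (h1 : m < 1) (n : ℤ) (u : ℝ) :
    ∫ v in -ellK m..ellK m, jdn m u * jdn m v / (1 - m * jsn m u ^ 2 * jsn m v ^ 2) *
      Real.cos (jfreq m n * v) =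
      Real.cos (jfreq m n * u) * ∫ v in -ellK m..ellK m, jdn m v * Real.cos (jfreq m n * v) := by
  have hd := continuous_jdn h0 h1
  have hk : ∀ v, jdn m u * jdn m v / (1 - m * jsn m u ^ 2 * jsn m v ^ 2) =
      (jdn m (u + v) + jdn m (u + -v)) / 2 := by
    intro v
    rw [jdn_add h0 h1, jdn_add h0 h1, jsn_neg h0 h1, jcn_neg h0 h1, jdn_neg h0 h1, neg_sq]
    ring
  have e1 := integral_jdn_add_mul_cos h0 h1 n u
  have e2 := intervalIntegral.integral_comp_neg (a := -ellK m) (b := ellK m)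
    (fun v => jdn m (u + v) * Real.cos (jfreq m n * v))
  simp only [mul_neg, Real.cos_neg, neg_neg] at e2
  have e3 : ∫ v in -ellK m..ellK m, jdn m u * jdn m v / (1 - m * jsn m u ^ 2 * jsn m v ^ 2) *
      Real.cos (jfreq m n * v) = ((∫ v in -ellK m..ellK m, jdn m (u +
          v) * Real.cos (jfreq m n * v)) +
        ∫ v in -ellK m..ellK m, jdn m (u + -v) * Real.cos (jfreq m n * v)) / 2 := by
    rw [← intervalIntegral.integral_add (by apply Continuous.intervalIntegrable; fun_prop)
        (by apply Continuous.intervalIntegrable; fun_prop), ← intervalIntegral.integral_div]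
    congr 1; funext v
    rw [hk]; ring
  rw [e3, e2, e1]; ring

/-- The cosine coefficients of a solution of the integral equation. -/
lemma integral_mul_cos_eq (h0 : 0 ≤ m) (h1 : m < 1) (hX : Continuous X)
    (heq : ∀ v, π * (X v - jdn m v) = β * ∫ u in -ellK m..ellK m,
      (jdn m u * jdn m v / (1 - m * jsn m u ^ 2 * jsn m v ^ 2) - jdn m v) * X u) (n : ℤ) :
    π * ((∫ v in -ellK m..ellK m, X v * Real.cos (jfreq m n * v)) -
      ∫ v in -ellK m..ellK m, jdn m v * Real.cos (jfreq m n * v)) =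
    β * (∫ v in -ellK m..ellK m, jdn m v * Real.cos (jfreq m n * v)) *
      ((∫ v in -ellK m..ellK m, X v * Real.cos (jfreq m n * v)) -
        ∫ v in -ellK m..ellK m, X v) := by
  set K := ellK m with hK
  set ω := jfreq m n with hω
  have hKp : 0 < K := ellK_pos h0 h1
  have hd := continuous_jdn h0 h1
  have hs := continuous_jsn h0 h1
  have hker : Continuous fun p : ℝ × ℝ => jdn m p.1 * jdn m p.2 /
      (1 - m * jsn m p.1 ^ 2 * jsn m p.2 ^ 2) :=
    Continuous.div (by fun_prop) (by fun_prop) fun p => (one_sub_mul_jsn_sq_mul_pos h0 h1 _ _).ne'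
  have hcont : Continuous fun p : ℝ × ℝ => (jdn m p.2 * jdn m p.1 /
      (1 - m * jsn m p.2 ^ 2 * jsn m p.1 ^ 2) - jdn m p.1) * X p.2 * Real.cos (ω * p.1) := by
    have := hker.comp continuous_swap
    simp only [Function.comp_def, Prod.fst_swap, Prod.snd_swap] at this
    fun_prop
  have hA : ∫ v in -K..K, π * (X v - jdn m v) * Real.cos (ω * v) =
      ∫ v in -K..K, (β * ∫ u in -K..K,
      (jdn m u * jdn m v / (1 - m * jsn m u ^ 2 * jsn m v ^ 2) - jdn m v) * X u) * Real.cos (ω * v)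
          := by
    congr 1; funext v; rw [heq]
  have hL : ∫ v in -K..K, π * (X v - jdn m v) * Real.cos (ω * v) =
      π * ((∫ v in -K..K, X v * Real.cos (ω * v)) - ∫ v in -K..K, jdn m v * Real.cos (ω * v)) := by
    rw [← intervalIntegral.integral_sub (by apply Continuous.intervalIntegrable; fun_prop)
        (by apply Continuous.intervalIntegrable; fun_prop), ← intervalIntegral.integral_const_mul]
    congr 1; funext v; ring
  have hR : ∫ v in -K..K, (β * ∫ u in -K..K,
      (jdn m u * jdn m v / (1 - m * jsn m u ^ 2 * jsn m v ^ 2) - jdn m v) * X u) * Real.cos (ω * v)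
          =
      β * ∫ u in -K..K, ∫ v in -K..K,
      (jdn m u * jdn m v / (1 - m * jsn m u ^ 2 * jsn m v ^ 2) - jdn m v) * X u * Real.cos (ω * v)
          := by
    have hswap := MeasureTheory.intervalIntegral_intervalIntegral_swap
      (F := fun v u => (jdn m u * jdn m v / (1 - m * jsn m u ^ 2 * jsn m v ^ 2) - jdn m v) * X u *
        Real.cos (ω * v)) (a := -K) (b := K) (c := -K) (d := K)
      ((hcont.continuousOn.integrableOn_compact (isCompact_uIcc.prod isCompact_uIcc)).mono_set
        (Set.prod_mono uIoc_subset_uIcc uIoc_subset_uIcc))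
    rw [← hswap, ← intervalIntegral.integral_const_mul]
    congr 1; funext v
    rw [intervalIntegral.integral_mul_const, mul_assoc]
  have hI : ∀ u, ∫ v in -K..K,
      (jdn m u * jdn m v / (1 - m * jsn m u ^ 2 * jsn m v ^ 2) - jdn m v) * X u * Real.cos (ω * v) =
      (∫ v in -K..K, jdn m v * Real.cos (ω * v)) * (X u * Real.cos (ω * u) - X u) := by
    intro u
    have hku : Continuous fun v => jdn m u * jdn m v / (1 - m * jsn m u ^ 2 * jsn m v ^ 2) :=
      hker.comp (f := fun v => (u, v)) (by fun_prop)
    have h2 := integral_kernel_mul_cos h0 h1 n u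
    rw [← hω, ← hK] at h2
    have h3 : ∫ v in -K..K,
      (jdn m u * jdn m v / (1 - m * jsn m u ^ 2 * jsn m v ^ 2) - jdn m v) * X u * Real.cos (ω * v) =
      X u * ((∫ v in -K..K, jdn m u * jdn m v / (1 - m * jsn m u ^ 2 * jsn m v ^ 2) * Real.cos (ω *
          v)) -
        ∫ v in -K..K, jdn m v * Real.cos (ω * v)) := by
      rw [← intervalIntegral.integral_sub (by apply Continuous.intervalIntegrable; fun_prop)
        (by apply Continuous.intervalIntegrable; fun_prop), ← intervalIntegral.integral_const_mul]
      congr 1; funext v; ring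
    rw [h3, h2]; ring
  rw [hL, hR] at hA
  rw [hA]
  simp only [hI]
  rw [intervalIntegral.integral_const_mul, intervalIntegral.integral_sub
    (by apply Continuous.intervalIntegrable; fun_prop)
        (by apply Continuous.intervalIntegrable; fun_prop)]
  ring

end IntegralEquation

section FourierInversion

variable {K : ℝ} {X : ℝ → ℝ}

lemma hasSum_integral_mul_cos (hK : 0 < K) (hX : Continuous X) (hper : Function.Periodic X (2 * K))
    (heven : ∀ v, X (-v) = X v)
    (hs : Summable fun n : ℤ => ∫ v in -K..K, X v * Real.cos (n * π / K * v)) :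
    HasSum (fun n : ℤ => (∫ v in -K..K, X v * Real.cos (n * π / K * v)) / (2 * K)) (X 0) := by
  have : Fact (0 < 2 * K) := ⟨by positivity⟩
  have hper' : Function.Periodic (fun v => (X v : ℂ)) (2 * K) := fun v => by
    simp only; rw [hper]
  have hXc : Continuous fun v => (X v : ℂ) := Complex.continuous_ofReal.comp hX
  let f : C(AddCircle (2 * K), ℂ) := ⟨hper'.lift, continuous_coinduced_dom.mpr hXc⟩
  have hf : ∀ v : ℝ, f (v : AddCircle (2 * K)) = (X v : ℂ) := fun v => hper'.lift_coe v
  have hcoef : ∀ n : ℤ, fourierCoeff f n =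
      (((∫ v in -K..K, X v * Real.cos (n * π / K * v)) / (2 * K) : ℝ) : ℂ) := by
    intro n
    rw [fourierCoeff_eq_intervalIntegral _ n (-K), show -K + 2 * K = K by ring]
    have h1 : ∀ v : ℝ, @fourier (2 * K) (-n) (v : AddCircle (2 * K)) • f (v : AddCircle (2 * K)) =
        ((X v * Real.cos (n * π / K * v) : ℝ) : ℂ) -
          Complex.I * ((X v * Real.sin (n * π / K * v) : ℝ) : ℂ) := by
      intro v
      rw [hf, fourier_coe_apply, smul_eq_mul,
        show 2 * (π : ℂ) * Complex.I * ((-n : ℤ) : ℂ) * (v : ℂ) / ((2 * K : ℝ) : ℂ) =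
          ((-(n * π / K * v) : ℝ) : ℂ) * Complex.I by
            have : (K : ℂ) ≠ 0 := by exact_mod_cast hK.ne'
            push_cast; field_simp, Complex.exp_mul_I]
      simp only [← Complex.ofReal_cos, ← Complex.ofReal_sin, Real.cos_neg, Real.sin_neg]
      push_cast; ring
    have h2 : ∫ v in -K..K, X v * Real.sin (n * π / K * v) = 0 :=
      integral_odd_eq_zero (fun v => by rw [heven, mul_neg, Real.sin_neg]; ring) K
    simp only [h1]
    rw [intervalIntegral.integral_sub
      (by apply Continuous.intervalIntegrable; fun_prop)
      (by apply Continuous.intervalIntegrable; fun_prop),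
      intervalIntegral.integral_const_mul, intervalIntegral.integral_ofReal,
      intervalIntegral.integral_ofReal, h2]
    simp [div_eq_inv_mul]
  have hsum : Summable (fourierCoeff f) := by
    rw [show fourierCoeff f = _ from funext hcoef]
    exact_mod_cast hs.div_const (2 * K)
  have h0 := has_pointwise_sum_fourier_series_of_summable hsum (0 : ℝ)
  rw [hf] at h0
  simp only [hcoef, fourier_coe_apply] at h0
  simp only [Complex.ofReal_zero, mul_zero, zero_div, Complex.exp_zero, smul_eq_mul, mul_one] at h0
  exact_mod_cast h0

end FourierInversion

section Density

variable {β k : ℝ} {h : ℕ → ℤ → ℤ → ℝ}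

/-- The boundary density in the elliptic coordinate. -/
def ellDensity (β : ℝ) (h : ℕ → ℤ → ℤ → ℝ) (k u : ℝ) : ℝ :=
  jdn (k ^ 2) u * bdryFun β h k (π / 2 - jam (k ^ 2) u)

lemma IsHalfPlane.continuous_ellDensity (hh : IsHalfPlane β h) (hβ : |β| ≤ 1) (h0 : 0 ≤ k)
    (h1 : k < 1) : Continuous (ellDensity β h k) := by
  have m1 : k ^ 2 < 1 := by nlinarith
  exact (continuous_jdn (sq_nonneg k) m1).mul ((hh.continuous_bdryFun hβ h0 h1).comp
    (continuous_const.sub (continuous_jam (sq_nonneg k) m1)))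

lemma IsHalfPlane.ellDensity_neg (hh : IsHalfPlane β h) (h0 : 0 ≤ k)
    (h1 : k < 1) (u : ℝ) : ellDensity β h k (-u) = ellDensity β h k u := by
  have m1 : k ^ 2 < 1 := by nlinarith
  rw [ellDensity, jdn_neg (sq_nonneg k) m1, jam_neg (sq_nonneg k) m1,
    ← hh.bdryFun_pi_sub (k := k), ellDensity]
  congr 2; ring

lemma IsHalfPlane.periodic_ellDensity (hh : IsHalfPlane β h) (h0 : 0 ≤ k)
    (h1 : k < 1) : Function.Periodic (ellDensity β h k) (2 * ellK (k ^ 2)) := fun u => by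
  have m1 : k ^ 2 < 1 := by nlinarith
  rw [ellDensity, jdn_periodic (sq_nonneg k) m1, jam_add_period (sq_nonneg k) m1, ellDensity,
    ← hh.bdryFun_pi_sub (k := k) (π / 2 - jam (k ^ 2) u), ← bdryFun_neg (π - _)]
  congr 2; ring

lemma IsHalfPlane.ellDensity_eq (hh : IsHalfPlane β h) (hβ : |β| ≤ 1) (h0 : 0 ≤ k)
    (h1 : k < 1) (v : ℝ) : π * (ellDensity β h k v - jdn (k ^ 2) v) =
      β * ∫ u in -ellK (k ^ 2)..ellK (k ^ 2),
      (jdn (k ^ 2) u * jdn (k ^ 2) v / (1 - k ^ 2 * jsn (k ^ 2) u ^ 2 * jsn (k ^ 2) v ^ 2) -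
        jdn (k ^ 2) v) * ellDensity β h k u := by
  have m1 : k ^ 2 < 1 := by nlinarith
  have m0 := sq_nonneg k
  have hΦ := hh.continuous_bdryFun hβ h0 h1
  set m := k ^ 2 with hm
  have e1 := hh.bdryFun_eq_integral_symm hβ h0 h1 (π / 2 - jam m v)
  rw [← hm] at e1
  set v' := π / 2 - jam m v with hv'
  have hcv : Real.cos v' = jsn m v := by rw [hv', Real.cos_pi_div_two_sub, jsn]
  set g : ℝ → ℝ := fun θ => (√(1 - m * Real.cos θ ^ 2) / (1 - m * Real.cos θ ^ 2 * Real.cos v' ^ 2)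
      - 1) *
    bdryFun β h k θ with hg
  have hgc : Continuous g := by
    refine ((Continuous.div (by fun_prop) (by fun_prop) fun θ => ?_).sub continuous_const).mul hΦ
    have h2 := Real.cos_sq_le_one θ
    have h3 := Real.cos_sq_le_one v'
    have h4 : Real.cos θ ^ 2 * Real.cos v' ^ 2 ≤ 1 := mul_le_one₀ h2 (sq_nonneg _) h3
    nlinarith [mul_nonneg (sq_nonneg (Real.cos θ)) (sq_nonneg (Real.cos v'))]
  have e2 := intervalIntegral.integral_comp_mul_deriv (a := -ellK m) (b := ellK m)
    (f := fun u => π / 2 - jam m u) (f' := fun u => -jdn m u) (g := g)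
    (fun u _ => by simpa using (hasDerivAt_jam' m0 m1 u).const_sub (π / 2))
    (continuous_jdn m0 m1).neg.continuousOn hgc
  simp only [jam_neg m0 m1, jam_ellK m0 m1, Function.comp_def] at e2
  rw [sub_self, show π / 2 - -(π / 2) = π by ring, intervalIntegral.integral_symm 0 π] at e2
  have e3 : ∀ u, (jdn m u * jdn m v / (1 - m * jsn m u ^ 2 * jsn m v ^ 2) -
        jdn m v) * ellDensity β h k u = - jdn m v * (g (π / 2 - jam m u) * -jdn m u) := by
    intro u
    simp only [hg, ellDensity, ← hm, hcv, Real.cos_pi_div_two_sub]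
    simp only [jdn, jsn]
    ring
  simp only [e3]
  rw [intervalIntegral.integral_const_mul, e2, ellDensity, ← hm, ← hv']
  linear_combination jdn m v * e1

lemma IsHalfPlane.integral_ellDensity_mul_cos (hh : IsHalfPlane β h) (hβ : |β| ≤ 1) (h0 : 0 < k)
    (h1 : k < 1) (n : ℤ) :
    (∫ v in -ellK (k ^ 2)..ellK (k ^ 2), ellDensity β h k v * Real.cos (n * π / ellK (k ^ 2) * v)) *
      (Real.cosh (n * π * ellK (1 - k ^ 2) / ellK (k ^ 2)) - β) = π * (1 - β) := by
  have m1 : k ^ 2 < 1 := by nlinarith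
  have m0 : 0 < k ^ 2 := by positivity
  have hX := hh.continuous_ellDensity hβ h0.le h1
  have key := fun n => integral_mul_cos_eq m0.le m1 hX (hh.ellDensity_eq hβ h0.le h1) n
  simp only [integral_jdn_mul_cos m0 m1 (sin_jfreq_mul m0.le m1 _)] at key
  have k0 := key 0
  simp only [jfreq, Int.cast_zero, zero_mul, zero_div, Real.cos_zero, mul_one, Real.cosh_zero,
      div_one,
    sub_self, mul_zero] at k0
  have k0' := (mul_eq_zero.1 k0).resolve_left Real.pi_ne_zero
  have kn := key n
  rw [sub_eq_zero.1 k0'] at kn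
  have hc := Real.cosh_pos (n * π * ellK (1 - k ^ 2) / ellK (k ^ 2))
  rw [show jfreq (k ^ 2) n * ellK (1 - k ^ 2) = n * π * ellK (1 - k ^ 2) / ellK (k ^ 2) by
    rw [jfreq]; ring] at kn
  simp only [jfreq] at kn
  set C := Real.cosh (n * π * ellK (1 - k ^ 2) / ellK (k ^ 2))
  set I := ∫ v in -ellK (k ^ 2)..ellK (k ^ 2), ellDensity β h k v *
    Real.cos (n * π / ellK (k ^ 2) * v)
  have hpi := Real.pi_ne_zero
  field_simp at kn
  linear_combination kn

lemma one_div_cosh_sub_le {β : ℝ} (hβ : β < 1) (x : ℝ) :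
    1 / (Real.cosh x - β) ≤ 2 / min 1 (1 - β) * Real.exp (-x) := by
  have hc := Real.one_le_cosh x
  have hmin : 0 < min 1 (1 - β) := lt_min one_pos (by linarith)
  have h1 : min 1 (1 - β) * Real.cosh x ≤ Real.cosh x - β := by
    rcases le_total 0 β with hb | hb
    · rw [min_eq_right (by linarith)]; nlinarith
    · rw [min_eq_left (by linarith)]; linarith
  have h2 : Real.exp x / 2 ≤ Real.cosh x := by
    rw [Real.cosh_eq]; linarith [Real.exp_pos (-x)]
  have h3 : 0 < min 1 (1 - β) * (Real.exp x / 2) := by positivity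
  calc 1 / (Real.cosh x - β) ≤ 1 / (min 1 (1 - β) * (Real.exp x / 2)) :=
        one_div_le_one_div_of_le h3 ((mul_le_mul_of_nonneg_left h2 hmin.le).trans h1)
    _ = _ := by rw [Real.exp_neg]; field_simp

lemma summable_one_div_cosh_sub {β y : ℝ} (hβ : β < 1) (hy : 0 < y) :
    Summable fun n : ℤ => 1 / (Real.cosh (n * y) - β) := by
  have hs : Summable fun n : ℕ => 1 / (Real.cosh (n * y) - β) := by
    refine .of_nonneg_of_le (fun n => ?_) (fun n => one_div_cosh_sub_le hβ _) ?_
    · exact one_div_nonneg.2 (by linarith [Real.one_le_cosh (n * y)])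
    · refine Summable.mul_left _ ?_
      simpa [← Real.exp_nat_mul] using
        summable_geometric_of_lt_one (Real.exp_pos (-y)).le (Real.exp_lt_one_iff.2 (by linarith))
  exact .of_nat_of_neg (by simpa using hs) (by simpa using hs)

lemma IsHalfPlane.hasSum_bdryFun_half_pi (hh : IsHalfPlane β h) (hβ : |β| ≤ 1) (hβ1 : β < 1)
    (h0 : 0 < k) (h1 : k < 1) :
    HasSum (fun n : ℤ => π * (1 - β) / (2 * ellK (k ^ 2)) *
      (1 / (Real.cosh (n * (π * ellK (1 - k ^ 2) / ellK (k ^ 2))) - β)))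
      (bdryFun β h k (π / 2)) := by
  have m1 : k ^ 2 < 1 := by nlinarith
  have m0 : 0 < k ^ 2 := by positivity
  have hK := ellK_pos m0.le m1
  have hK' := ellK_pos (m := 1 - k ^ 2) (by linarith) (by linarith)
  have hI : ∀ n : ℤ, ∫ v in -ellK (k ^ 2)..ellK (k ^ 2), ellDensity β h k v *
      Real.cos (n * π / ellK (k ^ 2) * v) = π * (1 - β) *
      (1 / (Real.cosh (n * (π * ellK (1 - k ^ 2) / ellK (k ^ 2))) - β)) := by
    intro n
    have e := hh.integral_ellDensity_mul_cos hβ h0 h1 n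
    have hc := Real.one_le_cosh (n * π * ellK (1 - k ^ 2) / ellK (k ^ 2))
    rw [show n * (π * ellK (1 - k ^ 2) / ellK (k ^ 2)) = n * π * ellK (1 - k ^ 2) / ellK (k ^ 2)
      by ring, mul_one_div, eq_div_iff (by linarith), e]
  have hs := hasSum_integral_mul_cos hK (hh.continuous_ellDensity hβ h0.le h1)
    (hh.periodic_ellDensity h0.le h1) (hh.ellDensity_neg h0.le h1) (by
      simp only [hI]
      exact (summable_one_div_cosh_sub hβ1 (by positivity)).mul_left _)
  have e0 : ellDensity β h k 0 = bdryFun β h k (π / 2) := by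
    rw [ellDensity, jdn_zero m0.le m1, jam_zero m0.le m1]; simp
  rw [e0] at hs
  simp only [hI] at hs
  convert hs using 1
  funext n; ring

lemma IsHalfPlane.bdryFun_half_pi_of_eq_one (hh : IsHalfPlane 1 h) (h0 : 0 < k) (h1 : k < 1) :
    bdryFun 1 h k (π / 2) = π / (2 * ellK (k ^ 2)) := by
  have m1 : k ^ 2 < 1 := by nlinarith
  have m0 : 0 < k ^ 2 := by positivity
  have hK := ellK_pos m0.le m1
  have hK' := ellK_pos (m := 1 - k ^ 2) (by linarith) (by linarith)
  have hβ : |(1:ℝ)| ≤ 1 := by simp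
  have hI : ∀ n : ℤ, n ≠ 0 → ∫ v in -ellK (k ^ 2)..ellK (k ^ 2), ellDensity 1 h k v *
      Real.cos (n * π / ellK (k ^ 2) * v) = 0 := by
    intro n hn
    have e := hh.integral_ellDensity_mul_cos hβ h0 h1 n
    rw [sub_self, mul_zero] at e
    refine (mul_eq_zero.1 e).resolve_right ?_
    have := Real.one_lt_cosh.2 (show n * π * ellK (1 - k ^ 2) / ellK (k ^ 2) ≠ 0 by positivity)
    linarith
  have hX := hh.continuous_ellDensity hβ h0.le h1
  have hz : ∫ v in -ellK (k ^ 2)..ellK (k ^ 2), ellDensity 1 h k v = π := by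
    have key := integral_mul_cos_eq m0.le m1 hX (hh.ellDensity_eq hβ h0.le h1) 0
    have hd := integral_jdn m0.le m1
    simp only [jfreq, Int.cast_zero, zero_mul, zero_div, Real.cos_zero, mul_one,
      sub_self, mul_zero] at key
    have := (mul_eq_zero.1 key).resolve_left Real.pi_ne_zero
    linarith
  have hs := hasSum_integral_mul_cos hK hX
    (hh.periodic_ellDensity h0.le h1) (hh.ellDensity_neg h0.le h1)
    (summable_of_ne_finset_zero (s := {0}) fun n hn => hI n (by simpa using hn))
  have e0 : ellDensity 1 h k 0 = bdryFun 1 h k (π / 2) := by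
    rw [ellDensity, jdn_zero m0.le m1, jam_zero m0.le m1]; simp
  rw [e0] at hs
  have := hs.unique (hasSum_single 0 fun n hn => by rw [hI n hn, zero_div])
  rw [this]
  simp [hz]

end Density

section QuarterPeriod

lemma ellK_eq_integral_cos (ε : ℝ) :
    ellK (1 - ε) = ∫ x in (0:ℝ)..π / 2, 1 / √(Real.sin x ^ 2 + ε * Real.cos x ^ 2) := by
  have h := intervalIntegral.integral_comp_sub_left (a := 0) (b := π / 2)
    (fun x => 1 / √(1 - (1 - ε) * Real.sin x ^ 2)) (π / 2)
  rw [sub_self, sub_zero] at h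
  rw [ellK, ellInt, ← h]
  refine intervalIntegral.integral_congr fun x _ => ?_
  simp only [Real.sin_pi_div_two_sub]
  congr 2
  have := Real.sin_sq_add_cos_sq x
  linear_combination -this

lemma sin_sq_add_mul_cos_sq_pos {ε : ℝ} (hε : 0 < ε) (x : ℝ) :
    0 < Real.sin x ^ 2 + ε * Real.cos x ^ 2 := by
  have := Real.sin_sq_add_cos_sq x
  rcases (sq_nonneg (Real.sin x)).lt_or_eq with h | h
  · positivity
  · rw [← h, zero_add]
    rw [show Real.cos x ^ 2 = 1 by linarith]; simpa

lemma integral_cos_div_sqrt {ε : ℝ} (hε : 0 < ε) (h1 : ε < 1) :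
    ∫ x in (0:ℝ)..π / 2, Real.cos x / √(Real.sin x ^ 2 + ε * Real.cos x ^ 2) =
      Real.arsinh (√((1 - ε) / ε)) / √(1 - ε) := by
  have hs : 0 < √(1 - ε) := Real.sqrt_pos.2 (by linarith)
  have hd : ∀ x, HasDerivAt (fun x => Real.arsinh (√((1 - ε) / ε) * Real.sin x) / √(1 - ε))
      (Real.cos x / √(Real.sin x ^ 2 + ε * Real.cos x ^ 2)) x := by
    intro x
    have := (((Real.hasDerivAt_sin x).const_mul (√((1 - ε) / ε))).arsinh).div_const (√(1 - ε))
    refine this.congr_deriv ?_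
    have hp := sin_sq_add_mul_cos_sq_pos hε x
    have e1 : 1 + (√((1 - ε) / ε) * Real.sin x) ^ 2 =
        (Real.sin x ^ 2 + ε * Real.cos x ^ 2) / ε := by
      rw [mul_pow, Real.sq_sqrt (div_nonneg (by linarith) hε.le)]
      have := Real.sin_sq_add_cos_sq x
      field_simp
      linear_combination (-ε) * this
    rw [e1, Real.sqrt_div hp.le, Real.sqrt_div (by linarith)]
    have h2 := Real.sqrt_pos.2 hp
    have h3 := Real.sqrt_pos.2 hε
    simp only [smul_eq_mul]
    field_simp
  have hc : Continuous fun x => Real.cos x / √(Real.sin x ^ 2 + ε * Real.cos x ^ 2) :=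
    Continuous.div (by fun_prop) (by fun_prop) fun x =>
      (Real.sqrt_pos.2 (sin_sq_add_mul_cos_sq_pos hε x)).ne'
  rw [intervalIntegral.integral_eq_sub_of_hasDerivAt (fun x _ => hd x) (hc.intervalIntegrable _ _)]
  simp

lemma integral_tan_half : ∫ x in (0:ℝ)..π / 2, (1 - Real.cos x) / Real.sin x = Real.log 2 := by
  have hpos : ∀ x ∈ uIcc 0 (π / 2), 0 < Real.cos (x / 2) := by
    intro x hx
    rw [uIcc_of_le (by positivity)] at hx
    exact Real.cos_pos_of_mem_Ioo ⟨by linarith [hx.1, Real.pi_pos], by linarith [hx.2, Real.pi_pos]⟩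
  have hd : ∀ x ∈ uIcc 0 (π / 2), HasDerivAt (fun x => -2 * Real.log (Real.cos (x / 2)))
      ((1 - Real.cos x) / Real.sin x) x := by
    intro x hx
    have hc := hpos x hx
    have := (((hasDerivAt_id x).div_const 2).cos.log hc.ne').const_mul (-2)
    refine this.congr_deriv ?_
    simp only [id]
    have e1 : Real.sin x = 2 * Real.sin (x / 2) * Real.cos (x / 2) := by
      rw [← Real.sin_two_mul]; ring_nf
    have e2 : Real.cos x = 1 - 2 * Real.sin (x / 2) ^ 2 := by
      have := Real.cos_two_mul (x / 2)
      have h4 := Real.sin_sq_add_cos_sq (x / 2)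
      rw [mul_div_cancel₀ x (two_ne_zero)] at this
      linarith
    rw [e1, e2]
    rcases eq_or_ne (Real.sin (x / 2)) 0 with h | h
    · simp [h]
    · field_simp
      ring
  have hi : IntervalIntegrable (fun x => (1 - Real.cos x) / Real.sin x) MeasureTheory.volume 0 (π /
      2) := by
    refine intervalIntegral.intervalIntegrable_deriv_of_nonneg
      (fun x hx => (hd x hx).continuousAt.continuousWithinAt)
      (fun x hx => hd x (Ioo_subset_Icc_self hx)) fun x hx => ?_
    rw [min_eq_left (by positivity), max_eq_right (by positivity)] at hx
    exact div_nonneg (by linarith [Real.cos_le_one x])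
      (Real.sin_nonneg_of_nonneg_of_le_pi hx.1.le (by linarith [hx.2, Real.pi_pos]))
  rw [intervalIntegral.integral_eq_sub_of_hasDerivAt hd hi]
  rw [zero_div, Real.cos_zero, Real.log_one, show π / 2 / 2 = π / 4 by ring, Real.cos_pi_div_four,
    Real.log_div (by positivity) two_ne_zero, Real.log_sqrt (by norm_num)]
  ring

lemma tendsto_integral_one_sub_cos : Filter.Tendsto (fun ε : ℝ => ∫ x in (0:ℝ)..π / 2,
    (1 - Real.cos x) / √(Real.sin x ^ 2 + ε * Real.cos x ^ 2)) (nhdsWithin 0 (Ioi 0))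
    (nhds (Real.log 2)) := by
  rw [← integral_tan_half]
  refine intervalIntegral.tendsto_integral_filter_of_dominated_convergence (fun _ => 1) ?_ ?_ ?_ ?_
  · filter_upwards [self_mem_nhdsWithin] with ε hε
    refine (Continuous.div (by fun_prop) (by fun_prop) fun x => ?_).aestronglyMeasurable
    exact (Real.sqrt_pos.2 (sin_sq_add_mul_cos_sq_pos hε x)).ne'
  · filter_upwards [self_mem_nhdsWithin] with ε hε
    refine .of_forall fun x hx => ?_
    rw [uIoc_of_le (by positivity)] at hx
    have h1 : 0 < √(Real.sin x ^ 2 + ε * Real.cos x ^ 2) :=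
      Real.sqrt_pos.2 (sin_sq_add_mul_cos_sq_pos hε x)
    have hs : 0 ≤ Real.sin x := Real.sin_nonneg_of_nonneg_of_le_pi hx.1.le (by linarith [hx.2,
        Real.pi_pos])
    have hc : 0 ≤ Real.cos x := Real.cos_nonneg_of_mem_Icc ⟨by linarith [hx.1, Real.pi_pos], hx.2⟩
    have h2 : Real.sin x ≤ √(Real.sin x ^ 2 + ε * Real.cos x ^ 2) :=
      Real.le_sqrt_of_sq_le (by have := mul_nonneg (le_of_lt hε) (sq_nonneg (Real.cos x)); linarith)
    have h3 : 1 - Real.cos x ≤ Real.sin x := by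
      nlinarith [Real.sin_sq_add_cos_sq x, mul_nonneg hs hc]
    rw [Real.norm_eq_abs, abs_of_nonneg (div_nonneg (by linarith [Real.cos_le_one x]) h1.le),
      div_le_one h1]
    linarith
  · simp
  · refine .of_forall fun x hx => ?_
    rw [uIoc_of_le (by positivity)] at hx
    have hs : 0 < Real.sin x := Real.sin_pos_of_pos_of_lt_pi hx.1 (by linarith [hx.2, Real.pi_pos])
    have : Filter.Tendsto (fun ε : ℝ => (1 - Real.cos x) / √(Real.sin x ^ 2 + ε * Real.cos x ^ 2))
        (nhds 0) (nhds ((1 - Real.cos x) / √(Real.sin x ^ 2 + 0 * Real.cos x ^ 2))) := by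
      refine ContinuousAt.tendsto (f := fun ε : ℝ => (1 - Real.cos x) /
        √(Real.sin x ^ 2 + ε * Real.cos x ^ 2)) (ContinuousAt.div (by fun_prop) (by fun_prop) ?_)
      simp [hs.ne', sq_nonneg]
    rw [zero_mul, add_zero, Real.sqrt_sq hs.le] at this
    exact this.mono_left nhdsWithin_le_nhds

lemma tendsto_arsinh_add_log : Filter.Tendsto (fun ε : ℝ =>
    Real.arsinh (√((1 - ε) / ε)) / √(1 - ε) + Real.log ε / 2) (nhdsWithin 0 (Ioi 0))
    (nhds (Real.log 2)) := by
  have e1 : ∀ᶠ ε : ℝ in nhdsWithin 0 (Ioi 0), Real.log (1 + √(1 - ε)) / √(1 - ε) -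
      (Real.log ε * ε) * (1 / (2 * √(1 - ε) * (1 + √(1 - ε)))) =
      Real.arsinh (√((1 - ε) / ε)) / √(1 - ε) + Real.log ε / 2 := by
    filter_upwards [Ioo_mem_nhdsGT (zero_lt_one' ℝ)] with ε hε
    have hs : 0 < √(1 - ε) := Real.sqrt_pos.2 (by linarith [hε.2])
    have h2 : √(1 - ε) ^ 2 = 1 - ε := Real.sq_sqrt (by linarith [hε.2])
    have e2 : Real.arsinh (√((1 - ε) / ε)) = Real.log (1 + √(1 - ε)) - Real.log ε / 2 := by
      rw [Real.arsinh, Real.sq_sqrt (div_nonneg (by linarith [hε.2]) hε.1.le),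
        show 1 + (1 - ε) / ε = 1 / ε by field_simp [hε.1.ne']; ring,
        Real.sqrt_div (by linarith [hε.2]), Real.sqrt_div zero_le_one, Real.sqrt_one, ← add_div,
        Real.log_div (by positivity) (Real.sqrt_pos.2 hε.1).ne', Real.log_sqrt hε.1.le, add_comm]
    rw [e2]
    field_simp
    linear_combination -Real.log ε * h2
  refine Filter.Tendsto.congr' e1 ?_
  have hl : Filter.Tendsto (fun ε : ℝ => Real.log ε * ε) (nhdsWithin 0 (Ioi 0)) (nhds 0) := by
    simpa using tendsto_log_mul_rpow_nhdsGT_zero (r := 1) one_pos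
  have hc1 : Filter.Tendsto (fun ε : ℝ => Real.log (1 + √(1 - ε)) / √(1 - ε)) (nhdsWithin 0 (Ioi 0))
      (nhds (Real.log 2)) := by
    have : ContinuousAt (fun ε : ℝ => Real.log (1 + √(1 - ε)) / √(1 - ε)) 0 :=
      ContinuousAt.div (ContinuousAt.log (by fun_prop) (by simp)) (by fun_prop) (by simp)
    have h := this.tendsto.mono_left (nhdsWithin_le_nhds (s := Ioi 0))
    convert h using 2
    norm_num
  have hc2 : Filter.Tendsto (fun ε : ℝ => 1 / (2 * √(1 - ε) * (1 +
      √(1 - ε)))) (nhdsWithin 0 (Ioi 0))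
      (nhds (1 / 4)) := by
    have : ContinuousAt (fun ε : ℝ => 1 / (2 * √(1 - ε) * (1 + √(1 - ε)))) 0 :=
      ContinuousAt.div (by fun_prop) (by fun_prop) (by simp)
    have h := this.tendsto.mono_left (nhdsWithin_le_nhds (s := Ioi 0))
    convert h using 2
    norm_num
  simpa using hc1.sub (hl.mul hc2)

lemma tendsto_ellK_add_log : Filter.Tendsto (fun ε : ℝ => ellK (1 - ε) + Real.log ε / 2)
    (nhdsWithin 0 (Ioi 0)) (nhds (2 * Real.log 2)) := by
  rw [two_mul]
  refine Filter.Tendsto.congr' ?_ (tendsto_integral_one_sub_cos.add tendsto_arsinh_add_log)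
  filter_upwards [Ioo_mem_nhdsGT (zero_lt_one' ℝ)] with ε hε
  have hc : Continuous fun x => 1 / √(Real.sin x ^ 2 + ε * Real.cos x ^ 2) :=
    Continuous.div (by fun_prop) (by fun_prop) fun x =>
      (Real.sqrt_pos.2 (sin_sq_add_mul_cos_sq_pos hε.1 x)).ne'
  rw [← integral_cos_div_sqrt hε.1 hε.2, ← add_assoc, ellK_eq_integral_cos]
  simp only [div_eq_mul_one_div (Real.cos _), div_eq_mul_one_div (1 - Real.cos _)]
  rw [← intervalIntegral.integral_add (by apply Continuous.intervalIntegrable; fun_prop)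
      (by apply Continuous.intervalIntegrable; fun_prop)]
  congr 2; funext x; ring

lemma abs_one_div_sqrt_sub_le {q : ℝ} (h0 : 0 ≤ q) (h1 : q ≤ 1 / 2) :
    |1 / √(1 - q) - (1 + q / 2)| ≤ q ^ 2 := by
  have hp : 0 < √(1 - q) := Real.sqrt_pos.2 (by linarith)
  have hs : √(1 - q) ^ 2 = 1 - q := Real.sq_sqrt (by linarith)
  have hlow : 1 + q / 2 ≤ 1 / √(1 - q) := by
    rw [le_div_iff₀ hp]
    refine abs_le_of_sq_le_sq' (b := 1) ?_ (by norm_num) |>.2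
    rw [mul_pow, hs]; nlinarith [pow_nonneg h0 3, sq_nonneg q]
  have hup : 1 / √(1 - q) ≤ 1 + q / 2 + q ^ 2 := by
    rw [div_le_iff₀ hp]
    refine abs_le_of_sq_le_sq' (a := 1) ?_ (by positivity) |>.2
    rw [mul_pow, hs]; nlinarith [pow_nonneg h0 3, sq_nonneg q, pow_nonneg h0 4,
        mul_nonneg (pow_nonneg h0 2) (sub_nonneg.2 h1),
            mul_nonneg (pow_nonneg h0 3) (sub_nonneg.2 h1),
                mul_nonneg (pow_nonneg h0 4) (sub_nonneg.2 h1)]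
  rw [abs_of_nonneg (by linarith)]; linarith

lemma abs_ellK_sub_le {ε : ℝ} (h0 : 0 ≤ ε) (h1 : ε ≤ 1 / 2) :
    |ellK ε - (π / 2 + π / 8 * ε)| ≤ π / 2 * ε ^ 2 := by
  have hquad : ∫ x in (0:ℝ)..π / 2, (1 + ε * Real.sin x ^ 2 / 2) = π / 2 + π / 8 * ε := by
    rw [intervalIntegral.integral_add (by simp) (by apply Continuous.intervalIntegrable; fun_prop),
      intervalIntegral.integral_div, intervalIntegral.integral_const_mul, integral_sin_sq]
    simp
    ring
  have hc : Continuous fun x => 1 / √(1 - ε * Real.sin x ^ 2) :=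
    Continuous.div (by fun_prop) (by fun_prop) fun x =>
      (Real.sqrt_pos.2 (one_sub_mul_sin_sq_pos h0 (by linarith) x)).ne'
  rw [← hquad, ellK, ellInt, ← intervalIntegral.integral_sub (hc.intervalIntegrable _ _)
    (by apply Continuous.intervalIntegrable; fun_prop)]
  have := intervalIntegral.norm_integral_le_of_norm_le_const (a := 0) (b := π / 2) (C := ε ^ 2)
    (f := fun x => 1 / √(1 - ε * Real.sin x ^ 2) - (1 + ε * Real.sin x ^ 2 / 2)) fun x _ => by
      have hs := Real.sin_sq_le_one x
      have hs0 := sq_nonneg (Real.sin x)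
      refine (abs_one_div_sqrt_sub_le (by positivity) (by nlinarith)).trans ?_
      rw [mul_pow]
      exact mul_le_of_le_one_right (sq_nonneg _) (pow_le_one₀ hs0 hs)
  rw [Real.norm_eq_abs, sub_zero, abs_of_pos (by positivity : 0 < π / 2)] at this
  linarith

lemma abs_one_div_ellK_sub_le {ε : ℝ} (h0 : 0 ≤ ε) (h1 : ε ≤ 1 / 2) :
    |1 / ellK ε - (2 / π - ε / (2 * π))| ≤ ε ^ 2 := by
  have hK : π / 2 ≤ ellK ε := le_ellInt h0 (by linarith) (by positivity)
  have h2 := abs_ellK_sub_le h0 h1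
  have hpi := Real.pi_gt_three
  have hKp : 0 < ellK ε := by linarith
  have e : 1 / ellK ε - (2 / π - ε / (2 * π)) =
      -((ellK ε - (π / 2 + π / 8 * ε)) * (2 / π - ε / (2 * π)) - ε ^ 2 / 16) / ellK ε := by
    field_simp; ring
  have hb : 0 ≤ 2 / π - ε / (2 * π) ∧ 2 / π - ε / (2 * π) ≤ 2 / π := by
    constructor
    · rw [sub_nonneg, div_le_div_iff₀ (by positivity) (by positivity)]; nlinarith
    · have : 0 ≤ ε / (2 * π) := by positivity
      linarith
  rw [e, abs_div, abs_of_pos hKp, div_le_iff₀ hKp, abs_neg]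
  refine (abs_sub _ _).trans ?_
  rw [abs_mul, abs_of_nonneg hb.1, abs_of_nonneg (by positivity : 0 ≤ ε ^ 2 / 16)]
  have h3 : |ellK ε - (π / 2 + π / 8 * ε)| * (2 / π - ε / (2 * π)) ≤ π / 2 * ε ^ 2 * (2 / π) :=
    mul_le_mul h2 hb.2 hb.1 (by positivity)
  have h4 : π / 2 * ε ^ 2 * (2 / π) = ε ^ 2 := by field_simp
  nlinarith [sq_nonneg ε]

end QuarterPeriod

lemma HasSum.of_eq {ι : Type*} {f g : ι → ℝ} {a b : ℝ} (h : HasSum f a) (hg : ∀ i, g i = f i)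
    (hb : b = a) : HasSum g b := by
  rwa [funext hg, hb]

section SinhRatio

variable {φ : ℝ}

/-- The continuous extension of `sinh ((π - φ) x) / sinh (π x)`. -/
def sinhRatio (φ x : ℝ) : ℝ :=
  dslope (fun x => Real.sinh ((π - φ) * x)) 0 x / dslope (fun x => Real.sinh (π * x)) 0 x

lemma hasDerivAt_sinh_mul (c x : ℝ) :
    HasDerivAt (fun x => Real.sinh (c * x)) (Real.cosh (c * x) * c) x := by
  simpa using ((hasDerivAt_id x).const_mul c).sinh

lemma continuous_dslope_sinh (c : ℝ) : Continuous (dslope (fun x => Real.sinh (c * x)) 0) := by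
  rw [continuous_iff_continuousAt]
  intro x
  rcases eq_or_ne x 0 with rfl | hx
  · exact continuousAt_dslope_same.2 (hasDerivAt_sinh_mul c 0).differentiableAt
  · rw [continuousAt_dslope_of_ne hx]; fun_prop

lemma dslope_sinh_zero (c : ℝ) : dslope (fun x => Real.sinh (c * x)) 0 0 = c := by
  rw [dslope_same, (hasDerivAt_sinh_mul c 0).deriv]; simp

lemma dslope_sinh_of_ne (c : ℝ) {x : ℝ} (hx : x ≠ 0) :
    dslope (fun x => Real.sinh (c * x)) 0 x = Real.sinh (c * x) / x := by
  rw [dslope_of_ne _ hx, slope_def_field]; simp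

lemma dslope_sinh_pos {c : ℝ} (hc : 0 < c) (x : ℝ) : 0 <
    dslope (fun x => Real.sinh (c * x)) 0 x := by
  rcases lt_trichotomy x 0 with hx | rfl | hx
  · rw [dslope_sinh_of_ne c hx.ne]
    exact div_pos_of_neg_of_neg (Real.sinh_neg_iff.2 (by nlinarith)) hx
  · rwa [dslope_sinh_zero]
  · rw [dslope_sinh_of_ne c hx.ne']
    exact div_pos (Real.sinh_pos_iff.2 (by positivity)) hx

lemma continuous_sinhRatio (φ : ℝ) : Continuous (sinhRatio φ) :=
  (continuous_dslope_sinh _).div (continuous_dslope_sinh _) fun x => (dslope_sinh_pos Real.pi_pos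
      x).ne'

lemma sinhRatio_zero (φ : ℝ) : sinhRatio φ 0 = (π - φ) / π := by
  rw [sinhRatio, dslope_sinh_zero, dslope_sinh_zero]

lemma sinhRatio_of_ne (φ : ℝ) {x : ℝ} (hx : x ≠ 0) :
    sinhRatio φ x = Real.sinh ((π - φ) * x) / Real.sinh (π * x) := by
  rw [sinhRatio, dslope_sinh_of_ne _ hx, dslope_sinh_of_ne _ hx, div_div_div_cancel_right₀ hx]

lemma sinhRatio_neg (φ x : ℝ) : sinhRatio φ (-x) = sinhRatio φ x := by
  rcases eq_or_ne x 0 with rfl | hx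
  · simp
  · rw [sinhRatio_of_ne _ hx, sinhRatio_of_ne _ (neg_ne_zero.2 hx)]
    simp [Real.sinh_neg]

lemma sinhRatio_eq (φ : ℝ) {x : ℝ} (hx : 0 < x) : sinhRatio φ x =
    Real.exp (-(φ * x)) * (1 - Real.exp (-(2 * (π - φ) * x))) / (1 - Real.exp (-(2 * π * x))) := by
  have hs : 0 < Real.sinh (π * x) := Real.sinh_pos_iff.2 (by positivity)
  have hq : Real.exp (-(2 * π * x)) < 1 := Real.exp_lt_one_iff.2 (by
    have := Real.pi_pos; simp only [Left.neg_neg_iff]; positivity)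
  rw [sinhRatio_of_ne _ hx.ne', div_eq_div_iff hs.ne' (by linarith), Real.sinh_eq, Real.sinh_eq]
  simp only [sub_mul, mul_sub, div_mul_eq_mul_div, mul_div_assoc', mul_one, ← Real.exp_add]
  ring_nf

lemma sinhRatio_le (h0 : 0 ≤ φ) {x : ℝ} (hx : 0 < x) :
    sinhRatio φ x ≤ Real.exp (-(φ * x)) := by
  have hq : Real.exp (-(2 * π * x)) < 1 := Real.exp_lt_one_iff.2 (by
    have := Real.pi_pos; simp only [Left.neg_neg_iff]; positivity)
  rw [sinhRatio_eq φ hx, div_le_iff₀ (by linarith)]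
  refine mul_le_mul_of_nonneg_left ?_ (Real.exp_pos _).le
  have : Real.exp (-(2 * π * x)) ≤ Real.exp (-(2 * (π - φ) * x)) := Real.exp_le_exp.2 (by nlinarith)
  linarith

lemma le_sinhRatio (h1 : φ ≤ π) {x : ℝ} (hx : 0 < x) :
    Real.exp (-(φ * x)) * (1 - Real.exp (-(2 * (π - φ) * x))) ≤ sinhRatio φ x := by
  have hq : Real.exp (-(2 * π * x)) < 1 := Real.exp_lt_one_iff.2 (by
    have := Real.pi_pos; simp only [Left.neg_neg_iff]; positivity)
  have h2 : Real.exp (-(2 * (π - φ) * x)) ≤ 1 := Real.exp_le_one_iff.2 (by nlinarith)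
  rw [sinhRatio_eq φ hx]
  refine le_div_self (mul_nonneg (Real.exp_pos _).le (by linarith)) (by linarith) ?_
  linarith [Real.exp_pos (-(2 * π * x))]

lemma sinhRatio_nonneg (h1 : φ ≤ π) {x : ℝ} (hx : 0 < x) : 0 ≤ sinhRatio φ x := by
  have h2 : Real.exp (-(2 * (π - φ) * x)) ≤ 1 := Real.exp_le_one_iff.2 (by nlinarith)
  exact (mul_nonneg (Real.exp_pos _).le (by linarith)).trans (le_sinhRatio h1 hx)

lemma hasSum_sinhRatio (φ : ℝ) {x : ℝ} (hx : 0 < x) :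
    HasSum (fun j : ℕ => Real.exp (-((2 * π * (j + 1) - φ) * x)) - Real.exp (-((2 * π * (j + 1) +
        φ) * x)))
      (Real.exp (-(φ * x)) - sinhRatio φ x) := by
  have hq : Real.exp (-(2 * π * x)) < 1 := Real.exp_lt_one_iff.2 (by
    have := Real.pi_pos; simp only [Left.neg_neg_iff]; positivity)
  have := (hasSum_geometric_of_lt_one (Real.exp_pos _).le hq).mul_left
    (Real.exp (-((2 * π - φ) * x)) - Real.exp (-((2 * π + φ) * x)))
  refine this.of_eq (fun j => ?_) ?_
  · rw [← Real.exp_nat_mul, sub_mul (Real.exp _), ← Real.exp_add, ← Real.exp_add]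
    ring_nf
  · rw [sinhRatio_eq φ hx, ← div_eq_mul_inv, eq_div_iff (by linarith), sub_mul,
      div_mul_cancel₀ _ (by linarith)]
    simp only [sub_mul, mul_sub, mul_one, ← Real.exp_add]
    ring_nf

lemma integrableOn_exp_mul_cos {a : ℝ} (ha : 0 < a) (ω : ℝ) :
    MeasureTheory.IntegrableOn (fun x => Real.exp (-(a * x)) * Real.cos (ω * x)) (Ioi 0) := by
  have h := integrableOn_exp_mul_Ioi (a := -a) (by linarith) 0
  refine h.mono' (by apply Continuous.aestronglyMeasurable; fun_prop) (.of_forall fun x => ?_)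
  rw [norm_mul, Real.norm_eq_abs, Real.abs_exp, neg_mul]
  exact mul_le_of_le_one_right (Real.exp_pos _).le (Real.abs_cos_le_one _)

lemma integral_exp_mul_cos {a : ℝ} (ha : 0 < a) (ω : ℝ) :
    ∫ x in Ioi (0:ℝ), Real.exp (-(a * x)) * Real.cos (ω * x) = a / (a ^ 2 + ω ^ 2) := by
  have hre : ((-a + ω * Complex.I : ℂ)).re < 0 := by simpa using ha
  have h := integral_exp_mul_complex_Ioi hre 0
  have h2 := congrArg Complex.re h
  have h3 : Complex.reCLM (∫ x : ℝ in Ioi 0, Complex.exp ((-a + ω * Complex.I) * x)) =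
      ∫ x : ℝ in Ioi 0, Complex.reCLM (Complex.exp ((-a + ω * Complex.I) * x)) :=
    (Complex.reCLM.integral_comp_comm (integrableOn_exp_mul_complex_Ioi hre 0)).symm
  simp only [Complex.reCLM_apply] at h3
  rw [h3] at h2
  have h4 : ∀ x : ℝ, (Complex.exp ((-a + ω * Complex.I) * x)).re =
      Real.exp (-(a * x)) * Real.cos (ω * x) := by
    intro x; rw [Complex.exp_re]; simp
  simp only [h4] at h2
  rw [h2]
  simp [Complex.div_re, Complex.normSq_apply]
  ring

lemma re_cot (x y : ℝ) : (Complex.cot (x + y * Complex.I)).re =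
    Real.sin (2 * x) / (Real.cosh (2 * y) - Real.cos (2 * x)) := by
  have e1 := Real.sin_sq_add_cos_sq x
  have e2 := Real.cosh_sq y
  rw [Complex.cot, Complex.sin_add_mul_I, Complex.cos_add_mul_I, Complex.div_re]
  simp only [← Complex.ofReal_sin, ← Complex.ofReal_cos, ← Complex.ofReal_sinh,
      ← Complex.ofReal_cosh]
  have hn : Complex.normSq (((Real.sin x : ℝ) : ℂ) * (Real.cosh y : ℝ) +
      (Real.cos x : ℝ) * (Real.sinh y : ℝ) * Complex.I) =
      (Real.cosh (2 * y) - Real.cos (2 * x)) / 2 := by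
    rw [Complex.normSq_apply, Real.cosh_two_mul, Real.cos_two_mul]
    simp [-Complex.ofReal_sin, -Complex.ofReal_cos, -Complex.ofReal_sinh, -Complex.ofReal_cosh]
    grind
  rw [hn, Real.sin_two_mul]
  simp [-Complex.ofReal_sin, -Complex.ofReal_cos, -Complex.ofReal_sinh, -Complex.ofReal_cosh]
  rw [← add_div, div_div_eq_mul_div]
  congr 1
  grind

lemma hasSum_sin_div_cosh_sub (h0 : 0 < φ) (h1 : φ < π) (ω : ℝ) :
    HasSum (fun j : ℕ => (2 * π * (j + 1) - φ) / ((2 * π * (j + 1) - φ) ^ 2 + ω ^ 2) -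
      (2 * π * (j + 1) + φ) / ((2 * π * (j + 1) + φ) ^ 2 + ω ^ 2))
      (φ / (φ ^ 2 + ω ^ 2) - Real.sin φ / (Real.cosh ω - Real.cos φ) / 2) := by
  set z : ℂ := (φ + ω * Complex.I) / (2 * π) with hz
  have hpi : (π : ℂ) ≠ 0 := by exact_mod_cast Real.pi_ne_zero
  have hpi' := Real.pi_pos
  have hmem : z ∈ Complex.integerComplement := by
    rintro ⟨n, hn⟩
    have h2 : (φ + ω * Complex.I : ℂ) = n * (2 * π) := by
      rw [hn, hz]; field_simp
    have h3 := congrArg Complex.re h2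
    simp at h3
    have h4 : (0:ℝ) < n := by
      by_contra hneg
      nlinarith [not_lt.1 hneg]
    have h5 : (n:ℝ) < 1 := by
      by_contra hneg
      nlinarith [not_lt.1 hneg]
    have h6 : 0 < n := by exact_mod_cast h4
    have h7 : n < 1 := by exact_mod_cast h5
    omega
  have hs : HasSum (fun n : ℕ => 1 / (z - (n + 1)) + 1 / (z + (n + 1)))
      (π * Complex.cot (π * z) - 1 / z) := by
    rw [cot_series_rep' hmem]
    exact (summable_cotTerm hmem).hasSum
  have hs2 := (Complex.hasSum_re hs).mul_right (-(1 / (2 * π)))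
  have key : ∀ c : ℝ, (1 / (z + c) : ℂ).re * (1 / (2 * π)) =
      (φ + 2 * π * c) / ((φ + 2 * π * c) ^ 2 + ω ^ 2) := by
    intro c
    have : (1 / (z + c) : ℂ) = (2 * π : ℝ) * (1 / ((φ + 2 * π * c : ℝ) + ω * Complex.I)) := by
      rw [hz, div_add' _ _ _ (by simp), one_div_div]
      push_cast; ring
    rw [this, Complex.re_ofReal_mul, one_div (_ + _), Complex.inv_re]
    simp [Complex.normSq_apply]
    field_simp
  refine hs2.of_eq (fun j => ?_) ?_
  · rw [Complex.add_re]
    have k1 := key (j + 1)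
    have k2 := key (-(j + 1))
    push_cast at k1 k2
    rw [← sub_eq_add_neg] at k2
    rw [mul_neg, add_mul, k1, k2]
    have e : (φ + 2 * π * (-(j + 1) : ℝ)) = -(2 * π * (j + 1) - φ) := by ring
    rw [e, add_comm φ, neg_sq, neg_div]
    ring
  · have k0 := key 0
    simp only [Complex.ofReal_zero, add_zero, mul_zero] at k0
    have hc : (π : ℂ) * z = (φ / 2 : ℝ) + (ω / 2 : ℝ) * Complex.I := by
      rw [hz]; push_cast; field_simp
    rw [Complex.sub_re, mul_neg, sub_mul, k0, hc, Complex.re_ofReal_mul, re_cot,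
      mul_div_cancel₀ φ two_ne_zero, mul_div_cancel₀ ω two_ne_zero]
    field_simp
    ring

end SinhRatio

section Poisson

variable {φ : ℝ}

lemma integrableOn_sinhRatio_mul_cos (h0 : 0 < φ) (h1 : φ < π) (ω : ℝ) :
    MeasureTheory.IntegrableOn (fun x => sinhRatio φ x * Real.cos (ω * x)) (Ioi 0) := by
  have h := integrableOn_exp_mul_Ioi (a := -φ) (by linarith) 0
  refine h.mono' (((continuous_sinhRatio φ).mul (by fun_prop)).aestronglyMeasurable) ?_
  refine (MeasureTheory.ae_restrict_mem measurableSet_Ioi).mono fun x hx => ?_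
  have hx : 0 < x := hx
  rw [norm_mul, Real.norm_eq_abs, abs_of_nonneg (sinhRatio_nonneg h1.le hx), neg_mul]
  exact (mul_le_of_le_one_right (sinhRatio_nonneg h1.le hx) (Real.abs_cos_le_one _)).trans
    (sinhRatio_le h0.le hx)

lemma integral_sinhRatio_mul_cos (h0 : 0 < φ) (h1 : φ < π) (ω : ℝ) :
    ∫ x in Ioi (0:ℝ), sinhRatio φ x * Real.cos (ω * x) =
      Real.sin φ / (Real.cosh ω - Real.cos φ) / 2 := by
  have hpi := Real.pi_pos
  have hb : ∀ j : ℕ, 0 < 2 * π * (j + 1) - φ := fun j => by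
    have : (0:ℝ) ≤ j := j.cast_nonneg
    nlinarith
  have ha : ∀ j : ℕ, 0 < 2 * π * (j + 1) + φ := fun j => by positivity
  have hquad : ∀ (ω : ℝ) (j : ℕ), MeasureTheory.IntegrableOn (fun x =>
      (Real.exp (-((2 * π * (j + 1) - φ) * x)) - Real.exp (-((2 * π * (j + 1) + φ) * x))) *
        Real.cos (ω * x)) (Ioi 0) := fun ω j => by
    simp only [sub_mul (Real.exp _)]
    exact (integrableOn_exp_mul_cos (hb j) ω).sub (integrableOn_exp_mul_cos (ha j) ω)
  have hval : ∀ (ω : ℝ) (j : ℕ), ∫ x in Ioi (0:ℝ),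
      (Real.exp (-((2 * π * (j + 1) - φ) * x)) - Real.exp (-((2 * π * (j + 1) + φ) * x))) *
        Real.cos (ω * x) = (2 * π * (j + 1) - φ) / ((2 * π * (j + 1) - φ) ^ 2 + ω ^ 2) -
      (2 * π * (j + 1) + φ) / ((2 * π * (j + 1) + φ) ^ 2 + ω ^ 2) := fun ω j => by
    simp only [sub_mul (Real.exp _)]
    rw [MeasureTheory.integral_sub (integrableOn_exp_mul_cos (hb j) ω)
      (integrableOn_exp_mul_cos (ha j) ω), integral_exp_mul_cos (hb j), integral_exp_mul_cos (ha j)]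
  have hsum := MeasureTheory.hasSum_integral_of_summable_integral_norm (hquad ω) ?_
  · have hU := hsum.unique ((hasSum_sin_div_cosh_sub h0 h1 ω).of_eq (hval ω) rfl)
    have hI : ∫ x in Ioi (0:ℝ), ∑' j : ℕ,
        (Real.exp (-((2 * π * (j + 1) - φ) * x)) - Real.exp (-((2 * π * (j + 1) + φ) * x))) *
          Real.cos (ω * x) = ∫ x in Ioi (0:ℝ), (Real.exp (-(φ * x)) * Real.cos (ω * x) -
            sinhRatio φ x * Real.cos (ω * x)) :=
      MeasureTheory.setIntegral_congr_fun measurableSet_Ioi fun x hx => by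
        rw [← sub_mul]
        exact ((hasSum_sinhRatio φ hx).mul_right _).tsum_eq
    rw [hI, MeasureTheory.integral_sub (integrableOn_exp_mul_cos h0 ω)
      (integrableOn_sinhRatio_mul_cos h0 h1 ω), integral_exp_mul_cos h0] at hU
    linarith
  · refine (hasSum_sin_div_cosh_sub h0 h1 0).summable.of_nonneg_of_le
      (fun j => MeasureTheory.integral_nonneg fun x => norm_nonneg _) fun j => ?_
    rw [← hval 0 j]
    refine MeasureTheory.setIntegral_mono_on (hquad ω j).norm (hquad 0 j) measurableSet_Ioi fun x hx
        => ?_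
    have hx : 0 < x := hx
    have hd : 0 ≤ Real.exp (-((2 * π * (j + 1) - φ) * x)) - Real.exp (-((2 * π * (j + 1) +
        φ) * x)) :=
      sub_nonneg.2 (Real.exp_le_exp.2 (by nlinarith))
    rw [norm_mul, Real.norm_eq_abs, abs_of_nonneg hd, zero_mul, Real.cos_zero]
    exact mul_le_mul_of_nonneg_left (Real.abs_cos_le_one _) hd

lemma sinhRatio_mul_abs (φ T x : ℝ) : sinhRatio φ (T * |x|) = sinhRatio φ (T * x) := by
  rcases abs_choice x with h | h <;> rw [h]
  rw [mul_neg, sinhRatio_neg]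

lemma integral_sinhRatio_mul_cos_univ (h0 : 0 < φ) (h1 : φ < π) {T : ℝ} (hT : 0 < T) (ω : ℝ) :
    ∫ x, sinhRatio φ (T * x) * Real.cos (ω * x) =
      T⁻¹ * (Real.sin φ / (Real.cosh (ω / T) - Real.cos φ)) := by
  have h := integral_comp_abs (f := fun x => sinhRatio φ (T * x) * Real.cos (ω * x))
  have hc : ∀ x, Real.cos (ω * |x|) = Real.cos (ω * x) := fun x => by
    rcases abs_choice x with h | h <;> rw [h]
    rw [mul_neg, Real.cos_neg]
  simp only [sinhRatio_mul_abs, hc] at h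
  have h2 := MeasureTheory.integral_comp_mul_left_Ioi
    (fun x => sinhRatio φ x * Real.cos (ω / T * x)) 0 hT
  have e : ∀ x, ω / T * (T * x) = ω * x := fun x => by field_simp
  simp only [e, mul_zero, smul_eq_mul] at h2
  rw [h, h2, integral_sinhRatio_mul_cos h0 h1]
  ring

lemma integrable_sinhRatio (h0 : 0 < φ) (h1 : φ < π) {T : ℝ} (hT : 0 < T) :
    MeasureTheory.Integrable fun x => sinhRatio φ (T * x) := by
  apply MeasureTheory.Integrable.of_integral_ne_zero
  have h := integral_sinhRatio_mul_cos_univ h0 h1 hT 0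
  simp only [zero_mul, Real.cos_zero, mul_one, zero_div, Real.cosh_zero] at h
  rw [h]
  have := Real.sin_pos_of_pos_of_lt_pi h0 h1
  have : Real.cos φ < 1 := by
    rw [← Real.cos_zero]
    exact Real.cos_lt_cos_of_nonneg_of_le_pi le_rfl h1.le h0
  have : 0 < 1 - Real.cos φ := by linarith
  positivity

lemma fourier_sinhRatio (h0 : 0 < φ) (h1 : φ < π) {T : ℝ} (hT : 0 < T) (ν : ℝ) :
    FourierTransform.fourier (fun x : ℝ => (sinhRatio φ (T * x) : ℂ)) ν =
      ((T⁻¹ * (Real.sin φ / (Real.cosh (ν * (2 * π / T)) - Real.cos φ)) : ℝ) : ℂ) := by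
  have hI := integrable_sinhRatio h0 h1 hT
  have hC : MeasureTheory.Integrable fun x => sinhRatio φ (T * x) * Real.cos (2 * π * ν * x) :=
    hI.mul_bdd (c := 1) (by fun_prop) (.of_forall fun x => Real.abs_cos_le_one _)
  have hS : MeasureTheory.Integrable fun x => sinhRatio φ (T * x) * Real.sin (2 * π * ν * x) :=
    hI.mul_bdd (c := 1) (by fun_prop) (.of_forall fun x => Real.abs_sin_le_one _)
  have hS0 : ∫ x, sinhRatio φ (T * x) * Real.sin (2 * π * ν * x) = 0 := by
    have h := MeasureTheory.integral_neg_eq_self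
      (fun x => sinhRatio φ (T * x) * Real.sin (2 * π * ν * x)) MeasureTheory.volume
    simp only [mul_neg, sinhRatio_neg, Real.sin_neg, MeasureTheory.integral_neg] at h
    linarith
  have hpt : ∀ x : ℝ, Complex.exp ((-2 * π * x * ν : ℝ) * Complex.I) • (sinhRatio φ (T * x) : ℂ) =
      ((sinhRatio φ (T * x) * Real.cos (2 * π * ν * x) : ℝ) : ℂ) -
        ((sinhRatio φ (T * x) * Real.sin (2 * π * ν * x) : ℝ) : ℂ) * Complex.I := fun x => by
    rw [show -2 * π * x * ν = -(2 * π * ν * x) by ring, Complex.exp_ofReal_mul_I, smul_eq_mul,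
      Complex.ext_iff]
    simp [-Complex.ofReal_sin, -Complex.ofReal_cos]
    constructor <;> ring
  rw [Real.fourier_real_eq_integral_exp_smul]
  simp only [hpt]
  rw [MeasureTheory.integral_sub hC.ofReal (hS.ofReal.mul_const _),
    MeasureTheory.integral_mul_const, integral_complex_ofReal, integral_complex_ofReal, hS0,
    integral_sinhRatio_mul_cos_univ h0 h1 hT, show 2 * π * ν / T = ν * (2 * π / T) by ring]
  simp

theorem tsum_sin_div_cosh_sub (h0 : 0 < φ) (h1 : φ < π) {T : ℝ} (hT : 0 < T) :
    ∑' n : ℤ, 1 / (Real.cosh (n * (2 * π / T)) - Real.cos φ) =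
      T / Real.sin φ * ∑' n : ℤ, sinhRatio φ (T * n) := by
  have hsin := Real.sin_pos_of_pos_of_lt_pi h0 h1
  have hcos : Real.cos φ < 1 := by
    rw [← Real.cos_zero]
    exact Real.cos_lt_cos_of_nonneg_of_le_pi le_rfl h1.le h0
  have hs := summable_one_div_cosh_sub hcos (y := 2 * π / T) (by positivity)
  have hf : ∀ n : ℤ, FourierTransform.fourier (fun x : ℝ => (sinhRatio φ (T * x) : ℂ)) (n : ℝ) =
      ((T⁻¹ * Real.sin φ * (1 / (Real.cosh (n * (2 * π / T)) - Real.cos φ)) : ℝ) : ℂ) := fun n => by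
    rw [fourier_sinhRatio h0 h1 hT]; congr 1; ring
  have hO : Asymptotics.IsBigO (Filter.cocompact ℝ) (fun x : ℝ => (sinhRatio φ (T * x) : ℂ))
      fun x => |x| ^ (-2 : ℝ) := by
    have hlim := (tendsto_rpow_mul_exp_neg_mul_atTop_nhds_zero 2 (φ * T) (by positivity)).comp
      (tendsto_norm_cocompact_atTop (E := ℝ))
    refine Asymptotics.IsBigO.of_bound 1 ?_
    filter_upwards [hlim.eventually (gt_mem_nhds one_pos),
      (tendsto_norm_cocompact_atTop (E := ℝ)).eventually_gt_atTop 0] with x hx hx0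
    simp only [Function.comp, Real.norm_eq_abs] at hx hx0
    have hTx : 0 < T * |x| := mul_pos hT hx0
    have hn : 0 ≤ |x| ^ (-2 : ℝ) := Real.rpow_nonneg (abs_nonneg _) _
    rw [Complex.norm_real, ← sinhRatio_mul_abs, Real.norm_of_nonneg (sinhRatio_nonneg h1.le hTx),
      one_mul, Real.norm_of_nonneg hn, Real.rpow_neg (abs_nonneg _)]
    refine (sinhRatio_le h0.le hTx).trans ?_
    rw [← one_div, le_div_iff₀ (by positivity), mul_comm]
    refine le_trans (le_of_eq ?_) hx.le
    ring_nf
  have hp := Real.tsum_eq_tsum_fourier_of_rpow_decay_of_summable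
    (f := fun x : ℝ => (sinhRatio φ (T * x) : ℂ))
    (Complex.continuous_ofReal.comp ((continuous_sinhRatio φ).comp (by fun_prop)))
    one_lt_two hO (by
      simp only [hf]
      exact Complex.summable_ofReal.2 (hs.mul_left _)) 0
  simp only [hf, zero_add, QuotientAddGroup.mk_zero, fourier_eval_zero, mul_one] at hp
  rw [← Complex.ofReal_tsum, ← Complex.ofReal_tsum, Complex.ofReal_inj, tsum_mul_left] at hp
  rw [hp, ← mul_assoc, div_mul_eq_mul_div, mul_inv_cancel_left₀ hT.ne', div_self hsin.ne', one_mul]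

end Poisson

section SinhTail

variable {φ : ℝ}

/-- The sum of `sinhRatio φ` over the positive multiples of `T`. -/
def sinhTail (φ T : ℝ) : ℝ := ∑' n : ℕ, sinhRatio φ (T * (n + 1))

lemma hasSum_exp_neg_mul_succ {c : ℝ} (hc : 0 < c) :
    HasSum (fun n : ℕ => Real.exp (-(c * (n + 1)))) (Real.exp (-c) / (1 - Real.exp (-c))) := by
  refine ((hasSum_geometric_of_lt_one (Real.exp_pos (-c)).le
    (Real.exp_lt_one_iff.2 (by linarith))).mul_left (Real.exp (-c))).of_eq (fun n => ?_) rfl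
  rw [← Real.exp_nat_mul, ← Real.exp_add]
  ring_nf

lemma summable_sinhRatio (h0 : 0 < φ) (h1 : φ < π) {T : ℝ} (hT : 0 < T) :
    Summable fun n : ℕ => sinhRatio φ (T * (n + 1)) :=
  (hasSum_exp_neg_mul_succ (mul_pos h0 hT)).summable.of_nonneg_of_le
    (fun n => sinhRatio_nonneg h1.le (by positivity))
    (fun n => by rw [mul_assoc]; exact sinhRatio_le h0.le (by positivity))

lemma sinhTail_le (h0 : 0 < φ) (h1 : φ < π) {T : ℝ} (hT : 0 < T) :
    sinhTail φ T ≤ Real.exp (-(φ * T)) / (1 - Real.exp (-(φ * T))) := by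
  have h := hasSum_exp_neg_mul_succ (mul_pos h0 hT)
  rw [← h.tsum_eq]
  refine (summable_sinhRatio h0 h1 hT).tsum_le_tsum (fun n => ?_) h.summable
  rw [mul_assoc]; exact sinhRatio_le h0.le (by positivity)

lemma le_sinhTail (h0 : 0 < φ) (h1 : φ < π) {T : ℝ} (hT : 0 < T) :
    Real.exp (-(φ * T)) * (1 - Real.exp (-(2 * (π - φ) * T))) ≤ sinhTail φ T := by
  have h := (summable_sinhRatio h0 h1 hT).le_tsum 0
    fun n _ => sinhRatio_nonneg h1.le (by positivity)
  simp only [Nat.cast_zero, zero_add, mul_one] at h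
  exact (le_sinhRatio h1.le hT).trans h

lemma tsum_sinhRatio_int (h0 : 0 < φ) (h1 : φ < π) {T : ℝ} (hT : 0 < T) :
    ∑' n : ℤ, sinhRatio φ (T * n) = (π - φ) / π + 2 * sinhTail φ T := by
  have hs := (summable_sinhRatio h0 h1 hT).hasSum
  have h := HasSum.of_add_one_of_neg_add_one (f := fun n : ℤ => sinhRatio φ (T * n))
    (m := sinhTail φ T) (m' := sinhTail φ T) (by simpa [sinhTail] using hs)
    (hs.of_eq (fun n => by push_cast; rw [mul_neg, sinhRatio_neg]) rfl)
  rw [h.tsum_eq, Int.cast_zero, mul_zero, sinhRatio_zero]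
  ring

lemma tendsto_exp_mul_sinhTail (h0 : 0 < φ) (h1 : φ < π) :
    Filter.Tendsto (fun T => Real.exp (φ * T) * sinhTail φ T) Filter.atTop (nhds 1) := by
  have hexp : ∀ c : ℝ, 0 < c → Filter.Tendsto (fun T => 1 - Real.exp (-(c * T))) Filter.atTop
      (nhds 1) := fun c hc => by
    have := (Real.tendsto_exp_neg_atTop_nhds_zero.comp (Filter.tendsto_id.const_mul_atTop
        hc)).const_sub 1
    simpa using this
  refine tendsto_of_tendsto_of_tendsto_of_le_of_le' (hexp (2 * (π - φ)) (by linarith))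
    (by simpa using (hexp φ h0).inv₀ one_ne_zero) ?_ ?_
  all_goals
    filter_upwards [Filter.eventually_gt_atTop 0] with T hT
    have he : Real.exp (φ * T) * Real.exp (-(φ * T)) = 1 := by rw [← Real.exp_add]; simp
  · have := mul_le_mul_of_nonneg_left (le_sinhTail h0 h1 hT) (Real.exp_pos (φ * T)).le
    rwa [← mul_assoc, he, one_mul] at this
  · have := mul_le_mul_of_nonneg_left (sinhTail_le h0 h1 hT) (Real.exp_pos (φ * T)).le
    rwa [mul_div_assoc', he, one_div] at this

lemma tendsto_pi_mul_ellK_div_add_log :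
    Filter.Tendsto (fun ε => π * ellK (1 - ε) / ellK ε + Real.log ε) (nhdsWithin 0 (Ioi 0))
      (nhds (Real.log 16)) := by
  have hd : Filter.Tendsto (fun ε : ℝ => 1 / ellK ε - 2 / π) (nhdsWithin 0 (Ioi 0)) (nhds 0) := by
    refine squeeze_zero_norm' (a := fun ε => 2 * ε) ?_ ?_
    · filter_upwards [Ioo_mem_nhdsGT (show (0:ℝ) < 1 / 2 by norm_num)] with ε hε
      have h := abs_one_div_ellK_sub_le hε.1.le hε.2.le
      have h2 : ε / (2 * π) ≤ ε := div_le_self hε.1.le (by linarith [Real.pi_gt_three])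
      have h3 : 0 ≤ ε / (2 * π) := by have := hε.1; positivity
      rw [Real.norm_eq_abs]
      rw [abs_le] at h ⊢
      constructor <;> nlinarith [hε.1, hε.2]
    · have : Filter.Tendsto (fun ε : ℝ => 2 * ε) (nhds 0) (nhds (2 * 0)) := by
        apply Continuous.tendsto; fun_prop
      simpa using this.mono_left nhdsWithin_le_nhds
  have hl : Filter.Tendsto (fun ε : ℝ => Real.log ε * (1 / ellK ε - 2 / π)) (nhdsWithin 0 (Ioi 0))
      (nhds 0) := by
    refine squeeze_zero_norm' (a := fun ε => |2 * (Real.log ε * ε)|) ?_ ?_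
    · filter_upwards [Ioo_mem_nhdsGT (show (0:ℝ) < 1 / 2 by norm_num)] with ε hε
      have h := abs_one_div_ellK_sub_le hε.1.le hε.2.le
      have h2 : ε / (2 * π) ≤ ε := div_le_self hε.1.le (by linarith [Real.pi_gt_three])
      have h3 : 0 ≤ ε / (2 * π) := by have := hε.1; positivity
      have h4 : |1 / ellK ε - 2 / π| ≤ 2 * |ε| := by
        rw [abs_of_pos hε.1]
        rw [abs_le] at h ⊢
        constructor <;> nlinarith [hε.1, hε.2]
      rw [norm_mul, Real.norm_eq_abs, Real.norm_eq_abs, abs_mul, abs_mul, abs_two]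
      nlinarith [abs_nonneg (Real.log ε)]
    · simpa using ((tendsto_log_mul_rpow_nhdsGT_zero one_pos).const_mul 2).abs
  have h := (tendsto_ellK_add_log.const_mul 2).add
    (((tendsto_ellK_add_log.const_mul π).mul hd).sub (hl.const_mul (π / 2)))
  have e : 2 * (2 * Real.log 2) + (π * (2 * Real.log 2) * 0 - π / 2 * 0) = Real.log 16 := by
    rw [show (16:ℝ) = 2 ^ 4 by norm_num, Real.log_pow]; push_cast; ring
  rw [e] at h
  refine h.congr fun ε => ?_
  field_simp
  ring

lemma tendsto_one_sub_exp_neg {c : ℝ} (hc : 0 < c) :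
    Filter.Tendsto (fun s => 1 - Real.exp (-(c * s))) (nhdsWithin 0 (Ioi 0))
      (nhdsWithin 0 (Ioi 0)) := by
  rw [tendsto_nhdsWithin_iff]
  constructor
  · have : Filter.Tendsto (fun s => 1 - Real.exp (-(c * s))) (nhds 0) (nhds (1 - Real.exp (-(c *
        0)))) := by
      apply Continuous.tendsto; fun_prop
    simpa using this.mono_left nhdsWithin_le_nhds
  · filter_upwards [self_mem_nhdsWithin] with s hs
    have hs : 0 < s := hs
    have : Real.exp (-(c * s)) < 1 := Real.exp_lt_one_iff.2 (by nlinarith)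
    simpa using this

lemma tendsto_one_sub_exp_neg_div (c : ℝ) :
    Filter.Tendsto (fun s => (1 - Real.exp (-(c * s))) / s) (nhdsWithin 0 (Ioi 0)) (nhds c) := by
  have h : HasDerivAt (fun s => 1 - Real.exp (-(c * s))) c 0 := by
    have := (((hasDerivAt_id (0:ℝ)).const_mul c).neg.exp).const_sub 1
    refine this.congr_deriv ?_
    simp
  have h2 := h.tendsto_slope_zero_right
  refine h2.congr fun s => ?_
  simp [div_eq_inv_mul]

lemma tendsto_sinhTail_div_rpow {b : ℝ} (h0 : 0 < b) (h2 : b < 2) :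
    Filter.Tendsto (fun ε => sinhTail (π * b / 2) (2 * ellK (1 - ε) / ellK ε) / ε ^ b)
      (nhdsWithin 0 (Ioi 0)) (nhds (1 / 16 ^ b)) := by
  have hpi := Real.pi_pos
  have hT : Filter.Tendsto (fun ε => 2 * ellK (1 - ε) / ellK ε) (nhdsWithin 0 (Ioi 0))
      Filter.atTop := by
    have h : Filter.Tendsto (fun ε => -Real.log ε) (nhdsWithin 0 (Ioi 0)) Filter.atTop :=
      Filter.tendsto_neg_atBot_atTop.comp Real.tendsto_log_nhdsGT_zero
    refine ((tendsto_pi_mul_ellK_div_add_log.add_atTop h).const_mul_atTop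
      (show 0 < 2 / π by positivity)).congr fun ε => ?_
    field_simp
    ring
  have hA := (tendsto_exp_mul_sinhTail (φ := π * b / 2) (by positivity) (by nlinarith)).comp hT
  have hB := (Real.continuous_exp.tendsto _).comp (tendsto_pi_mul_ellK_div_add_log.const_mul (-b))
  have hC := hA.mul hB
  have e : 1 * Real.exp (-b * Real.log 16) = 1 / 16 ^ b := by
    rw [Real.rpow_def_of_pos (by norm_num), one_div, ← Real.exp_neg]; ring_nf
  rw [e] at hC
  refine hC.congr' ?_
  filter_upwards [self_mem_nhdsWithin] with ε hε
  have hε : 0 < ε := hε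
  simp only [Function.comp]
  have h1 : Real.exp (π * b / 2 * (2 * ellK (1 - ε) / ellK ε)) *
      Real.exp (-b * (π * ellK (1 - ε) / ellK ε + Real.log ε)) * ε ^ b = 1 := by
    rw [Real.rpow_def_of_pos hε, ← Real.exp_add, ← Real.exp_add, Real.exp_eq_one_iff]
    ring
  rw [eq_div_iff (Real.rpow_pos_of_pos hε b).ne']
  linear_combination sinhTail (π * b / 2) (2 * ellK (1 - ε) / ellK ε) * h1

end SinhTail

section ExcursionGF

/-- The generating function of the normalized excursion sums `excNorm b`. -/
def excGF (b x : ℝ) : ℝ := ∑' l : ℕ, excNorm b (l + 1) * x ^ (l + 1)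

lemma hasSum_excGF {b x : ℝ} (hb0 : 0 ≤ b) (hb2 : b < 2) (h0 : 0 < x) (h1 : x < 1) :
    HasSum (fun l : ℕ => excNorm b (l + 1) * x ^ (l + 1)) (excGF b x) := by
  have hb : Real.cos (π * b / 4) ≠ 0 :=
    (Real.cos_pos_of_mem_Ioo ⟨by nlinarith [Real.pi_pos], by nlinarith [Real.pi_pos]⟩).ne'
  have h := hasSum_excNorm b hb (Real.sqrt_nonneg x) ((Real.sqrt_lt' one_pos).2 (by simpa using h1))
  rw [Real.sq_sqrt h0.le] at h
  exact h.summable.hasSum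

lemma cos_mul_excGF_eq {b x : ℝ} (hb0 : 0 ≤ b) (hb2 : b < 2) (h0 : 0 < x) (h1 : x < 1) :
    Real.cos (π * b / 2) * excGF b x =
      1 - bdryFun (Real.cos (π * b / 2)) (halfWt b) (√x) (π / 2) := by
  have hb : Real.cos (π * b / 4) ≠ 0 :=
    (Real.cos_pos_of_mem_Ioo ⟨by nlinarith [Real.pi_pos], by nlinarith [Real.pi_pos]⟩).ne'
  have hk := (Real.sqrt_lt' one_pos).2 (show x < 1 ^ 2 by simpa using h1)
  have h := hasSum_excNorm b hb (Real.sqrt_nonneg x) hk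
  rw [Real.sq_sqrt h0.le] at h
  rw [(isHalfPlane_halfWt b hb).bdryFun_half_pi (Real.abs_cos_le_one _) (Real.sqrt_nonneg x) hk,
    excGF, h.tsum_eq]
  ring

lemma excGF_zero {x : ℝ} (h0 : 0 < x) (h1 : x < 1) : excGF 0 x = 1 - π / (2 * ellK x) := by
  have h := cos_mul_excGF_eq le_rfl two_pos h0 h1
  have hh := isHalfPlane_halfWt 0 (by simp)
  simp only [mul_zero, zero_div, Real.cos_zero, one_mul] at h hh
  rw [h, hh.bdryFun_half_pi_of_eq_one (Real.sqrt_pos.2 h0) ((Real.sqrt_lt' one_pos).2 (by simpa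
      using h1)),
    Real.sq_sqrt h0.le]

lemma cos_mul_excGF {b x : ℝ} (hb0 : 0 < b) (hb2 : b < 2) (h0 : 0 < x) (h1 : x < 1) :
    Real.cos (π * b / 2) * excGF b x = 1 - (1 - Real.cos (π * b / 2)) * π / Real.sin (π * b / 2) *
      (1 / ellK (1 - x)) * ((π - π * b / 2) / π +
        2 * sinhTail (π * b / 2) (2 * ellK x / ellK (1 - x))) := by
  have hpi := Real.pi_pos
  have hb : Real.cos (π * b / 4) ≠ 0 :=
    (Real.cos_pos_of_mem_Ioo ⟨by nlinarith, by nlinarith⟩).ne'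
  have p0 : 0 < π * b / 2 := by positivity
  have p1 : π * b / 2 < π := by nlinarith
  have hcos : Real.cos (π * b / 2) < 1 := by
    rw [← Real.cos_zero]
    exact Real.cos_lt_cos_of_nonneg_of_le_pi le_rfl p1.le p0
  have hsin := Real.sin_pos_of_pos_of_lt_pi p0 p1
  have hK := ellK_pos h0.le h1
  have hK' := ellK_pos (m := 1 - x) (by linarith) (by linarith)
  have h := ((isHalfPlane_halfWt b hb).hasSum_bdryFun_half_pi (Real.abs_cos_le_one _) hcos
    (Real.sqrt_pos.2 h0) ((Real.sqrt_lt' one_pos).2 (by simpa using h1))).tsum_eq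
  rw [Real.sq_sqrt h0.le, tsum_mul_left] at h
  have hT : 0 < 2 * ellK x / ellK (1 - x) := by positivity
  have h2 := tsum_sin_div_cosh_sub p0 p1 hT
  have e : 2 * π / (2 * ellK x / ellK (1 - x)) = π * ellK (1 - x) / ellK x := by
    field_simp
  rw [e, tsum_sinhRatio_int p0 p1 hT] at h2
  rw [cos_mul_excGF_eq hb0.le hb2 h0 h1, ← h, h2]
  field_simp

end ExcursionGF

section SecondDifferences

lemma abs_one_div_ellK_one_sub_exp_le {u : ℝ} (h0 : 0 < u) (h1 : u ≤ 1 / 2) :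
    |1 / ellK (1 - Real.exp (-u)) - 2 / π + u / (2 * π)| ≤ 2 * u ^ 2 := by
  have hpi := Real.pi_gt_three
  have e1 : 1 - Real.exp (-u) ≤ u := by linarith [Real.add_one_le_exp (-u)]
  have e0 : 0 ≤ 1 - Real.exp (-u) := by linarith [Real.exp_le_one_iff.2 (show -u ≤ 0 by linarith)]
  have h := abs_one_div_ellK_sub_le e0 (by linarith)
  have h2 := Real.abs_exp_sub_one_sub_id_le (x := -u) (by rw [abs_neg, abs_of_pos h0]; linarith)
  have h3 : |(Real.exp (-u) - 1 - -u) / (2 * π)| ≤ u ^ 2 := by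
    rw [abs_div, abs_of_pos (show 0 < 2 * π by positivity)]
    refine (div_le_self (abs_nonneg _) (by linarith)).trans (h2.trans (by rw [neg_sq]))
  have h4 : (1 - Real.exp (-u)) ^ 2 ≤ u ^ 2 := by gcongr
  calc _ = |(1 / ellK (1 - Real.exp (-u)) - (2 / π - (1 - Real.exp (-u)) / (2 * π))) +
        (Real.exp (-u) - 1 - -u) / (2 * π)| := by congr 1; ring
    _ ≤ _ := (abs_add_le _ _).trans (by linarith)

lemma tendsto_one_div_ellK_remainder {b c : ℝ} (hb : b < 2) (hc : 0 < c) :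
    Filter.Tendsto (fun s => (1 / ellK (1 - Real.exp (-(c * s))) - 2 / π + c * s / (2 * π)) / s ^ b)
      (nhdsWithin 0 (Ioi 0)) (nhds 0) := by
  refine squeeze_zero_norm' (a := fun s => 2 * c ^ 2 * s ^ (2 - b)) ?_ ?_
  · filter_upwards [Ioo_mem_nhdsGT (show 0 < 1 / (2 * c) by positivity)] with s hs
    have hs0 : 0 < s := hs.1
    have h := abs_one_div_ellK_one_sub_exp_le (u := c * s) (by positivity) (by
      have := (lt_div_iff₀ (by positivity)).1 hs.2
      linarith)
    rw [norm_div, Real.norm_eq_abs, Real.norm_of_nonneg (by positivity),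
        div_le_iff₀ (by positivity),
      mul_assoc, ← Real.rpow_add hs0, sub_add_cancel, Real.rpow_two]
    linarith [mul_pow c s 2]
  · have h : Filter.Tendsto (fun s : ℝ => 2 * c ^ 2 * s ^ (2 - b)) (nhds 0)
        (nhds (2 * c ^ 2 * 0 ^ (2 - b))) :=
      ((Real.continuousAt_rpow_const 0 (2 - b) (Or.inr (by linarith))).tendsto).const_mul _
    rw [Real.zero_rpow (by linarith), mul_zero] at h
    exact h.mono_left nhdsWithin_le_nhds

lemma tendsto_one_div_ellK : Filter.Tendsto (fun ε => 1 / ellK ε) (nhdsWithin 0 (Ioi 0))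
    (nhds (2 / π)) := by
  have h : Filter.Tendsto (fun ε : ℝ => 2 / π - ε / (2 * π)) (nhds 0) (nhds (2 / π - 0 / (2 * π)))
      := by
    apply Continuous.tendsto; fun_prop
  rw [zero_div, sub_zero] at h
  have h2 : Filter.Tendsto (fun ε => 1 / ellK ε - (2 / π - ε / (2 * π))) (nhdsWithin 0 (Ioi 0))
      (nhds 0) := by
    refine squeeze_zero_norm' (a := fun ε => ε ^ 2) ?_ ?_
    · filter_upwards [Ioo_mem_nhdsGT (show (0:ℝ) < 1 / 2 by norm_num)] with ε hε
      exact abs_one_div_ellK_sub_le hε.1.le hε.2.le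
    · have : Filter.Tendsto (fun ε : ℝ => ε ^ 2) (nhds 0) (nhds (0 ^ 2)) := by
        apply Continuous.tendsto; fun_prop
      simpa using this.mono_left nhdsWithin_le_nhds
  simpa using h2.add (h.mono_left nhdsWithin_le_nhds)

lemma tendsto_sinhTail_div_ellK {b c : ℝ} (h0 : 0 < b) (h2 : b < 2) (hc : 0 < c) :
    Filter.Tendsto (fun s => sinhTail (π * b / 2)
        (2 * ellK (Real.exp (-(c * s))) / ellK (1 - Real.exp (-(c * s)))) *
        (1 / ellK (1 - Real.exp (-(c * s)))) / s ^ b)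
      (nhdsWithin 0 (Ioi 0)) (nhds (2 / π / 16 ^ b * c ^ b)) := by
  have hε := tendsto_one_sub_exp_neg hc
  have hd : Filter.Tendsto (fun s => ((1 - Real.exp (-(c * s))) / s) ^ b) (nhdsWithin 0 (Ioi 0))
      (nhds (c ^ b)) := (tendsto_one_sub_exp_neg_div c).rpow_const (Or.inl hc.ne')
  have h := (((tendsto_sinhTail_div_rpow h0 h2).mul tendsto_one_div_ellK).comp hε).mul hd
  rw [show 1 / (16:ℝ) ^ b * (2 / π) * c ^ b = 2 / π / 16 ^ b * c ^ b by ring] at h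
  refine h.congr' ?_
  filter_upwards [self_mem_nhdsWithin] with s hs
  have hs : 0 < s := hs
  have hx : 0 < 1 - Real.exp (-(c * s)) := by
    linarith [Real.exp_lt_one_iff.2 (show -(c * s) < 0 by nlinarith)]
  have hxb := Real.rpow_pos_of_pos hx b
  have hsb := Real.rpow_pos_of_pos hs b
  simp only [Function.comp, sub_sub_cancel]
  rw [Real.div_rpow hx.le hs.le]
  field_simp

/-- The second difference of `c ↦ f (e^{-cs})` at `c = j`. -/
def expDiff (f : ℝ → ℝ) (j : ℕ) (s : ℝ) : ℝ :=
  f (Real.exp (-(j * s))) - 2 * f (Real.exp (-((j + 1 : ℝ) * s))) + f (Real.exp (-((j +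
      2 : ℝ) * s)))

theorem tendsto_expDiff_excGF {b : ℝ} (h0 : 0 < b) (h2 : b < 2)
    (hβ : Real.cos (π * b / 2) ≠ 0) {j : ℕ} (hj : 1 ≤ j) :
    Filter.Tendsto (fun s => expDiff (excGF b) j s / s ^ b) (nhdsWithin 0 (Ioi 0))
      (nhds (-(4 * (1 - Real.cos (π * b / 2))) /
          (Real.cos (π * b / 2) * Real.sin (π * b / 2) * 16 ^ b) *
        ((j : ℝ) ^ b - 2 * (j + 1 : ℝ) ^ b + (j + 2 : ℝ) ^ b))) := by
  have hpi := Real.pi_pos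
  have hsin := Real.sin_pos_of_pos_of_lt_pi (x := π * b / 2) (by positivity) (by nlinarith)
  have hj0 : (0:ℝ) < j := by exact_mod_cast hj
  have hr := fun c hc => tendsto_one_div_ellK_remainder (c := c) h2 hc
  have ht := fun c hc => tendsto_sinhTail_div_ellK (c := c) h0 h2 hc
  set β := Real.cos (π * b / 2) with hβdef
  set A := (1 - β) * (π - π * b / 2) / Real.sin (π * b / 2)
  set B := 2 * (1 - β) * π / Real.sin (π * b / 2)
  have H := ((((hr j hj0).sub ((hr (j + 1) (by positivity)).const_mul 2)).add
    (hr (j + 2) (by positivity))).const_mul (-A / β)).add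
    ((((ht j hj0).sub ((ht (j + 1) (by positivity)).const_mul 2)).add
    (ht (j + 2) (by positivity))).const_mul (-B / β))
  have e : -A / β * (0 - 2 * 0 + 0) + -B / β * (2 / π / 16 ^ b * (j : ℝ) ^ b -
      2 * (2 / π / 16 ^ b * (j + 1 : ℝ) ^ b) + 2 / π / 16 ^ b * (j + 2 : ℝ) ^ b) =
      -(4 * (1 - β)) / (β * Real.sin (π * b / 2) * 16 ^ b) *
        ((j : ℝ) ^ b - 2 * (j + 1 : ℝ) ^ b + (j + 2 : ℝ) ^ b) := by
    simp only [B]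
    field_simp
    ring
  rw [e] at H
  refine H.congr' ?_
  filter_upwards [self_mem_nhdsWithin] with s hs
  have hs : 0 < s := hs
  have hsb := Real.rpow_pos_of_pos hs b
  have hF : ∀ c : ℝ, 0 < c → excGF b (Real.exp (-(c * s))) = 1 / β - A / β *
      (1 / ellK (1 - Real.exp (-(c * s)))) - B / β * (sinhTail (π * b / 2)
        (2 * ellK (Real.exp (-(c * s))) / ellK (1 - Real.exp (-(c * s)))) *
        (1 / ellK (1 - Real.exp (-(c * s))))) := by
    intro c hc
    have h := cos_mul_excGF h0 h2 (Real.exp_pos (-(c * s)))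
      (Real.exp_lt_one_iff.2 (show -(c * s) < 0 by nlinarith))
    rw [← hβdef] at h
    rw [eq_div_of_mul_eq hβ ((mul_comm _ _).trans h)]
    simp only [A, B]
    field_simp
    ring
  rw [expDiff, hF j hj0, hF (j + 1) (by positivity), hF (j + 2) (by positivity)]
  field_simp
  ring

lemma tendsto_ellK_exp_neg_add_log {c : ℝ} (hc : 0 < c) :
    Filter.Tendsto (fun s => ellK (Real.exp (-(c * s))) + Real.log s / 2) (nhdsWithin 0 (Ioi 0))
      (nhds (2 * Real.log 2 - Real.log c / 2)) := by
  have h := (tendsto_ellK_add_log.comp (tendsto_one_sub_exp_neg hc)).sub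
    (((tendsto_one_sub_exp_neg_div c).log hc.ne').div_const 2)
  refine h.congr' ?_
  filter_upwards [self_mem_nhdsWithin] with s hs
  have hs : 0 < s := hs
  have hx : 0 < 1 - Real.exp (-(c * s)) := by
    linarith [Real.exp_lt_one_iff.2 (show -(c * s) < 0 by nlinarith)]
  simp only [Function.comp, sub_sub_cancel]
  rw [Real.log_div hx.ne' hs.ne']
  ring

lemma tendsto_log_div_ellK_exp_neg {c : ℝ} (hc : 0 < c) :
    Filter.Tendsto (fun s => Real.log s / ellK (Real.exp (-(c * s)))) (nhdsWithin 0 (Ioi 0))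
      (nhds (-2)) := by
  have h := (((tendsto_ellK_exp_neg_add_log hc).div_atBot Real.tendsto_log_nhdsGT_zero).sub_const
    (1 / 2)).inv₀ (by norm_num)
  rw [show ((0:ℝ) - 1 / 2)⁻¹ = -2 by norm_num] at h
  refine h.congr' ?_
  filter_upwards [Ioo_mem_nhdsGT (zero_lt_one' ℝ)] with s hs
  have hl := (Real.log_neg hs.1 hs.2).ne
  rw [← inv_div]
  field_simp
  ring

lemma tendsto_log_sq_mul_ellK_exp_neg_sub {c d : ℝ} (hc : 0 < c) (hd : 0 < d) :
    Filter.Tendsto (fun s => Real.log s ^ 2 *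
        (1 / ellK (Real.exp (-(c * s))) - 1 / ellK (Real.exp (-(d * s))))) (nhdsWithin 0 (Ioi 0))
      (nhds (2 * (Real.log c - Real.log d))) := by
  have h := (((tendsto_ellK_exp_neg_add_log hd).sub (tendsto_ellK_exp_neg_add_log hc)).mul
    (tendsto_log_div_ellK_exp_neg hc)).mul (tendsto_log_div_ellK_exp_neg hd)
  rw [show (2 * Real.log 2 - Real.log d / 2 - (2 * Real.log 2 - Real.log c / 2)) * -2 * -2 =
    2 * (Real.log c - Real.log d) by ring] at h
  refine h.congr' ?_
  filter_upwards [self_mem_nhdsWithin] with s hs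
  have hK : ∀ c : ℝ, 0 < c → 0 < ellK (Real.exp (-(c * s))) := fun c hc =>
    ellK_pos (Real.exp_pos _).le (Real.exp_lt_one_iff.2 (by
      have : 0 < c * s := mul_pos hc hs
      linarith))
  have h1 := hK c hc
  have h2 := hK d hd
  generalize ellK (Real.exp (-(c * s))) = u at h1 ⊢
  generalize ellK (Real.exp (-(d * s))) = v at h2 ⊢
  field_simp
  ring

theorem tendsto_expDiff_excGF_zero {j : ℕ} (hj : 1 ≤ j) :
    Filter.Tendsto (fun s => expDiff (excGF 0) j s / (π / Real.log s ^ 2)) (nhdsWithin 0 (Ioi 0))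
      (nhds (-(Real.log j - 2 * Real.log (j + 1 : ℝ) + Real.log (j + 2 : ℝ)))) := by
  have hpi := Real.pi_pos
  have hj0 : (0:ℝ) < j := by exact_mod_cast hj
  have h := ((tendsto_log_sq_mul_ellK_exp_neg_sub hj0 (d := (j + 1 : ℝ)) (by positivity)).sub
    (tendsto_log_sq_mul_ellK_exp_neg_sub (c := (j + 1 : ℝ)) (d := (j + 2 : ℝ)) (by positivity)
      (by positivity))).const_mul (-1 / 2)
  rw [show -1 / 2 * (2 * (Real.log j - Real.log (j + 1 : ℝ)) -
    2 * (Real.log (j + 1 : ℝ) - Real.log (j + 2 : ℝ))) =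
    -(Real.log j - 2 * Real.log (j + 1 : ℝ) + Real.log (j + 2 : ℝ)) by ring] at h
  refine h.congr' ?_
  filter_upwards [Ioo_mem_nhdsGT (zero_lt_one' ℝ)] with s hs
  have hl := (Real.log_neg hs.1 hs.2).ne
  have hF : ∀ c : ℝ, 0 < c → excGF 0 (Real.exp (-(c * s))) =
      1 - π / 2 * (1 / ellK (Real.exp (-(c * s)))) := fun c hc => by
    rw [excGF_zero (Real.exp_pos _) (Real.exp_lt_one_iff.2 (by
      have : 0 < c * s := mul_pos hc hs.1
      linarith))]
    ring
  rw [expDiff, hF j hj0, hF (j + 1) (by positivity), hF (j + 2) (by positivity)]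
  field_simp
  ring

end SecondDifferences

section LaplaceDifferences

variable {w : ℝ → ℝ} {a : ℝ}

lemma one_sub_exp_neg_div_mem {s : ℝ} (hs : 0 < s) : (1 - Real.exp (-s)) / s ∈ Icc (0:ℝ) 1 := by
  have h1 := Real.add_one_le_exp (-s)
  have h2 := Real.exp_le_one_iff.2 (show -s ≤ 0 by linarith)
  exact ⟨div_nonneg (by linarith) hs.le, div_le_one_of_le₀ (by linarith) hs.le⟩

lemma integrableOn_laplace_diff (hw : Measurable w)
    (hi : MeasureTheory.IntegrableOn (fun s => w s * Real.exp (-(a * s))) (Ioi 0)) :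
    MeasureTheory.IntegrableOn (fun s => w s * ((1 - Real.exp (-s)) / s) * Real.exp (-(a * s)))
      (Ioi 0) := by
  refine hi.norm.mono' (Measurable.aestronglyMeasurable (by fun_prop)) ?_
  refine (MeasureTheory.ae_restrict_mem measurableSet_Ioi).mono fun s hs => ?_
  obtain ⟨h0, h1⟩ := one_sub_exp_neg_div_mem hs
  rw [mul_right_comm, norm_mul, Real.norm_of_nonneg h0]
  exact mul_le_of_le_one_right (norm_nonneg _) h1

lemma integral_laplace_interval (hw : Measurable w)
    (hi : MeasureTheory.IntegrableOn (fun s => w s * Real.exp (-(a * s))) (Ioi 0)) :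
    ∫ u in a..a + 1, ∫ s in Ioi (0:ℝ), w s * Real.exp (-(u * s)) =
      ∫ s in Ioi (0:ℝ), w s * ((1 - Real.exp (-s)) / s) * Real.exp (-(a * s)) := by
  rw [MeasureTheory.intervalIntegral_integral_swap]
  · refine MeasureTheory.setIntegral_congr_fun measurableSet_Ioi fun s hs => ?_
    have hs : s ≠ 0 := ne_of_gt hs
    have h2 : ∫ u in a..a + 1, Real.exp (-(u * s)) = (Real.exp (-(a * s)) -
        Real.exp (-((a + 1) * s))) / s := by
      have hd : ∀ u ∈ uIcc a (a + 1), HasDerivAt (fun u => -Real.exp (-(u * s)) / s)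
          (Real.exp (-(u * s))) u := fun u _ => by
        refine (((((hasDerivAt_id u).mul_const s).neg).exp).neg.div_const s).congr_deriv ?_
        simp; field_simp
      rw [intervalIntegral.integral_eq_sub_of_hasDerivAt hd
        (Continuous.intervalIntegrable (by fun_prop) _ _)]
      ring
    rw [intervalIntegral.integral_const_mul, h2, add_mul, neg_add, Real.exp_add, one_mul]
    field_simp
  · rw [uIoc_of_le (by linarith)]
    have h1 : MeasureTheory.Integrable (fun _ : ℝ => (1:ℝ))
        (MeasureTheory.volume.restrict (Ioc a (a + 1))) :=
      MeasureTheory.integrable_const _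
    refine (h1.mul_prod hi.norm).mono' (Measurable.aestronglyMeasurable ?_) ?_
    · unfold Function.uncurry; fun_prop
    · rw [MeasureTheory.Measure.prod_restrict]
      refine (MeasureTheory.ae_restrict_mem (measurableSet_Ioc.prod measurableSet_Ioi)).mono
        fun z hz => ?_
      obtain ⟨⟨hz1, hz2⟩, hz3⟩ := hz
      have hz3 : 0 < z.2 := hz3
      simp only [Function.uncurry, one_mul, norm_mul, Real.norm_eq_abs, Real.abs_exp]
      gcongr

/-- The Laplace transform at `j` of `s ↦ s ^ (-1 - b) * (1 - e^{-s}) ^ 2`. -/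
def diffMoment (b : ℝ) (j : ℕ) : ℝ :=
  ∫ s in Ioi (0:ℝ), s ^ (-1 - b) * (1 - Real.exp (-s)) ^ 2 * Real.exp (-(j * s))

lemma integrableOn_rpow_mul_exp {b : ℝ} (hb : b < 2) (ha : 0 < a) :
    MeasureTheory.IntegrableOn (fun s => s ^ (1 - b) * Real.exp (-(a * s))) (Ioi 0) := by
  have h := integrableOn_rpow_mul_exp_neg_mul_rpow (p := 1) (s := 1 - b) (b := a) (by linarith)
    one_pos ha
  simpa using h

lemma diffKernel_eq (b : ℝ) {s : ℝ} (hs : 0 < s) :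
    s ^ (1 - b) * ((1 - Real.exp (-s)) / s) * ((1 - Real.exp (-s)) / s) =
      s ^ (-1 - b) * (1 - Real.exp (-s)) ^ 2 := by
  rw [show 1 - b = (-1 - b) + 2 by ring, Real.rpow_add hs, Real.rpow_two]
  field_simp

lemma integrableOn_diffKernel {b : ℝ} (hb : b < 2) (ha : 0 < a) : MeasureTheory.IntegrableOn
    (fun s => s ^ (-1 - b) * (1 - Real.exp (-s)) ^ 2 * Real.exp (-(a * s))) (Ioi 0) := by
  refine (integrableOn_laplace_diff (by fun_prop) (integrableOn_laplace_diff (by fun_prop)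
    (integrableOn_rpow_mul_exp hb ha))).congr_fun (fun s hs => ?_) measurableSet_Ioi
  simp only
  rw [diffKernel_eq b hs]

/-- A second antiderivative of `Γ(2 - b) u ^ (b - 2)` determines `diffMoment b`. -/
lemma diffMoment_eq {b : ℝ} (hb : b < 2) {f g : ℝ → ℝ}
    (hf : ∀ u, 0 < u → HasDerivAt f (g u) u)
    (hg : ∀ u, 0 < u → HasDerivAt g (u ^ (b - 2) * Real.Gamma (2 - b)) u) {j : ℕ} (hj : 1 ≤ j) :
    diffMoment b j = f j - 2 * f (j + 1) + f (j + 2) := by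
  have hj0 : (0:ℝ) < j := by exact_mod_cast hj
  have hm : Measurable fun s : ℝ => s ^ (1 - b) := by fun_prop
  have hgc : ContinuousOn g (Ioi 0) := fun u hu => (hg u hu).continuousAt.continuousWithinAt
  have h0 : ∀ u : ℝ, 0 < u → ∫ s in Ioi (0:ℝ), s ^ (1 - b) * Real.exp (-(u * s)) =
      u ^ (b - 2) * Real.Gamma (2 - b) := fun u hu => by
    have h := Real.integral_rpow_mul_exp_neg_mul_Ioi (a := 2 - b) (by linarith) hu
    rw [show 2 - b - 1 = 1 - b by ring] at h
    rw [h, one_div, Real.inv_rpow hu.le, ← Real.rpow_neg hu.le, neg_sub]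
  have h1 : ∀ u : ℝ, 0 < u → ∫ s in Ioi (0:ℝ), s ^ (1 - b) * ((1 - Real.exp (-s)) / s) *
      Real.exp (-(u * s)) = g (u + 1) - g u := fun u hu => by
    rw [← integral_laplace_interval hm (integrableOn_rpow_mul_exp hb hu),
      ← intervalIntegral.integral_eq_sub_of_hasDerivAt (f' := fun u =>
        u ^ (b - 2) * Real.Gamma (2 - b))]
    · refine intervalIntegral.integral_congr fun v hv => ?_
      rw [uIcc_of_le (by linarith)] at hv
      exact h0 v (hu.trans_le hv.1)
    · intro v hv
      rw [uIcc_of_le (by linarith)] at hv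
      exact hg v (hu.trans_le hv.1)
    · refine ContinuousOn.intervalIntegrable fun v hv => ?_
      rw [uIcc_of_le (by linarith)] at hv
      exact ((Real.continuousAt_rpow_const _ _ (Or.inl (hu.trans_le hv.1).ne')).mul_const
          _).continuousWithinAt
  have h2 := integral_laplace_interval (w := fun s => s ^ (1 - b) * ((1 - Real.exp (-s)) / s))
    (by fun_prop) (integrableOn_laplace_diff hm (integrableOn_rpow_mul_exp hb hj0))
  have h3 : diffMoment b j = ∫ s in Ioi (0:ℝ), s ^ (1 - b) * ((1 - Real.exp (-s)) / s) *
      ((1 - Real.exp (-s)) / s) * Real.exp (-(j * s)) :=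
    MeasureTheory.setIntegral_congr_fun measurableSet_Ioi fun s hs => by
      rw [diffKernel_eq b hs]
  have h4 : ∫ u in (j:ℝ)..j + 1, (g (u + 1) - g u) = (f (j + 1 + 1) - f (j + 1)) - (f (j +
      1) - f j) := by
    refine intervalIntegral.integral_eq_sub_of_hasDerivAt (f := fun u => f (u + 1) - f u) ?_ ?_
    · intro v hv
      rw [uIcc_of_le (by linarith)] at hv
      have hv0 : 0 < v := hj0.trans_le hv.1
      exact ((hf (v + 1) (by linarith)).comp_add_const v 1).sub (hf v hv0)
    · refine ContinuousOn.intervalIntegrable fun v hv => ?_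
      rw [uIcc_of_le (by linarith)] at hv
      have hv0 : 0 < v := hj0.trans_le hv.1
      exact (((hg (v + 1) (by linarith)).comp_add_const v 1).continuousAt.sub
        (hg v hv0).continuousAt).continuousWithinAt
  rw [h3, ← h2, intervalIntegral.integral_congr (g := fun u => g (u + 1) - g u), h4]
  · ring_nf
  · intro v hv
    rw [uIcc_of_le (by linarith)] at hv
    exact h1 v (hj0.trans_le hv.1)

lemma diffMoment_rpow {b : ℝ} (h0 : 0 < b) (h1 : b ≠ 1) (h2 : b < 2) {j : ℕ} (hj : 1 ≤ j) :
    diffMoment b j = Real.Gamma (-b) * ((j : ℝ) ^ b - 2 * (j + 1 : ℝ) ^ b + (j + 2 : ℝ) ^ b) := by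
  have e1 : Real.Gamma (1 - b) = -b * Real.Gamma (-b) := by
    rw [← Real.Gamma_add_one (by linarith)]; ring_nf
  have e2 : Real.Gamma (2 - b) = (1 - b) * Real.Gamma (1 - b) := by
    rw [← Real.Gamma_add_one (sub_ne_zero.2 h1.symm)]; ring_nf
  rw [diffMoment_eq h2 (f := fun u => Real.Gamma (-b) * u ^ b)
    (g := fun u => Real.Gamma (-b) * (b * u ^ (b - 1))) _ _ hj]
  · ring
  · intro u hu
    exact (Real.hasDerivAt_rpow_const (Or.inl hu.ne')).const_mul _
  · intro u hu
    refine (((Real.hasDerivAt_rpow_const (p := b - 1) (Or.inl hu.ne')).const_mul b).const_mul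
      (Real.Gamma (-b))).congr_deriv ?_
    rw [e2, e1, show b - 1 - 1 = b - 2 by ring]
    ring

lemma diffMoment_zero {j : ℕ} (hj : 1 ≤ j) :
    diffMoment 0 j = -(Real.log j - 2 * Real.log (j + 1 : ℝ) + Real.log (j + 2 : ℝ)) := by
  rw [diffMoment_eq two_pos (f := fun u => -Real.log u) (g := fun u => -u⁻¹) _ _ hj]
  · ring
  · intro u hu
    exact (Real.hasDerivAt_log hu.ne').neg
  · intro u hu
    refine (hasDerivAt_inv hu.ne').neg.congr_deriv ?_
    rw [zero_sub, Real.rpow_neg hu.le, Real.rpow_two, sub_zero, Real.Gamma_two]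
    ring

lemma diffMoment_neg_one {j : ℕ} (hj : 1 ≤ j) :
    diffMoment (-1) j = 1 / (j : ℝ) - 2 * (1 / (j + 1 : ℝ)) + 1 / (j + 2 : ℝ) := by
  rw [diffMoment_eq (by norm_num) (f := fun u => 1 / u) (g := fun u => -(u ^ 2)⁻¹) _ _ hj]
  · intro u hu
    simpa using hasDerivAt_inv hu.ne'
  · intro u hu
    have h3 : Real.Gamma (2 - -1) = 2 := by
      have := Real.Gamma_nat_eq_factorial 2
      norm_num at this ⊢
    refine ((hasDerivAt_pow 2 u).inv (by positivity)).neg.congr_deriv ?_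
    rw [h3, show (-1 - 2 : ℝ) = -(3 : ℕ) by norm_num, Real.rpow_neg hu.le, Real.rpow_natCast]
    simp
    field_simp

end LaplaceDifferences

section Tauberian

/-- `a` has generating function `F` whose second differences along `x = e^{-js}` behave, relative
to the gauge `κ`, like those of a measure with density `C s ^ (-1 - b)`. -/
structure HasDiffAsymp (a : ℕ → ℝ) (F κ : ℝ → ℝ) (b C : ℝ) : Prop where
  nonneg : ∀ l, 0 ≤ a (l + 1)
  hasSum : ∀ x, 0 < x → x < 1 → HasSum (fun l => a (l + 1) * x ^ (l + 1)) (F x)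
  pos : ∀ s, 0 < s → s < 1 → 0 < κ s
  lt_two : b < 2
  const_nonneg : 0 ≤ C
  tendsto : ∀ j : ℕ, 1 ≤ j → Filter.Tendsto (fun s => expDiff F j s / κ s)
    (nhdsWithin 0 (Ioi 0)) (nhds (C * diffMoment b j))

/-- The weights `a_{l+1} (1 - z) ^ 2 z` with `z = e^{-s(l+1)}`. -/
def diffWeight (a : ℕ → ℝ) (s : ℝ) (l : ℕ) : ℝ :=
  a (l + 1) * ((1 - Real.exp (-(s * (l + 1)))) ^ 2 * Real.exp (-(s * (l + 1))))

/-- The limiting density of the weights. -/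
def diffDensity (b s : ℝ) : ℝ := s ^ (-1 - b) * (1 - Real.exp (-s)) ^ 2 * Real.exp (-s)

/-- The weighted sum of a test function of `e^{-s(l+1)}`. -/
def diffSum (a : ℕ → ℝ) (f : ℝ → ℝ) (s : ℝ) : ℝ :=
  ∑' l : ℕ, diffWeight a s l * f (Real.exp (-(s * (l + 1))))

/-- The limiting integral of a test function of `e^{-s}`. -/
def diffIntegral (b : ℝ) (f : ℝ → ℝ) : ℝ :=
  ∫ s in Ioi (0:ℝ), diffDensity b s * f (Real.exp (-s))

lemma diffDensity_nonneg (b : ℝ) {s : ℝ} (hs : 0 < s) : 0 ≤ diffDensity b s := by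
  unfold diffDensity; positivity

lemma exp_neg_mem_Icc {s : ℝ} (hs : 0 ≤ s) : Real.exp (-s) ∈ Icc (0:ℝ) 1 :=
  ⟨(Real.exp_pos _).le, Real.exp_le_one_iff.2 (by linarith)⟩

lemma exists_bound_Icc {f : ℝ → ℝ} (hf : Continuous f) :
    ∃ M, ∀ z ∈ Icc (0:ℝ) 1, |f z| ≤ M :=
  isCompact_Icc.exists_bound_of_continuousOn hf.continuousOn

variable {b : ℝ} {f g : ℝ → ℝ}

lemma integrableOn_diffDensity (hb : b < 2) : MeasureTheory.IntegrableOn (diffDensity b) (Ioi 0) :=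
    by
  have h := integrableOn_diffKernel hb one_pos
  simp only [one_mul] at h
  exact h

lemma integrableOn_diffDensity_mul (hb : b < 2) (hf : Continuous f) :
    MeasureTheory.IntegrableOn (fun s => diffDensity b s * f (Real.exp (-s))) (Ioi 0) := by
  obtain ⟨M, hM⟩ := exists_bound_Icc hf
  refine ((integrableOn_diffDensity hb).norm.mul_const M).mono' ?_ ?_
  · have : Measurable f := hf.measurable
    unfold diffDensity
    exact Measurable.aestronglyMeasurable (by fun_prop)
  · refine (MeasureTheory.ae_restrict_mem measurableSet_Ioi).mono fun s hs => ?_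
    rw [norm_mul]
    exact mul_le_mul_of_nonneg_left (hM _ (exp_neg_mem_Icc (le_of_lt hs))) (norm_nonneg _)

lemma diffIntegral_add (hb : b < 2) (hf : Continuous f) (hg : Continuous g) :
    diffIntegral b (fun z => f z + g z) = diffIntegral b f + diffIntegral b g := by
  unfold diffIntegral
  rw [← MeasureTheory.integral_add (integrableOn_diffDensity_mul hb hf)
    (integrableOn_diffDensity_mul hb hg)]
  simp only [mul_add]

lemma abs_diffIntegral_sub_le (hb : b < 2) (hf : Continuous f) (hg : Continuous g) {ε : ℝ}
    (h : ∀ z ∈ Icc (0:ℝ) 1, |f z - g z| ≤ ε) :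
    |diffIntegral b f - diffIntegral b g| ≤ ε * diffIntegral b fun _ => 1 := by
  unfold diffIntegral
  rw [← MeasureTheory.integral_sub (integrableOn_diffDensity_mul hb hf)
    (integrableOn_diffDensity_mul hb hg), ← MeasureTheory.integral_const_mul]
  rw [← Real.norm_eq_abs]
  refine MeasureTheory.norm_integral_le_of_norm_le
    ((integrableOn_diffDensity_mul hb continuous_const).const_mul ε) ?_
  refine (MeasureTheory.ae_restrict_mem measurableSet_Ioi).mono fun s hs => ?_
  rw [← mul_sub, norm_mul, Real.norm_of_nonneg (diffDensity_nonneg b hs), mul_one, mul_comm]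
  exact mul_le_mul_of_nonneg_right (h _ (exp_neg_mem_Icc (le_of_lt hs))) (diffDensity_nonneg b hs)

namespace HasDiffAsymp

variable {a : ℕ → ℝ} {F κ : ℝ → ℝ} {C : ℝ}

lemma diffWeight_nonneg (H : HasDiffAsymp a F κ b C) (s : ℝ) (l : ℕ) : 0 ≤ diffWeight a s l := by
  have := H.nonneg l
  unfold diffWeight; positivity

lemma hasSum_pow (H : HasDiffAsymp a F κ b C) {s : ℝ} (hs : 0 < s) (n : ℕ) :
    HasSum (fun l => diffWeight a s l * Real.exp (-(s * (l + 1))) ^ n) (expDiff F (n + 1) s) := by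
  have h : ∀ c : ℝ, 0 < c → HasSum (fun l : ℕ => a (l + 1) * Real.exp (-(c * s)) ^ (l + 1))
      (F (Real.exp (-(c * s)))) := fun c hc =>
    H.hasSum _ (Real.exp_pos _) (Real.exp_lt_one_iff.2 (by nlinarith [mul_pos hc hs]))
  have h1 := h (n + 1 : ℕ) (by positivity)
  have h2 := h ((n + 1 : ℕ) + 1) (by positivity)
  have h3 := h ((n + 1 : ℕ) + 2) (by positivity)
  refine ((h1.sub (h2.mul_left 2)).add h3).of_eq (fun l => ?_) rfl
  have e : ∀ k : ℕ, Real.exp (-(k * s)) ^ (l + 1) = Real.exp (-(s * (l + 1))) ^ k := fun k => by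
    rw [← Real.exp_nat_mul, ← Real.exp_nat_mul]
    push_cast; ring_nf
  have e1 := e (n + 1)
  have e2 := e (n + 2)
  have e3 := e (n + 3)
  rw [e1, show (((n + 1 : ℕ) : ℝ) + 1) = ((n + 2 : ℕ) : ℝ) by push_cast; ring, e2,
    show (((n + 1 : ℕ) : ℝ) + 2) = ((n + 3 : ℕ) : ℝ) by push_cast; ring, e3]
  unfold diffWeight
  ring

lemma summable_diffWeight (H : HasDiffAsymp a F κ b C) {s : ℝ} (hs : 0 < s) :
    Summable (diffWeight a s) := by
  simpa using (H.hasSum_pow hs 0).summable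

lemma summable (H : HasDiffAsymp a F κ b C) (hf : Continuous f) {s : ℝ} (hs : 0 < s) :
    Summable (fun l : ℕ => diffWeight a s l * f (Real.exp (-(s * (l + 1))))) := by
  obtain ⟨M, hM⟩ := exists_bound_Icc hf
  refine Summable.of_norm_bounded ((H.summable_diffWeight hs).mul_right M) fun l => ?_
  rw [norm_mul, Real.norm_of_nonneg (H.diffWeight_nonneg s l)]
  exact mul_le_mul_of_nonneg_left (hM _ (exp_neg_mem_Icc (by positivity))) (H.diffWeight_nonneg s l)

lemma abs_diffSum_sub_le (H : HasDiffAsymp a F κ b C) (hf : Continuous f) (hg : Continuous g)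
    {ε s : ℝ} (hs : 0 < s) (h : ∀ z ∈ Icc (0:ℝ) 1, |f z - g z| ≤ ε) :
    |diffSum a f s - diffSum a g s| ≤ ε * diffSum a (fun _ => 1) s := by
  unfold diffSum
  rw [← (H.summable hf hs).tsum_sub (H.summable hg hs), ← tsum_mul_left, ← Real.norm_eq_abs]
  refine tsum_of_norm_bounded ((H.summable continuous_const hs).mul_left ε).hasSum fun l => ?_
  rw [← mul_sub, norm_mul, Real.norm_of_nonneg (H.diffWeight_nonneg s l), mul_one, mul_comm]
  exact mul_le_mul_of_nonneg_right (h _ (exp_neg_mem_Icc (by positivity))) (H.diffWeight_nonneg s l)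

lemma tendsto_pow (H : HasDiffAsymp a F κ b C) (n : ℕ) :
    Filter.Tendsto (fun s => diffSum a (fun z => z ^ n) s / κ s) (nhdsWithin 0 (Ioi 0))
      (nhds (C * diffIntegral b fun z => z ^ n)) := by
  have e : diffIntegral b (fun z => z ^ n) = diffMoment b (n + 1) := by
    unfold diffIntegral diffMoment diffDensity
    congr 1; ext s
    have h : Real.exp (-s) * Real.exp (-s) ^ n = Real.exp (-((n + 1 : ℕ) * s)) := by
      rw [← Real.exp_nat_mul, ← Real.exp_add]
      push_cast; ring_nf
    rw [← h, ← mul_assoc]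
  rw [e]
  refine (H.tendsto (n + 1) (by omega)).congr' ?_
  filter_upwards [self_mem_nhdsWithin] with s hs
  rw [diffSum, (H.hasSum_pow hs n).tsum_eq]

lemma tendsto_polynomial (H : HasDiffAsymp a F κ b C) (p : Polynomial ℝ) :
    Filter.Tendsto (fun s => diffSum a (fun z => p.eval z) s / κ s) (nhdsWithin 0 (Ioi 0))
      (nhds (C * diffIntegral b fun z => p.eval z)) := by
  induction p using Polynomial.induction_on' with
  | add p q hp hq =>
    simp only [Polynomial.eval_add]
    rw [diffIntegral_add H.lt_two p.continuous q.continuous, mul_add]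
    refine (hp.add hq).congr' ?_
    filter_upwards [self_mem_nhdsWithin] with s hs
    unfold diffSum
    rw [← add_div, ← (H.summable p.continuous hs).tsum_add (H.summable q.continuous hs)]
    simp only [mul_add]
  | monomial n c =>
    simp only [Polynomial.eval_monomial]
    have e : diffIntegral b (fun z => c * z ^ n) = c * diffIntegral b fun z => z ^ n := by
      unfold diffIntegral
      rw [← MeasureTheory.integral_const_mul]
      simp only [mul_left_comm]
    rw [e, mul_left_comm]
    refine ((H.tendsto_pow n).const_mul c).congr fun s => ?_
    unfold diffSum
    rw [← mul_div_assoc, ← tsum_mul_left]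
    simp only [mul_left_comm]

lemma tendsto_diffSum (H : HasDiffAsymp a F κ b C) (hf : Continuous f) :
    Filter.Tendsto (fun s => diffSum a f s / κ s) (nhdsWithin 0 (Ioi 0))
      (nhds (C * diffIntegral b f)) := by
  have h1 := H.tendsto_pow 0
  simp only [pow_zero] at h1
  set M := |C * diffIntegral b fun _ => 1| + 1 with hM
  have hM0 : 0 < M := by positivity
  have h1e : ∀ᶠ s in nhdsWithin (0:ℝ) (Ioi 0), diffSum a (fun _ => 1) s / κ s < M :=
    h1.eventually_lt_const (lt_of_le_of_lt (le_abs_self _) (lt_add_one _))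
  have hκ : ∀ᶠ s in nhdsWithin (0:ℝ) (Ioi 0), 0 < s ∧ 0 < κ s := by
    filter_upwards [self_mem_nhdsWithin, nhdsWithin_le_nhds (Iio_mem_nhds one_pos)] with s h0 h1
    exact ⟨h0, H.pos s h0 h1⟩
  rw [Metric.tendsto_nhds]
  intro ε hε
  obtain ⟨p, hp⟩ := exists_polynomial_near_of_continuousOn 0 1 f hf.continuousOn (ε / (3 * M))
    (by positivity)
  have hp' : ∀ z ∈ Icc (0:ℝ) 1, |p.eval z - f z| ≤ ε / (3 * M) := fun z hz => (hp z hz).le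
  have h2 : |C * diffIntegral b (fun z => p.eval z) - C * diffIntegral b f| ≤ ε / 3 := by
    rw [← mul_sub, abs_mul]
    have h := abs_diffIntegral_sub_le H.lt_two p.continuous hf hp'
    have hi : C * diffIntegral b (fun _ => 1) ≤ M := (le_abs_self _).trans (by linarith)
    calc |C| * _ ≤ C * (ε / (3 * M) * diffIntegral b fun _ => 1) := by
          rw [abs_of_nonneg H.const_nonneg]
          exact mul_le_mul_of_nonneg_left h H.const_nonneg
      _ = ε / (3 * M) * (C * diffIntegral b fun _ => 1) := by ring
      _ ≤ ε / (3 * M) * M := by gcongr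
      _ = ε / 3 := by field_simp
  filter_upwards [h1e, hκ, Metric.tendsto_nhds.1 (H.tendsto_polynomial p) (ε / 3) (by positivity)]
    with s hs1 hs2 hs3
  obtain ⟨hs, hk⟩ := hs2
  have h4 : |diffSum a (fun z => p.eval z) s / κ s - diffSum a f s / κ s| ≤ ε / 3 := by
    rw [← sub_div, abs_div, abs_of_pos hk]
    have h := H.abs_diffSum_sub_le p.continuous hf hs hp'
    calc _ ≤ (ε / (3 * M) * diffSum a (fun _ => 1) s) / κ s := by gcongr
      _ = ε / (3 * M) * (diffSum a (fun _ => 1) s / κ s) := by ring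
      _ ≤ ε / (3 * M) * M := by gcongr
      _ = ε / 3 := by field_simp
  rw [Real.dist_eq] at hs3 ⊢
  rw [abs_lt] at hs3 ⊢
  rw [abs_le] at h2 h4
  constructor <;> linarith [h2.1, h2.2, h4.1, h4.2, hs3.1, hs3.2]

end HasDiffAsymp
variable {a : ℕ → ℝ} {F κ : ℝ → ℝ} {C : ℝ}

lemma tendsto_mul_exp_div_one_sub_exp {c : ℝ} (hc : 0 < c) :
    Filter.Tendsto (fun s => s * (Real.exp (-(c * s)) / (1 - Real.exp (-(c * s)))))
      (nhdsWithin 0 (Ioi 0)) (nhds (1 / c)) := by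
  have hd : HasDerivAt (fun s => 1 - Real.exp (-(c * s))) c 0 := by
    refine ((((hasDerivAt_id (0:ℝ)).const_mul c).neg.exp).const_sub 1).congr_deriv ?_
    simp
  have h1 := (hasDerivAt_iff_tendsto_slope.1 hd).mono_left
    (nhdsWithin_mono 0 fun s (hs : 0 < s) => hs.ne')
  have h2 : Filter.Tendsto (fun s => Real.exp (-(c * s))) (nhdsWithin 0 (Ioi 0)) (nhds 1) := by
    have : Continuous fun s => Real.exp (-(c * s)) := by fun_prop
    simpa using (this.tendsto 0).mono_left nhdsWithin_le_nhds
  refine (h2.div h1 hc.ne').congr' ?_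
  filter_upwards [self_mem_nhdsWithin] with s hs
  have hs : 0 < s := hs
  have : 1 - Real.exp (-(c * s)) ≠ 0 := by
    have := Real.exp_lt_one_iff.2 (show -(c * s) < 0 by nlinarith [mul_pos hc hs])
    linarith
  simp [slope_def_field]
  field_simp

/-- The constant sequence is the reference point of the comparison. -/
lemma hasDiffAsymp_one :
    HasDiffAsymp (fun _ => 1) (fun x => x / (1 - x)) (fun s => 1 / s) (-1) 1 where
  nonneg _ := zero_le_one
  hasSum x h0 h1 := by
    refine ((hasSum_geometric_of_lt_one h0.le h1).mul_left x).of_eq (fun l => ?_) rfl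
    ring
  pos s h _ := by positivity
  lt_two := by norm_num
  const_nonneg := zero_le_one
  tendsto j hj := by
    have hj0 : (0:ℝ) < j := by exact_mod_cast hj
    rw [diffMoment_neg_one hj, one_mul]
    refine (((tendsto_mul_exp_div_one_sub_exp hj0).sub
      ((tendsto_mul_exp_div_one_sub_exp (c := j + 1) (by linarith)).const_mul 2)).add
      (tendsto_mul_exp_div_one_sub_exp (c := j + 2) (by linarith))).congr fun s => ?_
    unfold expDiff
    rw [div_div_eq_mul_div, div_one]
    ring

/-- A continuous bump in the variable `z = e^{-s}`, positive exactly for `s ∈ (p, q)`. -/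
def expBump (p q z : ℝ) : ℝ := max 0 ((Real.exp (-p) - z) * (z - Real.exp (-q)))

lemma continuous_expBump (p q : ℝ) : Continuous (expBump p q) := by
  unfold expBump; fun_prop

lemma expBump_nonneg (p q z : ℝ) : 0 ≤ expBump p q z := le_max_left _ _

lemma expBump_eq_zero {p q s : ℝ} (hpq : p < q) (h : s ∉ Ioo p q) : expBump p q (Real.exp (-s)) =
    0 := by
  refine max_eq_left ?_
  rw [mem_Ioo, not_and_or, not_lt, not_lt] at h
  have hpq' : Real.exp (-q) < Real.exp (-p) := Real.exp_lt_exp.2 (by linarith)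
  rcases h with h | h
  · have h1 : Real.exp (-p) ≤ Real.exp (-s) := Real.exp_le_exp.2 (by linarith)
    exact mul_nonpos_of_nonpos_of_nonneg (by linarith) (by linarith)
  · have h1 : Real.exp (-s) ≤ Real.exp (-q) := Real.exp_le_exp.2 (by linarith)
    exact mul_nonpos_of_nonneg_of_nonpos (by linarith) (by linarith)

lemma expBump_pos {p q s : ℝ} (h : s ∈ Ioo p q) : 0 < expBump p q (Real.exp (-s)) := by
  refine lt_max_of_lt_right (mul_pos ?_ ?_) <;> rw [sub_pos, Real.exp_lt_exp]
  · linarith [h.1]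
  · linarith [h.2]

lemma diffDensity_eq_mul (b s : ℝ) :
    diffDensity b s = s ^ (-1 - b) * diffDensity (-1) s := by
  unfold diffDensity
  norm_num
  ring

lemma diffIntegral_expBump_pos {p q : ℝ} (hp : 0 < p) (hpq : p < q) :
    0 < diffIntegral (-1) (expBump p q) := by
  unfold diffIntegral
  rw [MeasureTheory.setIntegral_pos_iff_support_of_nonneg_ae]
  · refine lt_of_lt_of_le ?_ (MeasureTheory.measure_mono (s := Ioo p q) fun s hs => ?_)
    · simp [hpq]
    · have hs0 : 0 < s := hp.trans hs.1
      refine ⟨mul_ne_zero ?_ (expBump_pos hs).ne', hs0⟩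
      have h1 : Real.exp (-s) < 1 := Real.exp_lt_one_iff.2 (by linarith)
      have h2 : (1 - Real.exp (-s)) ≠ 0 := by linarith
      unfold diffDensity
      have := Real.rpow_pos_of_pos hs0 (-1 - -1)
      positivity
  · refine (MeasureTheory.ae_restrict_mem measurableSet_Ioi).mono fun s hs => ?_
    exact mul_nonneg (diffDensity_nonneg _ hs) (expBump_nonneg _ _ _)
  · exact integrableOn_diffDensity_mul (by norm_num) (continuous_expBump p q)

lemma diffIntegral_expBump_bounds {p q : ℝ} (hb : -1 ≤ b) (hb2 : b < 2) (hp : 0 < p) (hpq : p < q) :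
    q ^ (-1 - b) * diffIntegral (-1) (expBump p q) ≤ diffIntegral b (expBump p q) ∧
      diffIntegral b (expBump p q) ≤ p ^ (-1 - b) * diffIntegral (-1) (expBump p q) := by
  have hi := integrableOn_diffDensity_mul hb2 (continuous_expBump p q)
  have hi1 := integrableOn_diffDensity_mul (b := -1) (by norm_num) (continuous_expBump p q)
  unfold diffIntegral
  rw [← MeasureTheory.integral_const_mul, ← MeasureTheory.integral_const_mul]
  have key : ∀ s ∈ Ioi (0:ℝ), q ^ (-1 - b) * (diffDensity (-1) s * expBump p q (Real.exp (-s))) ≤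
      diffDensity b s * expBump p q (Real.exp (-s)) ∧ diffDensity b s * expBump p q (Real.exp (-s))
      ≤ p ^ (-1 - b) * (diffDensity (-1) s * expBump p q (Real.exp (-s))) := fun s hs => by
    have hs : 0 < s := hs
    have hn := mul_nonneg (diffDensity_nonneg (-1) hs) (expBump_nonneg p q (Real.exp (-s)))
    by_cases h : s ∈ Ioo p q
    · rw [diffDensity_eq_mul b s, mul_assoc (s ^ (-1 - b))]
      exact ⟨mul_le_mul_of_nonneg_right
          (Real.rpow_le_rpow_of_nonpos hs h.2.le (by linarith)) hn,
        mul_le_mul_of_nonneg_right (Real.rpow_le_rpow_of_nonpos hp h.1.le (by linarith)) hn⟩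
    · simp [expBump_eq_zero hpq h]
  exact ⟨MeasureTheory.setIntegral_mono_on (hi1.const_mul _) hi measurableSet_Ioi
      fun s hs => (key s hs).1,
    MeasureTheory.setIntegral_mono_on hi (hi1.const_mul _) measurableSet_Ioi
      fun s hs => (key s hs).2⟩

lemma tendsto_one_div_nat_nhdsGT : Filter.Tendsto (fun n : ℕ => 1 / (n : ℝ)) Filter.atTop
    (nhdsWithin 0 (Ioi 0)) := by
  refine tendsto_nhdsWithin_iff.2 ⟨tendsto_one_div_atTop_nhds_zero_nat, ?_⟩
  filter_upwards [Filter.eventually_gt_atTop 0] with n hn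
  have : (0:ℝ) < n := by exact_mod_cast hn
  exact one_div_pos.2 this

namespace HasDiffAsymp

/-- The ratio of the smoothed sums of `a` and of the constant sequence. -/
lemma tendsto_ratio (H : HasDiffAsymp a F κ b C) {p q : ℝ} (hp : 0 < p) (hpq : p < q) :
    Filter.Tendsto (fun n : ℕ => n * diffSum a (expBump p q) (1 / n) /
      (diffSum (fun _ => 1) (expBump p q) (1 / n) * κ (1 / n))) Filter.atTop
      (nhds (C * diffIntegral b (expBump p q) / diffIntegral (-1) (expBump p q))) := by
  have h1 := (H.tendsto_diffSum (continuous_expBump p q)).comp tendsto_one_div_nat_nhdsGT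
  have h2 := (hasDiffAsymp_one.tendsto_diffSum (continuous_expBump p q)).comp
      tendsto_one_div_nat_nhdsGT
  rw [one_mul] at h2
  refine (h1.div h2 (diffIntegral_expBump_pos hp hpq).ne').congr' ?_
  filter_upwards [Filter.eventually_gt_atTop 0] with n hn
  have : (n:ℝ) ≠ 0 := by exact_mod_cast hn.ne'
  simp only [Function.comp, Pi.div_apply]
  field_simp

lemma eventually_diffSum_one_pos {p q : ℝ} (hp : 0 < p) (hpq : p < q) :
    ∀ᶠ n : ℕ in Filter.atTop, 0 < diffSum (fun _ => 1) (expBump p q) (1 / n) := by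
  have h2 := (hasDiffAsymp_one.tendsto_diffSum (continuous_expBump p q)).comp
      tendsto_one_div_nat_nhdsGT
  rw [one_mul] at h2
  filter_upwards [h2.eventually_const_lt (diffIntegral_expBump_pos hp hpq),
    Filter.eventually_gt_atTop 0] with n hn hn0
  have h0 : (0:ℝ) < n := by exact_mod_cast hn0
  simp only [Function.comp] at hn
  exact (div_pos_iff_of_pos_right (by positivity)).1 hn

lemma eventually_gauge_pos (H : HasDiffAsymp a F κ b C) :
    ∀ᶠ n : ℕ in Filter.atTop, 0 < κ (1 / n) := by
  filter_upwards [Filter.eventually_gt_atTop 1] with n hn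
  have h0 : (1:ℝ) < n := by exact_mod_cast hn
  exact H.pos _ (by positivity) ((div_lt_one (by linarith)).2 h0)

lemma diffSum_one_compare (H : HasDiffAsymp a F κ b C) {p q : ℝ} (hpq : p < q)
    {n : ℕ} (hn : 0 < n) (c : ℝ) :
    ((∀ l : ℕ, p * n < l + 1 → (l + 1 : ℝ) < q * n → a (l + 1) ≤ c) →
      diffSum a (expBump p q) (1 / n) ≤ c * diffSum (fun _ => 1) (expBump p q) (1 / n)) ∧
    ((∀ l : ℕ, p * n < l + 1 → (l + 1 : ℝ) < q * n → c ≤ a (l + 1)) →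
      c * diffSum (fun _ => 1) (expBump p q) (1 / n) ≤ diffSum a (expBump p q) (1 / n)) := by
  have hn0 : (0:ℝ) < n := by exact_mod_cast hn
  have hs : (0:ℝ) < 1 / n := by positivity
  have hc := continuous_expBump p q
  have hz : ∀ l : ℕ, ¬ (p * n < l + 1 ∧ (l + 1 : ℝ) < q * n) →
      expBump p q (Real.exp (-(1 / n * (l + 1)))) = 0 := fun l hl => by
    refine expBump_eq_zero hpq fun h => hl ?_
    have e : (1 / n * (l + 1) : ℝ) = (l + 1) / n := by ring
    rw [e] at h
    exact ⟨(lt_div_iff₀ hn0).1 h.1, (div_lt_iff₀ hn0).1 h.2⟩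
  have hw : ∀ l : ℕ, 0 ≤ (1 - Real.exp (-(1 / n * (l + 1)))) ^ 2 *
      Real.exp (-(1 / n * (l + 1))) * expBump p q (Real.exp (-(1 / n * (l + 1)))) := fun l =>
    mul_nonneg (by positivity) (expBump_nonneg _ _ _)
  unfold diffSum
  rw [← tsum_mul_left]
  constructor
  · intro h
    refine (H.summable hc hs).tsum_le_tsum (fun l => ?_)
      ((hasDiffAsymp_one.summable hc hs).mul_left c)
    by_cases hl : p * n < l + 1 ∧ (l + 1 : ℝ) < q * n
    · have := mul_le_mul_of_nonneg_right (h l hl.1 hl.2) (hw l)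
      unfold diffWeight
      calc _ = _ := by ring
        _ ≤ _ := this
        _ = _ := by ring
    · rw [hz l hl]; simp
  · intro h
    refine ((hasDiffAsymp_one.summable hc hs).mul_left c).tsum_le_tsum (fun l => ?_)
      (H.summable hc hs)
    by_cases hl : p * n < l + 1 ∧ (l + 1 : ℝ) < q * n
    · have := mul_le_mul_of_nonneg_right (h l hl.1 hl.2) (hw l)
      unfold diffWeight
      calc _ = _ := by ring
        _ ≤ _ := this
        _ = _ := by ring
    · rw [hz l hl]; simp

/-- The Tauberian theorem: a monotone sequence inherits the density of its second differences. -/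
theorem tendsto_of_antitone (H : HasDiffAsymp a F κ b C) (hb : -1 ≤ b)
    (ha : ∀ l m : ℕ, 1 ≤ l → l ≤ m → a m ≤ a l) :
    Filter.Tendsto (fun n : ℕ => n * a n / κ (1 / n)) Filter.atTop (nhds C) := by
  have hcont : Filter.Tendsto (fun p : ℝ => C * p ^ (-1 - b)) (nhds 1) (nhds C) := by
    have h := (Real.continuousAt_rpow_const 1 (-1 - b) (Or.inl one_ne_zero)).tendsto.const_mul C
    simpa using h
  refine tendsto_order.2 ⟨fun x hx => ?_, fun x hx => ?_⟩
  · obtain ⟨q, hq1, hq⟩ := ((hcont.mono_left (nhdsWithin_le_nhds (s := Ioi 1))).eventually_const_lt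
      hx).and self_mem_nhdsWithin |>.exists
    have hq : 1 < q := hq
    have hJ := diffIntegral_expBump_pos one_pos hq
    have hlt : x < C * diffIntegral b (expBump 1 q) / diffIntegral (-1) (expBump 1 q) := by
      refine hq1.trans_le ?_
      rw [le_div_iff₀ hJ, mul_assoc]
      exact mul_le_mul_of_nonneg_left
        (diffIntegral_expBump_bounds hb H.lt_two one_pos hq).1 H.const_nonneg
    filter_upwards [(H.tendsto_ratio one_pos hq).eventually_const_lt hlt,
      eventually_diffSum_one_pos one_pos hq, H.eventually_gauge_pos,
      Filter.eventually_gt_atTop 0] with n h1 h2 h3 h4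
    refine h1.trans_le ?_
    have h5 := (H.diffSum_one_compare hq h4 (a n)).1 fun l hl _ => ha n (l + 1) h4 (by
      rw [one_mul] at hl
      exact_mod_cast hl.le)
    rw [div_le_div_iff₀ (by positivity) h3]
    calc _ ≤ n * (a n * diffSum (fun _ => 1) (expBump 1 q) (1 / n)) * κ (1 / n) := by gcongr
      _ = _ := by ring
  · obtain ⟨p, ⟨hp1, hp⟩, hp0⟩ := (((hcont.mono_left
      (nhdsWithin_le_nhds (s := Iio 1))).eventually_lt_const hx).and self_mem_nhdsWithin).and
      (nhdsWithin_le_nhds (Ioi_mem_nhds one_pos)) |>.exists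
    have hp : p < 1 := hp
    have hp0 : 0 < p := hp0
    have hJ := diffIntegral_expBump_pos hp0 hp
    have hlt : C * diffIntegral b (expBump p 1) / diffIntegral (-1) (expBump p 1) < x := by
      refine lt_of_le_of_lt ?_ hp1
      rw [div_le_iff₀ hJ, mul_assoc]
      exact mul_le_mul_of_nonneg_left
        (diffIntegral_expBump_bounds hb H.lt_two hp0 hp).2 H.const_nonneg
    filter_upwards [(H.tendsto_ratio hp0 hp).eventually_lt_const hlt,
      eventually_diffSum_one_pos hp0 hp, H.eventually_gauge_pos,
      Filter.eventually_gt_atTop 0] with n h1 h2 h3 h4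
    refine lt_of_le_of_lt ?_ h1
    have h5 := (H.diffSum_one_compare hp h4 (a n)).2 fun l _ hl => ha (l + 1) n (by omega) (by
      rw [one_mul] at hl
      exact_mod_cast hl.le)
    rw [div_le_div_iff₀ h3 (by positivity)]
    calc _ = n * (a n * diffSum (fun _ => 1) (expBump p 1) (1 / n)) * κ (1 / n) := by ring
      _ ≤ _ := by gcongr

end HasDiffAsymp
end Tauberian

section Assembly

lemma excNorm_antitone {b : ℝ} (l m : ℕ) (hl : 1 ≤ l) (hm : l ≤ m) : excNorm b m ≤ excNorm b l := by
  induction m, hm using Nat.le_induction with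
  | base => exact le_rfl
  | succ m hm ih => exact (excNorm_succ_le _ (hl.trans hm)).trans ih

lemma tendsto_excNorm_zero : Filter.Tendsto
    (fun n : ℕ => n * excNorm 0 n / (π / Real.log (1 / (n:ℝ)) ^ 2)) Filter.atTop (nhds 1) := by
  have H : HasDiffAsymp (excNorm 0) (excGF 0) (fun s => π / Real.log s ^ 2) 0 1 :=
    { nonneg := fun l => excNorm_nonneg _ (by omega)
      hasSum := fun x h0 h1 => hasSum_excGF le_rfl two_pos h0 h1
      pos := fun s h0 h1 => by
        have := Real.log_neg h0 h1
        exact div_pos Real.pi_pos (sq_pos_of_neg this)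
      lt_two := two_pos
      const_nonneg := zero_le_one
      tendsto := fun j hj => by
        rw [diffMoment_zero hj, one_mul]
        exact tendsto_expDiff_excGF_zero hj }
  exact H.tendsto_of_antitone (by norm_num) excNorm_antitone

/-- Euler's reflection formula in the form relating the two descriptions of the constant. -/
lemma exc_const_eq {b : ℝ} (h0 : 0 < b) (h2 : b < 2) (hβ : Real.cos (π * b / 2) ≠ 0) :
    -(4 * (1 - Real.cos (π * b / 2))) / (Real.cos (π * b / 2) * Real.sin (π * b / 2) * 16 ^ b) =
      Real.sin (π * b / 4) ^ 2 * (Real.Gamma (1 + b) / π) * 16 ^ (1 - b) * Real.Gamma (-b) := by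
  have hs : 0 < Real.sin (π * b / 2) :=
    Real.sin_pos_of_pos_of_lt_pi (by positivity) (by nlinarith [Real.pi_pos])
  have e1 : Real.Gamma (1 - b) = -b * Real.Gamma (-b) := by
    rw [← Real.Gamma_add_one (by linarith)]; ring_nf
  have e2 : Real.Gamma (1 + b) = b * Real.Gamma b := by
    rw [← Real.Gamma_add_one h0.ne']; ring_nf
  have e3 := Real.Gamma_mul_Gamma_one_sub b
  have e4 : Real.sin (π * b) = 2 * Real.sin (π * b / 2) * Real.cos (π * b / 2) := by
    rw [← Real.sin_two_mul]; ring_nf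
  have e5 : Real.sin (π * b / 4) ^ 2 = (1 - Real.cos (π * b / 2)) / 2 := by
    rw [Real.sin_sq_eq_half_sub]; ring_nf
  have e6 : Real.Gamma (1 + b) * Real.Gamma (-b) =
      -(π / (2 * Real.sin (π * b / 2) * Real.cos (π * b / 2))) := by
    rw [← e4, ← e3, e1, e2]; ring
  have e7 : (16:ℝ) ^ (1 - b) = 16 / 16 ^ b := by
    rw [Real.rpow_sub (by norm_num), Real.rpow_one]
  have h16 : (0:ℝ) < 16 ^ b := by positivity
  calc _ = (1 - Real.cos (π * b / 2)) / 2 * (-(π / (2 * Real.sin (π * b / 2) *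
        Real.cos (π * b / 2)))) / π * (16 / 16 ^ b) := by
        have := hs.ne'
        have := Real.pi_ne_zero
        field_simp
        ring
    _ = _ := by rw [← e5, ← e6, e7]; ring

lemma tendsto_excNorm {b : ℝ} (h0 : 0 < b) (h1 : b ≠ 1) (h2 : b < 2)
    (hβ : Real.cos (π * b / 2) ≠ 0) : Filter.Tendsto
    (fun n : ℕ => n * excNorm b n / (1 / (n:ℝ)) ^ b) Filter.atTop
    (nhds (Real.sin (π * b / 4) ^ 2 * (Real.Gamma (1 + b) / π) * 16 ^ (1 - b))) := by
  have H : HasDiffAsymp (excNorm b) (excGF b) (fun s => s ^ b) b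
      (Real.sin (π * b / 4) ^ 2 * (Real.Gamma (1 + b) / π) * 16 ^ (1 - b)) :=
    { nonneg := fun l => excNorm_nonneg _ (by omega)
      hasSum := fun x hx0 hx1 => hasSum_excGF h0.le h2 hx0 hx1
      pos := fun s hs _ => Real.rpow_pos_of_pos hs b
      lt_two := h2
      const_nonneg := by
        have := Real.Gamma_pos_of_pos (show 0 < 1 + b by linarith)
        positivity
      tendsto := fun j hj => by
        rw [diffMoment_rpow h0 h1 h2 hj, ← mul_assoc, ← exc_const_eq h0 h2 hβ]
        exact tendsto_expDiff_excGF h0 h2 hβ hj }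
  exact H.tendsto_of_antitone (by linarith) excNorm_antitone

lemma cos_half_pi_mul_ne_zero {b : ℝ} (h0 : 0 < b) (h1 : b ≠ 1) (h2 : b < 2) :
    Real.cos (π * b / 2) ≠ 0 := by
  have hp := Real.pi_pos
  rcases lt_or_gt_of_ne h1 with h | h
  · exact (Real.cos_pos_of_mem_Ioo ⟨by nlinarith, by nlinarith⟩).ne'
  · exact (Real.cos_neg_of_pi_div_two_lt_of_lt (by nlinarith) (by nlinarith)).ne

/-- Passing from the normalised real coefficients to `cExc`. -/
lemma tendsto_cExc_of_excNorm {b : ℝ} {d : ℕ → ℝ}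
    (h : Filter.Tendsto (fun l => excNorm b l * 16 ^ l / d l) Filter.atTop (nhds 1)) :
    Filter.Tendsto (fun l : ℕ => cExc (2 * l) b / (d l : ℂ)) Filter.atTop (nhds 1) := by
  have h' := (Complex.continuous_ofReal.tendsto 1).comp h
  rw [Complex.ofReal_one] at h'
  refine h'.congr' ?_
  filter_upwards [Filter.eventually_ge_atTop 1] with l hl
  rw [cExc_eq_excNorm b hl]
  simp [Function.comp]

lemma tendsto_cExc_zero : Filter.Tendsto (fun l : ℕ => cExc (2 * l) 0 /
    ((π / ((l : ℝ) * Real.log l ^ 2) * (4 : ℝ) ^ (2 * l) : ℝ) : ℂ)) Filter.atTop (nhds 1) := by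
  refine tendsto_cExc_of_excNorm (tendsto_excNorm_zero.congr' ?_)
  filter_upwards [Filter.eventually_gt_atTop 1] with l hl
  have hl1 : (1:ℝ) < l := by exact_mod_cast hl
  have hlog : Real.log l ≠ 0 := (Real.log_pos hl1).ne'
  have hl0 : (l:ℝ) ≠ 0 := by positivity
  rw [one_div, Real.log_inv, pow_mul]
  have := Real.pi_ne_zero
  norm_num
  field_simp

lemma tendsto_cExc_Ioo {b : ℝ} (h0 : 0 < b) (h1 : b ≠ 1) (h2 : b < 2) :
    Filter.Tendsto (fun l : ℕ => cExc (2 * l) b /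
        ((Real.sin (π * b / 4) ^ 2 * (Real.Gamma (1 + b) / π) *
          (4 : ℝ) ^ (2 * ((l : ℝ) + 1 - b)) / (l : ℝ) ^ (b + 1) : ℝ) : ℂ))
        Filter.atTop (nhds 1) := by
  have hs : 0 < Real.sin (π * b / 4) :=
    Real.sin_pos_of_pos_of_lt_pi (by positivity) (by nlinarith [Real.pi_pos])
  have hG := Real.Gamma_pos_of_pos (show 0 < 1 + b by linarith)
  set c : ℝ := Real.sin (π * b / 4) ^ 2 * (Real.Gamma (1 + b) / π) with hc
  have hc0 : 0 < c := by positivity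
  have hc1 : c * 16 ^ (1 - b) ≠ 0 := by positivity
  have h := (tendsto_excNorm h0 h1 h2 (cos_half_pi_mul_ne_zero h0 h1 h2)).div_const
    (c * 16 ^ (1 - b))
  rw [div_self hc1] at h
  refine tendsto_cExc_of_excNorm (h.congr' ?_)
  filter_upwards [Filter.eventually_gt_atTop 0] with l hl
  have hl0 : (0:ℝ) < l := by exact_mod_cast hl
  have e1 : (4:ℝ) ^ (2 * ((l:ℝ) + 1 - b)) = 16 ^ l * 16 ^ (1 - b) := by
    rw [Real.rpow_mul (by norm_num), show (4:ℝ) ^ (2:ℝ) = 16 by norm_num,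
      show (l:ℝ) + 1 - b = l + (1 - b) by ring, Real.rpow_add (by norm_num), Real.rpow_natCast]
  rw [e1, Real.rpow_add hl0, Real.rpow_one, one_div, Real.inv_rpow hl0.le]
  have : (0:ℝ) < (l:ℝ) ^ b := by positivity
  have : (0:ℝ) < 16 ^ (1 - b) := by positivity
  field_simp

end Assembly

/-- Lemma 15 (asymptotics of the coefficients of `F(t,b)`): as `l → ∞`,
`c_{2l}(b) ∼ sin²(πb/4) (Γ(1+b)/π) 4^{2(l+1-b)}/l^{b+1}` for fixed `b ∈ (0,2)`,
`c_{2l}(0) ∼ (π/(l log² l)) 4^{2l}`, and `c_{2l}(2) ∼ 4^{2l}/(4πl³)`. -/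
theorem statement13 :
    (∀ b : ℝ, b ∈ Set.Ioo (0 : ℝ) 2 →
      Filter.Tendsto (fun l : ℕ => cExc (2 * l) b /
        ((Real.sin (π * b / 4) ^ 2 * (Real.Gamma (1 + b) / π) *
          (4 : ℝ) ^ (2 * ((l : ℝ) + 1 - b)) / (l : ℝ) ^ (b + 1) : ℝ) : ℂ))
        Filter.atTop (nhds 1)) ∧
    Filter.Tendsto (fun l : ℕ => cExc (2 * l) 0 /
        ((π / ((l : ℝ) * Real.log l ^ 2) * (4 : ℝ) ^ (2 * l) : ℝ) : ℂ))
      Filter.atTop (nhds 1) ∧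
    Filter.Tendsto (fun l : ℕ => cExc (2 * l) 2 /
        (((4 : ℝ) ^ (2 * l) / (4 * π * (l : ℝ) ^ 3) : ℝ) : ℂ))
      Filter.atTop (nhds 1) := by
  refine ⟨fun b hb => ?_, tendsto_cExc_zero, tendsto_cExc_two⟩
  rcases eq_or_ne b 1 with rfl | h1
  · refine tendsto_cExc_one.congr fun l => ?_
    congr 2
    have e1 : Real.sin (π * 1 / 4) ^ 2 = 1 / 2 := by
      rw [mul_one, Real.sin_pi_div_four, div_pow, Real.sq_sqrt zero_le_two]
      norm_num
    have e2 : (4:ℝ) ^ (2 * ((l:ℝ) + 1 - 1)) = 4 ^ (2 * l) := by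
      rw [← Real.rpow_natCast]; push_cast; ring_nf
    have e3 : (l:ℝ) ^ ((1:ℝ) + 1) = (l:ℝ) ^ 2 := by
      rw [← Real.rpow_natCast]; norm_num
    rw [e1, e2, e3, show (1:ℝ) + 1 = 2 by norm_num, Real.Gamma_two]
    ring
  · exact tendsto_cExc_Ioo hb.1 h1 hb.2

end
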